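/- arXiv:1309.7677 — 4 statements merged into one kernel-verified Lean document; each statement's English description precedes it below -/
import Mathlib

section
/- Let T be a tournament on n vertices, let t be an integer with t ≥ 2, and let L_1, …, L_t be integers with L_j ≥ 3 for all j and L_1 + … + L_t = n. If T is strongly 10^10·t^4·log t-connected, then T contains t pairwise vertex-disjoint directed cycles of lengths L_1, …, L_t (in particular, their vertex sets partition V(T)). -/
/-!
Common definitions: tournaments as irreflexive, asymmetric, total relations on a
finite vertex type; reachability/strong connectivity inside induced subtournaments;
directed paths and cycles as lists of vertices; linkedness; transitivity; domination.
All logarithms are base 2 (`Real.logb 2`).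
-/

variable {V : Type*}

/-- `adj` is (the edge relation of) a tournament on `V`. -/
def IsTournament (adj : V → V → Prop) : Prop :=
  (∀ v, ¬ adj v v) ∧ (∀ u v, adj u v → ¬ adj v u) ∧ (∀ u v, u ≠ v → adj u v ∨ adj v u)

/-- There is a directed path (possibly trivial) from `x` to `y` inside the induced
subtournament on `U`. -/
def ReachIn (adj : V → V → Prop) (U : Set V) (x y : V) : Prop :=
  Relation.ReflTransGen (fun a b => a ∈ U ∧ b ∈ U ∧ adj a b) x y

/-- The induced subtournament on `U` is strongly connected. -/
def StrConnOn (adj : V → V → Prop) (U : Set V) : Prop :=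
  ∀ x ∈ U, ∀ y ∈ U, ReachIn adj U x y

/-- The induced subtournament on `U` is strongly `k`-connected: it has more than `k`
vertices and removing any fewer than `k` vertices leaves it strongly connected. -/
def StrKConnOn (adj : V → V → Prop) (k : ℕ) (U : Set V) : Prop :=
  k < U.ncard ∧ ∀ S : Set V, S ⊆ U → S.ncard < k → StrConnOn adj (U \ S)

/-- The tournament is strongly `r`-connected for a real parameter `r`:
it has more than `r` vertices, and removal of any set of fewer than `r` vertices
leaves a strongly connected tournament. -/
def StrConnR [Fintype V] (adj : V → V → Prop) (r : ℝ) : Prop :=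
  r < (Fintype.card V : ℝ) ∧ ∀ S : Set V, (S.ncard : ℝ) < r → StrConnOn adj (Set.univ \ S)

/-- A directed path, recorded as its (nonempty, duplicate-free) list of vertices,
consecutive ones joined by edges. -/
def IsPathList (adj : V → V → Prop) (p : List V) : Prop :=
  p ≠ [] ∧ p.Nodup ∧ p.Chain' adj

/-- `p` is a directed path from `x` to `y`. -/
def PathFromTo (adj : V → V → Prop) (p : List V) (x y : V) : Prop :=
  IsPathList adj p ∧ p.head? = some x ∧ p.getLast? = some y

/-- The interior (internal vertices) of a path given as a list. -/
def Interior (p : List V) : List V := p.tail.dropLast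

/-- A directed cycle, recorded as a duplicate-free list of at least 3 vertices,
consecutive ones joined by edges, and an edge from the last vertex back to the first. -/
def IsCycleList (adj : V → V → Prop) (p : List V) : Prop :=
  3 ≤ p.length ∧ p.Nodup ∧ p.Chain' adj ∧ ∀ h : p ≠ [], adj (p.getLast h) (p.head h)

/-- A tournament is `k`-linked if it has at least `2k` vertices and any `2k` distinct
vertices `x₁,…,x_k,y₁,…,y_k` can be joined by vertex-disjoint directed paths
`Pᵢ : xᵢ → yᵢ`. -/
def KLinked [Fintype V] (adj : V → V → Prop) (k : ℕ) : Prop :=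
  2 * k ≤ Fintype.card V ∧
    ∀ x y : Fin k → V, Function.Injective (Sum.elim x y) →
      ∃ P : Fin k → List V,
        (∀ i, PathFromTo adj (P i) (x i) (y i)) ∧
        ∀ i j, i ≠ j → ∀ v ∈ P i, v ∉ P j

/-- The list `l` enumerates a transitive tournament: `l[i] → l[j]` iff `i < j`. -/
def TransList (adj : V → V → Prop) (l : List V) : Prop :=
  ∀ i j : Fin l.length, adj (l.get i) (l.get j) ↔ (i : ℕ) < (j : ℕ)

/-- The induced subtournament on `A` is transitive. -/
def IsTransSet (adj : V → V → Prop) (A : Set V) : Prop :=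
  ∃ l : List V, l.Nodup ∧ (∀ x, x ∈ l ↔ x ∈ A) ∧ TransList adj l

/-- The induced subtournament on `A` is transitive with sink `v`. -/
def IsTransSetSink (adj : V → V → Prop) (A : Set V) (v : V) : Prop :=
  ∃ l : List V, l.Nodup ∧ (∀ x, x ∈ l ↔ x ∈ A) ∧ TransList adj l ∧ l.getLast? = some v

/-- The induced subtournament on `A` is transitive with source `v`. -/
def IsTransSetSource (adj : V → V → Prop) (A : Set V) (v : V) : Prop :=
  ∃ l : List V, l.Nodup ∧ (∀ x, x ∈ l ↔ x ∈ A) ∧ TransList adj l ∧ l.head? = some v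

/-- `A` out-dominates `B`: every `b ∈ B` receives an edge from some `a ∈ A`. -/
def OutDominates (adj : V → V → Prop) (A B : Set V) : Prop := ∀ b ∈ B, ∃ a ∈ A, adj a b

/-- `A` in-dominates `B`: every `b ∈ B` sends an edge to some `a ∈ A`. -/
def InDominates (adj : V → V → Prop) (A B : Set V) : Prop := ∀ b ∈ B, ∃ a ∈ A, adj b a

/-- The list `l` enumerates a backwards-transitive path:
`l[i] → l[j]` iff `j = i + 1` or `i ≥ j + 2`. -/
def BackTransList (adj : V → V → Prop) (l : List V) : Prop :=
  ∀ i j : Fin l.length,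
    adj (l.get i) (l.get j) ↔ ((j : ℕ) = (i : ℕ) + 1 ∨ (j : ℕ) + 2 ≤ (i : ℕ))

/-- The induced subtournament on `Q` is a backwards-transitive path. -/
def IsBackTransPathSet (adj : V → V → Prop) (Q : Set V) : Prop :=
  ∃ l : List V, l ≠ [] ∧ l.Nodup ∧ (∀ x, x ∈ l ↔ x ∈ Q) ∧ BackTransList adj l

/-- The ordered pair `(x, y)` is `k`-connected in the induced subtournament on `U`:
after deleting any fewer than `k` vertices of `U` other than `x, y`,
there still is a directed path from `x` to `y`. -/
def KConnPair (adj : V → V → Prop) (U : Set V) (k : ℕ) (x y : V) : Prop :=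
  ∀ S : Set V, S ⊆ U \ {x, y} → S.ncard < k → ReachIn adj (U \ S) x y


section MyProof
open Classical

namespace Tp

theorem ReachIn.mono {adj : V → V → Prop} {U U' : Set V} {x y : V} (h : ReachIn adj U x y)
    (hs : U ⊆ U') : ReachIn adj U' x y :=
  Relation.ReflTransGen.mono (r := fun a b => a ∈ U ∧ b ∈ U ∧ adj a b)
    (fun _ _ h => ⟨hs h.1, hs h.2.1, h.2.2⟩) _ _ h

theorem ReachIn.edge {adj : V → V → Prop} {U : Set V} {x y : V} (hx : x ∈ U) (hy : y ∈ U)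
    (h : adj x y) : ReachIn adj U x y :=
  Relation.ReflTransGen.single ⟨hx, hy, h⟩

theorem ReachIn.trans' {adj : V → V → Prop} {U : Set V} {x y z : V} (h : ReachIn adj U x y)
    (h' : ReachIn adj U y z) : ReachIn adj U x z :=
  Relation.ReflTransGen.trans h h'

theorem ReachIn.flip {adj : V → V → Prop} {U : Set V} {x y : V} (h : ReachIn adj U x y) :
    ReachIn (flip adj) U y x := by
  unfold ReachIn at *
  induction h with
  | refl => exact .refl
  | tail _ h ih => exact .head ⟨h.2.1, h.1, h.2.2⟩ ih

theorem IsTournament.flip {adj : V → V → Prop} (h : IsTournament adj) :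
    IsTournament (flip adj) :=
  ⟨h.1, fun _ _ huv hvu => h.2.1 _ _ huv hvu, fun u v huv => (h.2.2 u v huv).symm⟩

theorem exitEdge {adj : V → V → Prop} {Z : Set V} {x y : V} (h : ReachIn adj Z x y)
    (S : V → Prop) (hx : S x) (hy : ¬ S y) : ∃ a b, a ∈ Z ∧ b ∈ Z ∧ adj a b ∧ S a ∧ ¬ S b := by
  unfold ReachIn at h
  induction h with
  | refl => exact absurd hx hy
  | tail _ h2 ih =>
    rename_i b c h1
    by_cases hb : S b
    · exact ⟨b, c, h2.1, h2.2.1, h2.2.2, hb, hy⟩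
    · exact ih hb

/-- cycle as a function on `0..k` -/
def Cyc (adj : V → V → Prop) (Z : Set V) (c : ℕ → V) (k : ℕ) : Prop :=
  2 ≤ k ∧ (∀ i ≤ k, ∀ j ≤ k, c i = c j → i = j) ∧ (∀ i < k, adj (c i) (c (i+1))) ∧
    adj (c k) (c 0) ∧ ∀ i ≤ k, c i ∈ Z

theorem Cyc.insert {adj : V → V → Prop} {Z : Set V} {c : ℕ → V} {k : ℕ} (h : Cyc adj Z c k)
    {v : V} (hv : v ∈ Z) (hn : ∀ i ≤ k, c i ≠ v) {i : ℕ} (hi : i ≤ k) (h1 : adj (c i) v)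
    (h2 : (i < k ∧ adj v (c (i+1))) ∨ (i = k ∧ adj v (c 0))) :
    ∃ c', Cyc adj Z c' (k+1) := by
  obtain ⟨hk, hinj, hadj, hlast, hZ⟩ := h
  refine ⟨fun s => if s ≤ i then c s else if s = i+1 then v else c (s-1), by omega, ?_, ?_, ?_, ?_⟩
  · intro a ha b hb hab
    by_cases ha1 : a ≤ i <;> by_cases hb1 : b ≤ i <;> by_cases ha2 : a = i+1 <;>
      by_cases hb2 : b = i+1 <;> simp only [ha1, hb1, ha2, hb2, if_true, if_false] at hab <;>
      first
      | omega
      | (have := hinj _ (by omega) _ (by omega) hab; omega)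
      | (subst_vars; simp at hab; first | exact absurd hab (hn _ (by omega)) | exact absurd hab.symm (hn _ (by omega)))
  · intro s hs
    rcases lt_trichotomy s i with h | h | h
    · simp only [h.le, if_true, show s + 1 ≤ i by omega]; exact hadj _ (by omega)
    · subst h; simpa using h1
    · by_cases h3 : s = i+1
      · subst h3
        simp only [show ¬ (i + 1 ≤ i) by omega, show ¬ (i+1+1 ≤ i) by omega, if_false, if_true,
          show ¬ (i+1+1 = i+1) by omega]
        rcases h2 with h2 | h2
        · simpa using h2.2
        · omega
      · simp only [show ¬ (s ≤ i) by omega, show ¬ (s+1 ≤ i) by omega, if_false, h3,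
          show ¬ (s+1 = i+1) by omega]
        have := hadj (s-1) (by omega)
        rwa [show s - 1 + 1 = s + 1 - 1 by omega] at this
  · simp only [Nat.zero_le, if_true, show ¬ (k+1 ≤ i) by omega, if_false]
    rcases h2 with h2 | h2
    · simpa [show k ≠ i by omega] using hlast
    · simpa [h2.1] using h2.2
  · intro s hs
    dsimp only
    split_ifs
    · exact hZ _ (by omega)
    · exact hv
    · exact hZ _ (by omega)

theorem Cyc.append {adj : V → V → Prop} {Z : Set V} {c : ℕ → V} {k : ℕ} (h : Cyc adj Z c k)
    {d e : V} (hd : d ∈ Z) (he : e ∈ Z) (hnd : ∀ i ≤ k, c i ≠ d) (hne : ∀ i ≤ k, c i ≠ e)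
    (hde : d ≠ e)  (h1 : adj (c k) d) (h2 : adj d e) (h3 : adj e (c 0)) :
    ∃ c', Cyc adj Z c' (k+2) := by
  obtain ⟨hk, hinj, hadj, hlast, hZ⟩ := h
  refine ⟨fun s => if s ≤ k then c s else if s = k+1 then d else e, by omega, ?_, ?_, ?_, ?_⟩
  · intro a ha b hb hab
    dsimp only at hab
    split_ifs at hab
    · exact hinj _ ‹_› _ ‹_› hab
    · exact absurd hab (hnd _ ‹_›)
    · exact absurd hab (hne _ ‹_›)
    · exact absurd hab.symm (hnd _ ‹_›)
    · omega
    · exact absurd hab hde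
    · exact absurd hab.symm (hne _ ‹_›)
    · exact absurd hab.symm hde
    · omega
  · intro s hs
    rcases lt_trichotomy s k with h | h | h
    · simp only [h.le, if_true, show s + 1 ≤ k by omega]; exact hadj _ (by omega)
    · subst h; simpa using h1
    · have : s = k+1 := by omega
      subst this
      simpa using h2
  · simpa using h3
  · intro s hs
    dsimp only
    split_ifs
    · exact hZ _ (by omega)
    · exact hd
    · exact he

theorem exists_max (P : ℕ → Prop) (B : ℕ) (hB : ∀ k, P k → k ≤ B) (h : ∃ k, P k) :
    ∃ k, P k ∧ ∀ m, P m → m ≤ k := by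
  obtain ⟨k, hk⟩ := h
  refine ⟨Nat.findGreatest P B, Nat.findGreatest_spec (hB k hk) hk, fun m hm => ?_⟩
  exact Nat.le_findGreatest (hB m hm) hm

theorem exists_cyc [Fintype V] {adj : V → V → Prop} (hT : IsTournament adj) {Z : Finset V}
    (hZ : StrConnOn adj (Z : Set V)) (h3 : 2 ≤ Z.card) :
    ∃ c k, Cyc adj (Z : Set V) c k ∧ ∀ z ∈ Z, ∃ i ≤ k, c i = z := by
  have base : ∃ k c, Cyc adj (Z : Set V) c k := by
    obtain ⟨v, hv, u, hu, huv⟩ := Finset.one_lt_card.1 (show 1 < Z.card by omega)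
    obtain ⟨v', w, _, hw, hvw, hv', hwv⟩ := exitEdge (hZ v hv u hu) (fun z => z = v) rfl huv.symm
    obtain ⟨a, b, ha, hb, hab, hSa, hSb⟩ := exitEdge (hZ w hw _ hv) (fun z => adj v z) (hv' ▸ hvw) (hT.1 _)
    have hbv : b ≠ v := by rintro rfl; exact hT.2.1 _ _ hab hSa
    have hbv' : adj b v := (hT.2.2 b v hbv).resolve_right hSb
    have hne : ∀ {x y}, adj x y → x ≠ y := fun h e => hT.1 _ (e ▸ h)
    refine ⟨2, fun s => if s = 0 then v else if s = 1 then a else b, le_rfl, ?_, ?_, ?_, ?_⟩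
    · intro i hi j hj hij
      have e1 := hne hSa
      have e2 := hne hab
      interval_cases i <;> interval_cases j <;> simp_all
    · intro i hi
      interval_cases i <;> simp [hSa, hab]
    · simpa using hbv'
    · intro i hi
      dsimp only
      split_ifs
      · exact hv
      · exact ha
      · exact hb
  obtain ⟨k, ⟨c, hc⟩, hmax⟩ := exists_max (fun k => ∃ c, Cyc adj (Z : Set V) c k) (Fintype.card V)
    (by
      rintro k ⟨c, hc⟩
      have := Finset.card_le_card_of_injOn (s := Finset.range (k+1)) (t := (Finset.univ : Finset V)) c
        (by intro _ _; simp)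
        (by
          intro a ha b hb hab
          simp at ha hb
          exact hc.2.1 a (by omega) b (by omega) hab)
      simp at this
      omega) base
  refine ⟨c, k, hc, ?_⟩
  by_contra hcon
  push Not at hcon
  obtain ⟨z, hz, hzc⟩ := hcon
  have key : ∀ v ∈ Z, (∀ i ≤ k, c i ≠ v) → (∀ i ≤ k, adj (c i) v) ∨ (∀ i ≤ k, adj v (c i)) := by
    intro v hv hvc
    by_contra hno
    push Not at hno
    obtain ⟨⟨p, hp, hp'⟩, ⟨q, hq, hq'⟩⟩ := hno
    have hq'' : adj (c q) v := (hT.2.2 _ _ (hvc q hq)).resolve_right hq'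
    have step : ∀ i ≤ k, adj (c i) v → ¬ ((i < k ∧ adj v (c (i+1))) ∨ (i = k ∧ adj v (c 0))) := by
      intro i hi h1 h2
      obtain ⟨c', hc'⟩ := Cyc.insert hc hv hvc hi h1 h2
      have := hmax _ ⟨c', hc'⟩
      omega
    have fwd : ∀ i ≤ k, adj (c i) v → ∀ d, i + d ≤ k → adj (c (i+d)) v := by
      intro i hi h1 d
      induction d with
      | zero => intro _; exact h1
      | succ d ih =>
        intro hd
        have h2 := step _ (by omega) (ih (by omega))
        rcases hT.2.2 _ _ (hvc (i+(d+1)) hd) with h | h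
        · exact h
        · exact absurd (Or.inl ⟨by omega, h⟩) h2
    have hk := fwd q hq hq'' (k - q) (by omega)
    rw [show q + (k-q) = k by omega] at hk
    have h0 : adj (c 0) v := by
      rcases hT.2.2 _ _ (hvc 0 (by omega)) with h | h
      · exact h
      · exact absurd (Or.inr ⟨rfl, h⟩) (step k le_rfl hk)
    have := fwd 0 (by omega) h0 p (by omega)
    rw [Nat.zero_add] at this
    exact hp' this
  have hc0 : c 0 ∈ (Z : Set V) := hc.2.2.2.2 0 (by omega)
  have app : ∀ d ∈ Z, ∀ e ∈ Z, (∀ i ≤ k, c i ≠ d) → (∀ i ≤ k, c i ≠ e) → adj d e →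
      (∀ i ≤ k, adj (c i) d) → ¬ (∀ i ≤ k, adj e (c i)) := by
    intro d hd e he hdc hec hde h1 h2
    obtain ⟨c', hc'⟩ := Cyc.append hc hd he hdc hec (fun h => hT.1 _ (h ▸ hde)) (h1 k le_rfl) hde
      (h2 0 (by omega))
    have := hmax _ ⟨c', hc'⟩
    omega
  rcases key z hz hzc with h | h
  · obtain ⟨a, b, ha, hb, hab, hSa, hSb⟩ := exitEdge (hZ z hz _ hc0)
      (fun y => (∀ i ≤ k, c i ≠ y) ∧ ∀ i ≤ k, adj (c i) y) ⟨hzc, h⟩ (fun h => h.1 0 (by omega) rfl)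
    by_cases hbc : ∀ i ≤ k, c i ≠ b
    · rcases key b hb hbc with h' | h'
      · exact hSb ⟨hbc, h'⟩
      · exact app a ha b hb hSa.1 hbc hab hSa.2 h'
    · push Not at hbc
      obtain ⟨i, hi, rfl⟩ := hbc
      exact hT.2.1 _ _ hab (hSa.2 i hi)
  · obtain ⟨a, b, ha, hb, hab, hSa, hSb⟩ := exitEdge (hZ _ hc0 z hz)
      (fun y => ¬ ((∀ i ≤ k, c i ≠ y) ∧ ∀ i ≤ k, adj y (c i))) (fun h => h.1 0 (by omega) rfl)
      (not_not.2 ⟨hzc, h⟩)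
    rw [not_not] at hSb
    by_cases hac : ∀ i ≤ k, c i ≠ a
    · rcases key a ha hac with h' | h'
      · exact app a ha b hb hac hSb.1 hab h' hSb.2
      · exact hSa ⟨hac, h'⟩
    · push Not at hac
      obtain ⟨i, hi, rfl⟩ := hac
      exact hT.2.1 _ _ hab (hSb.2 i hi)

theorem camion [Fintype V] {adj : V → V → Prop} (hT : IsTournament adj) {Z : Finset V}
    (hZ : StrConnOn adj (Z : Set V)) (h3 : 3 ≤ Z.card) :
    ∃ p : List V, IsCycleList adj p ∧ p.length = Z.card ∧ ∀ v, v ∈ p ↔ v ∈ Z := by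
  obtain ⟨c, k, ⟨hk, hinj, hadj, hlast, hcZ⟩, hcov⟩ := exists_cyc hT hZ (by omega)
  set p := List.ofFn (fun i : Fin (k+1) => c i) with hp
  have hmem : ∀ v, v ∈ p ↔ v ∈ Z := by
    intro v
    rw [hp, List.mem_ofFn]
    constructor
    · rintro ⟨i, rfl⟩
      exact hcZ i (by omega)
    · intro hv
      obtain ⟨i, hi, rfl⟩ := hcov v hv
      exact ⟨⟨i, by omega⟩, rfl⟩
  have hnd : p.Nodup := by
    rw [hp, List.nodup_ofFn]
    intro i j hij
    exact Fin.ext (hinj i (by omega) j (by omega) hij)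
  refine ⟨p, ⟨by simp [hp]; omega, hnd, ?_, ?_⟩, ?_, hmem⟩
  · rw [hp]
    exact List.isChain_ofFn.2 (fun i hi => hadj i (by omega))
  · intro h
    rw [List.getLast_eq_getElem, List.head_eq_getElem]
    simp only [hp, List.getElem_ofFn, List.length_ofFn]
    simpa using hlast
  · have : p.toFinset = Z := by ext v; simp [hmem]
    rw [← this, List.toFinset_card_of_nodup hnd]


/-- in-neighbourhood -/
noncomputable def inN [Fintype V] (adj : V → V → Prop) (v : V) : Finset V :=
  Finset.univ.filter (fun u => adj u v)

/-- out-neighbourhood -/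
noncomputable def outN [Fintype V] (adj : V → V → Prop) (v : V) : Finset V :=
  Finset.univ.filter (fun u => adj v u)

theorem mem_inN [Fintype V] {adj : V → V → Prop} {u v : V} : u ∈ inN adj v ↔ adj u v := by
  simp [inN]

theorem mem_outN [Fintype V] {adj : V → V → Prop} {u v : V} : u ∈ outN adj v ↔ adj v u := by
  simp [outN]

theorem halving {adj : V → V → Prop} (hT : IsTournament adj) {U : Finset V} (hU : U.Nonempty) :
    ∃ a ∈ U, 2 * (U.filter (fun u => adj u a)).card ≤ U.card := by
  by_contra hcon
  push Not at hcon
  have h1 : ∑ a ∈ U, (U.filter (fun u => adj u a)).card = ∑ a ∈ U, (U.filter (fun u => adj a u)).card :=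
    (Finset.sum_card_bipartiteAbove_eq_sum_card_bipartiteBelow (s := U) (t := U) adj).symm
  have h2 : ∑ a ∈ U, ((U.filter (fun u => adj u a)).card + (U.filter (fun u => adj a u)).card)
      ≤ ∑ a ∈ U, U.card := by
    apply Finset.sum_le_sum
    intro a _
    rw [← Finset.card_union_of_disjoint]
    · apply Finset.card_le_card
      intro x hx
      simp only [Finset.mem_union, Finset.mem_filter] at hx
      tauto
    · rw [Finset.disjoint_left]
      intro x hx hx'
      simp only [Finset.mem_filter] at hx hx'
      exact hT.2.1 _ _ hx.2 hx'.2
  have h3 : ∑ a ∈ U, U.card < ∑ a ∈ U, 2 * (U.filter (fun u => adj u a)).card :=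
    Finset.sum_lt_sum_of_nonempty hU hcon
  rw [Finset.sum_add_distrib, ← h1] at h2
  rw [← Finset.mul_sum] at h3
  omega

theorem lemH {adj : V → V → Prop} (hT : IsTournament adj) (c : ℕ) : ∀ {U : Finset V}, U.Nonempty →
    ∃ A ⊆ U, ∃ s ∈ A, A.card ≤ c + 1 ∧ (∀ a ∈ A, a = s ∨ adj s a) ∧ ∃ E : Finset V,
      2 ^ c * E.card ≤ U.card ∧ ∀ u ∈ U, u ∈ A ∨ u ∈ E ∨ ∃ a ∈ A, adj a u := by
  induction c with
  | zero =>
    intro U hU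
    obtain ⟨a, ha⟩ := hU
    refine ⟨{a}, by simpa using ha, a, by simp, by simp, by simp, U, by simp, ?_⟩
    intro u hu
    exact Or.inr (Or.inl hu)
  | succ c ih =>
    intro U hU
    obtain ⟨a, ha, hcard⟩ := halving hT hU
    set U' := U.filter (fun u => adj u a) with hU'
    have htri : ∀ u ∈ U, u = a ∨ u ∈ U' ∨ adj a u := by
      intro u hu
      by_cases h : u = a
      · exact Or.inl h
      · rcases hT.2.2 _ _ h with h | h
        · exact Or.inr (Or.inl (by simp [hU', hu, h]))
        · exact Or.inr (Or.inr h)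
    rcases U'.eq_empty_or_nonempty with h0 | h0
    · refine ⟨{a}, by simpa using ha, a, by simp, by simp, by simp, ∅, by simp, ?_⟩
      intro u hu
      rcases htri u hu with h | h | h
      · simp [h]
      · simp [h0] at h
      · right; right; exact ⟨a, by simp, h⟩
    · obtain ⟨A, hA, s, hs, hAc, hsrc, E, hE, hdom⟩ := ih h0
      have hUU : U' ⊆ U := Finset.filter_subset _ _
      refine ⟨insert a A, ?_, s, by simp [hs], ?_, ?_, E, ?_, ?_⟩
      · intro x hx
        rcases Finset.mem_insert.1 hx with rfl | hx
        · exact ha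
        · exact hUU (hA hx)
      · have := Finset.card_insert_le a A
        omega
      · intro x hx
        rcases Finset.mem_insert.1 hx with rfl | hx
        · right
          have := hA hs
          rw [hU', Finset.mem_filter] at this
          exact this.2
        · exact hsrc x hx
      · rw [pow_succ]
        nlinarith
      · intro u hu
        rcases htri u hu with h | h | h
        · left; simp [h]
        · rcases hdom u h with h | h | ⟨b, hb, h⟩
          · left; simp [h]
          · exact Or.inr (Or.inl h)
          · right; right; exact ⟨b, by simp [hb], h⟩
        · right; right; exact ⟨a, by simp, h⟩

theorem domOne [Fintype V] {adj : V → V → Prop} (hT : IsTournament adj) (c : ℕ) (F0 : Finset V)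
    (hF : F0.card < Fintype.card V) :
    ∃ (A : Finset V) (s : V) (E : Finset V), s ∈ A ∧ Disjoint F0 A ∧ A.card ≤ c + 2 ∧
      (∀ a ∈ A, a = s ∨ adj s a) ∧
      (∀ u, u ∉ F0 → u ∉ A → u ∈ E ∨ ∃ a ∈ A, adj a u) ∧
      (∀ u, u ∉ F0 → 2 ^ c * E.card ≤ (inN adj u).card) := by
  have hne : (Finset.univ \ F0).Nonempty := by
    rw [← Finset.card_pos, Finset.card_sdiff_of_subset (Finset.subset_univ _), Finset.card_univ]
    omega
  obtain ⟨v, hv, hmin⟩ := Finset.exists_min_image _ (fun v => (inN adj v).card) hne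
  simp only [Finset.mem_sdiff, Finset.mem_univ, true_and] at hv hmin
  set U := inN adj v \ F0 with hU
  have htri : ∀ u, u ∉ F0 → u = v ∨ u ∈ U ∨ adj v u := by
    intro u hu
    by_cases h : u = v
    · exact Or.inl h
    · rcases hT.2.2 _ _ h with h | h
      · exact Or.inr (Or.inl (by simp [hU, hu, h, mem_inN]))
      · exact Or.inr (Or.inr h)
  rcases U.eq_empty_or_nonempty with h0 | h0
  · refine ⟨{v}, v, ∅, by simp, by simpa using hv, by simp, by simp, ?_, by simp⟩
    intro u hu huv
    rcases htri u hu with h | h | h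
    · simp [h] at huv
    · simp [h0] at h
    · right; exact ⟨v, by simp, h⟩
  · obtain ⟨A, hA, s, hs, hAc, hsrc, E, hE, hdom⟩ := lemH hT c h0
    refine ⟨insert v A, s, E, by simp [hs], ?_, ?_, ?_, ?_, ?_⟩
    · rw [Finset.disjoint_right]
      intro x hx
      rcases Finset.mem_insert.1 hx with rfl | hx
      · exact hv
      · exact (Finset.mem_sdiff.1 (hA hx)).2
    · have := Finset.card_insert_le v A
      omega
    · intro x hx
      rcases Finset.mem_insert.1 hx with rfl | hx
      · right
        have := hA hs
        rw [hU, Finset.mem_sdiff, mem_inN] at this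
        exact this.1
      · exact hsrc x hx
    · intro u hu huA
      rcases htri u hu with h | h | h
      · simp [h] at huA
      · rcases hdom u h with h | h | ⟨b, hb, h⟩
        · simp [h] at huA
        · exact Or.inl h
        · right; exact ⟨b, by simp [hb], h⟩
      · right; exact ⟨v, by simp, h⟩
    · intro u hu
      refine hE.trans ((Finset.card_le_card ?_).trans (hmin u hu))
      exact Finset.sdiff_subset

/-- family of dominating sets -/
structure DomFam [Fintype V] (adj : V → V → Prop) (F0 : Finset V) (N c : ℕ) (A : ℕ → Finset V)
    (s : ℕ → V) (E : ℕ → Finset V) : Prop where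
  disj : ∀ i < N, ∀ j < N, i ≠ j → Disjoint (A i) (A j)
  dF : ∀ i < N, Disjoint F0 (A i)
  card : ∀ i < N, (A i).card ≤ c + 2
  smem : ∀ i < N, s i ∈ A i
  src : ∀ i < N, ∀ a ∈ A i, a = s i ∨ adj (s i) a
  dom : ∀ i < N, ∀ v, v ∉ F0 → (∀ j < N, v ∉ A j) → v ∈ E i ∨ ∃ a ∈ A i, adj a v
  small : ∀ i < N, ∀ v, v ∉ F0 → (∀ j < N, v ∉ A j) → 2 ^ c * (E i).card ≤ (inN adj v).card

theorem domFam_exists [Fintype V] {adj : V → V → Prop} (hT : IsTournament adj) (c : ℕ) (F0 : Finset V)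
    (N : ℕ) (hF : F0.card + N * (c + 2) < Fintype.card V) :
    ∃ A s E, DomFam adj F0 N c A s E := by
  induction N with
  | zero =>
    have : 0 < Fintype.card V := by omega
    obtain ⟨v⟩ := Fintype.card_pos_iff.1 this
    refine ⟨fun _ => ∅, fun _ => v, fun _ => ∅, ?_⟩
    constructor <;> intro i hi <;> omega
  | succ N ih =>
    obtain ⟨A, s, E, h⟩ := ih (by nlinarith)
    set F1 := F0 ∪ (Finset.range N).biUnion A with hF1
    have hc1 : F1.card < Fintype.card V := by
      have h1 := Finset.card_union_le F0 ((Finset.range N).biUnion A)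
      have h2 : ((Finset.range N).biUnion A).card ≤ (Finset.range N).card * (c+2) :=
        Finset.card_biUnion_le_card_mul _ _ _ (fun i hi => h.card i (by simpa using hi))
      rw [Finset.card_range] at h2
      have : (N + 1) * (c+2) = N * (c+2) + (c + 2) := by ring
      rw [← hF1] at h1
      omega
    obtain ⟨A', s', E', hs', hd', hc', hsrc', hdom', hsm'⟩ := domOne hT c F1 hc1
    rw [hF1, Finset.disjoint_union_left, Finset.disjoint_biUnion_left] at hd'
    have memF : ∀ v, v ∉ F0 → (∀ j < N, v ∉ A j) → v ∉ F1 := by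
      intro v h1 h2
      simp only [hF1, Finset.mem_union, Finset.mem_biUnion, Finset.mem_range, not_or, not_exists, not_and]
      exact ⟨h1, h2⟩
    refine ⟨fun i => if i = N then A' else A i, fun i => if i = N then s' else s i,
      fun i => if i = N then E' else E i, ?_, ?_, ?_, ?_, ?_, ?_, ?_⟩
    · intro i hi j hj hij
      split_ifs with h1 h2 h2
      · omega
      · exact (hd'.2 j (by simp; omega)).symm
      · exact hd'.2 i (by simp; omega)
      · exact h.disj i (by omega) j (by omega) hij
    · intro i hi
      split_ifs with h1
      · exact hd'.1
      · exact h.dF i (by omega)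
    · intro i hi
      split_ifs with h1
      · exact hc'
      · exact h.card i (by omega)
    · intro i hi
      split_ifs with h1
      · exact hs'
      · exact h.smem i (by omega)
    · intro i hi
      split_ifs with h1
      · exact hsrc'
      · exact h.src i (by omega)
    all_goals
      intro i hi v hv hvA
      have hvA1 : ∀ j < N, v ∉ A j := by
        intro j hj
        have := hvA j (by omega)
        simpa [show j ≠ N by omega] using this
      have hvA2 : v ∉ A' := by
        have := hvA N (by omega)
        simpa using this
      split_ifs with h1
    · exact hdom' v (memF v hv hvA1) hvA2
    · exact h.dom i (by omega) v hv hvA1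
    · exact hsm' v (memF v hv hvA1)
    · exact h.small i (by omega) v hv hvA1


/-- natural-number connectivity -/
def KC [Fintype V] (adj : V → V → Prop) (K : ℕ) : Prop :=
  K < Fintype.card V ∧ ∀ S : Finset V, S.card < K → StrConnOn adj {v | v ∉ S}

theorem KC.flip [Fintype V] {adj : V → V → Prop} {K : ℕ} (h : KC adj K) : KC (flip adj) K :=
  ⟨h.1, fun S hS x hx y hy => ReachIn.flip (h.2 S hS y hy x hx)⟩

theorem KC.indeg [Fintype V] {adj : V → V → Prop} {K : ℕ} (h : KC adj K) (hT : IsTournament adj)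
    (v : V) : K ≤ (inN adj v).card := by
  by_contra hlt
  push Not at hlt
  have hc : (insert v (inN adj v)).card < (Finset.univ : Finset V).card := by
    have := Finset.card_insert_le v (inN adj v)
    have := h.1
    rw [Finset.card_univ]
    omega
  obtain ⟨u, _, hu⟩ := Finset.exists_mem_notMem_of_card_lt_card hc
  rw [Finset.mem_insert, not_or] at hu
  obtain ⟨a, b, ha, hb, hab, h1, h2⟩ := exitEdge (h.2 _ hlt u hu.2 v (by simp [mem_inN, hT.1]))
    (fun z => z ≠ v) hu.1 (by simp)
  rw [not_not] at h2
  subst h2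
  exact ha (mem_inN.2 hab)

theorem KC.outdeg [Fintype V] {adj : V → V → Prop} {K : ℕ} (h : KC adj K) (hT : IsTournament adj)
    (v : V) : K ≤ (outN adj v).card :=
  h.flip.indeg (IsTournament.flip hT) v

/-- the bundle of dominating sets -/
structure Dt [Fintype V] (adj : V → V → Prop) (N c : ℕ) where
  A : ℕ → Finset V
  B : ℕ → Finset V
  a : ℕ → V
  b : ℕ → V
  Em : ℕ → Finset V
  Ep : ℕ → Finset V
  F : Finset V
  hF : ∀ v, v ∈ F ↔ ∃ i < N, v ∈ A i ∨ v ∈ B i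
  dAA : ∀ i < N, ∀ j < N, i ≠ j → Disjoint (A i) (A j)
  dBB : ∀ i < N, ∀ j < N, i ≠ j → Disjoint (B i) (B j)
  dAB : ∀ i < N, ∀ j < N, Disjoint (A i) (B j)
  cA : ∀ i < N, (A i).card ≤ c + 2
  cB : ∀ i < N, (B i).card ≤ c + 2
  amem : ∀ i < N, a i ∈ A i
  bmem : ∀ i < N, b i ∈ B i
  asrc : ∀ i < N, ∀ x ∈ A i, x = a i ∨ adj (a i) x
  bsnk : ∀ i < N, ∀ x ∈ B i, x = b i ∨ adj x (b i)
  domA : ∀ i < N, ∀ v, v ∉ F → v ∈ Em i ∨ ∃ x ∈ A i, adj x v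
  domB : ∀ i < N, ∀ v, v ∉ F → v ∈ Ep i ∨ ∃ x ∈ B i, adj v x
  smA : ∀ i < N, ∀ v, v ∉ F → 2 ^ c * (Em i).card ≤ (inN adj v).card
  smB : ∀ i < N, ∀ v, v ∉ F → 2 ^ c * (Ep i).card ≤ (outN adj v).card

/-- dual bundle -/
def Dt.flip [Fintype V] {adj : V → V → Prop} {N c : ℕ} (D : Dt adj N c) : Dt (flip adj) N c where
  A := D.B
  B := D.A
  a := D.b
  b := D.a
  Em := D.Ep
  Ep := D.Em
  F := D.F
  hF := fun v => (D.hF v).trans (by simp only [or_comm])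
  dAA := D.dBB
  dBB := D.dAA
  dAB := fun i hi j hj => (D.dAB j hj i hi).symm
  cA := D.cB
  cB := D.cA
  amem := D.bmem
  bmem := D.amem
  asrc := D.bsnk
  bsnk := D.asrc
  domA := D.domB
  domB := D.domA
  smA := D.smB
  smB := D.smA

theorem dt_exists [Fintype V] {adj : V → V → Prop} (hT : IsTournament adj) (N c : ℕ)
    (hF : 2 * N * (c + 2) < Fintype.card V) : ∃ _D : Dt adj N c, True := by
  obtain ⟨A, a, Em, hA⟩ := domFam_exists hT c ∅ N (by simp; nlinarith)
  have h2 : ((Finset.range N).biUnion A).card ≤ (Finset.range N).card * (c+2) :=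
        Finset.card_biUnion_le_card_mul _ _ _ (fun i hi => hA.card i (by simpa using hi))
  rw [Finset.card_range] at h2
  obtain ⟨B, b, Ep, hB⟩ := domFam_exists (IsTournament.flip hT) c ((Finset.range N).biUnion A) N
    (by nlinarith)
  have hm : ∀ v, v ∉ ((Finset.range N).biUnion A) ∪ ((Finset.range N).biUnion B) →
    v ∉ (∅ : Finset V) ∧ v ∉ ((Finset.range N).biUnion A) ∧ (∀ j < N, v ∉ A j) ∧ (∀ j < N, v ∉ B j) := by
    intro v hv
    simp only [Finset.mem_union, Finset.mem_biUnion, Finset.mem_range, not_or, not_exists, not_and] at hv ⊢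
    exact ⟨by simp, hv.1, hv.1, hv.2⟩
  refine ⟨⟨A, B, a, b, Em, Ep, ((Finset.range N).biUnion A) ∪ ((Finset.range N).biUnion B), ?_,
    hA.disj, hB.disj, ?_, hA.card, hB.card, hA.smem, hB.smem, hA.src, hB.src, ?_, ?_, ?_, ?_⟩, trivial⟩
  · intro v
    simp only [Finset.mem_union, Finset.mem_biUnion, Finset.mem_range]
    constructor
    · rintro (⟨i, hi, h⟩ | ⟨i, hi, h⟩)
      · exact ⟨i, hi, Or.inl h⟩
      · exact ⟨i, hi, Or.inr h⟩
    · rintro ⟨i, hi, h | h⟩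
      · exact Or.inl ⟨i, hi, h⟩
      · exact Or.inr ⟨i, hi, h⟩
  · intro i hi j hj
    have := hB.dF j hj
    rw [Finset.disjoint_biUnion_left] at this
    exact this i (by simpa using hi)
  · intro i hi v hv
    exact hA.dom i hi v (hm v hv).1 (hm v hv).2.2.1
  · intro i hi v hv
    exact hB.dom i hi v (hm v hv).2.1 (hm v hv).2.2.2
  · intro i hi v hv
    exact hA.small i hi v (hm v hv).1 (hm v hv).2.2.1
  · intro i hi v hv
    exact hB.small i hi v (hm v hv).2.1 (hm v hv).2.2.2

/-- union of the exceptional sets -/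
noncomputable def Dt.EM [Fintype V] {adj : V → V → Prop} {N c : ℕ} (D : Dt adj N c) : Finset V :=
  (Finset.range N).biUnion D.Em
/-- union of the exceptional sets -/
noncomputable def Dt.EP [Fintype V] {adj : V → V → Prop} {N c : ℕ} (D : Dt adj N c) : Finset V :=
  (Finset.range N).biUnion D.Ep

theorem Dt.EM_sub [Fintype V] {adj : V → V → Prop} {N c : ℕ} (D : Dt adj N c) {i : ℕ} (hi : i < N) :
    D.Em i ⊆ D.EM := Finset.subset_biUnion_of_mem D.Em (by simpa using hi)
theorem Dt.EP_sub [Fintype V] {adj : V → V → Prop} {N c : ℕ} (D : Dt adj N c) {i : ℕ} (hi : i < N) :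
    D.Ep i ⊆ D.EP := Finset.subset_biUnion_of_mem D.Ep (by simpa using hi)

theorem Dt.EM_small [Fintype V] {adj : V → V → Prop} {N c : ℕ} (D : Dt adj N c)
    (hc : 8 * N ≤ 2 ^ c) {v : V} (hv : v ∉ D.F) : 8 * D.EM.card ≤ (inN adj v).card := by
  rcases Nat.eq_zero_or_pos N with h0 | h0
  · subst h0; simp [Dt.EM]
  have h1 : D.EM.card ≤ ∑ i ∈ Finset.range N, (D.Em i).card := Finset.card_biUnion_le
  have h2 : ∑ i ∈ Finset.range N, 8 * N * (D.Em i).card ≤ ∑ i ∈ Finset.range N, (inN adj v).card := by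
    apply Finset.sum_le_sum
    intro i hi
    refine le_trans ?_ (D.smA i (by simpa using hi) v hv)
    gcongr
  rw [← Finset.mul_sum, Finset.sum_const, Finset.card_range, smul_eq_mul] at h2
  have h3 : N * (8 * D.EM.card) ≤ N * (inN adj v).card := by nlinarith
  exact Nat.le_of_mul_le_mul_left h3 h0

theorem Dt.EP_small [Fintype V] {adj : V → V → Prop} {N c : ℕ} (D : Dt adj N c)
    (hc : 8 * N ≤ 2 ^ c) {v : V} (hv : v ∉ D.F) : 8 * D.EP.card ≤ (outN adj v).card :=
  D.flip.EM_small hc hv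

theorem Dt.F_card [Fintype V] {adj : V → V → Prop} {N c : ℕ} (D : Dt adj N c) :
    D.F.card ≤ 2 * N * (c + 2) := by
  have : D.F ⊆ ((Finset.range N).biUnion D.A) ∪ ((Finset.range N).biUnion D.B) := by
    intro v hv
    obtain ⟨i, hi, h | h⟩ := (D.hF v).1 hv
    · exact Finset.mem_union_left _ (Finset.mem_biUnion.2 ⟨i, by simpa using hi, h⟩)
    · exact Finset.mem_union_right _ (Finset.mem_biUnion.2 ⟨i, by simpa using hi, h⟩)
  have h1 := Finset.card_le_card this
  have h2 := Finset.card_union_le ((Finset.range N).biUnion D.A) ((Finset.range N).biUnion D.B)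
  have h3 : ((Finset.range N).biUnion D.A).card ≤ (Finset.range N).card * (c+2) :=
        Finset.card_biUnion_le_card_mul _ _ _ (fun i hi => D.cA i (by simpa using hi))
  have h4 : ((Finset.range N).biUnion D.B).card ≤ (Finset.range N).card * (c+2) :=
        Finset.card_biUnion_le_card_mul _ _ _ (fun i hi => D.cB i (by simpa using hi))
  rw [Finset.card_range] at h3 h4
  nlinarith

/-- protected sets -/
def Prot (adj : V → V → Prop) (EM EP H : Finset V) : Prop :=
  ∀ h ∈ H, (h ∉ EM ∨ ∃ h' ∈ H, adj h' h ∧ h' ∉ EM) ∧ (h ∉ EP ∨ ∃ h' ∈ H, adj h h' ∧ h' ∉ EP)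

theorem Prot.union {adj : V → V → Prop} {EM EP H H' : Finset V} (h1 : Prot adj EM EP H)
    (h2 : Prot adj EM EP H') : Prot adj EM EP (H ∪ H') := by
  intro h hh
  rcases Finset.mem_union.1 hh with hh | hh
  · obtain ⟨p, q⟩ := h1 h hh
    exact ⟨p.imp_right (fun ⟨x, hx, hx'⟩ => ⟨x, Finset.mem_union_left _ hx, hx'⟩),
      q.imp_right (fun ⟨x, hx, hx'⟩ => ⟨x, Finset.mem_union_left _ hx, hx'⟩)⟩
  · obtain ⟨p, q⟩ := h2 h hh
    exact ⟨p.imp_right (fun ⟨x, hx, hx'⟩ => ⟨x, Finset.mem_union_right _ hx, hx'⟩),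
      q.imp_right (fun ⟨x, hx, hx'⟩ => ⟨x, Finset.mem_union_right _ hx, hx'⟩)⟩

theorem prot_aux [Fintype V] {adj : V → V → Prop} (F EM EP X : Finset V) (K : ℕ)
    (hin : ∀ v, v ∉ F → 8 * EM.card ≤ (inN adj v).card)
    (hout : ∀ v, v ∉ F → 8 * EP.card ≤ (outN adj v).card)
    (hdi : ∀ v, K ≤ (inN adj v).card) (hdo : ∀ v, K ≤ (outN adj v).card)
    (hle : EM.card ≤ EP.card) (hK : 2 * (F.card + X.card) < K) {u : V} (hu : u ∉ F) (huX : u ∉ X) :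
    ∃ H : Finset V, u ∈ H ∧ H.card ≤ 4 ∧ (∀ h ∈ H, h ∉ F ∧ h ∉ X) ∧ Prot adj EM EP H := by
  have good : ∀ v, v ∉ F → ∃ g, adj v g ∧ g ∉ EM ∧ g ∉ EP ∧ g ∉ F ∧ g ∉ X := by
    intro v hv
    have hc : (EM ∪ EP ∪ (F ∪ X)).card < (outN adj v).card := by
      have h1 := Finset.card_union_le (EM ∪ EP) (F ∪ X)
      have h2 := Finset.card_union_le EM EP
      have h3 := Finset.card_union_le F X
      have := hout v hv
      have := hdo v
      omega
    obtain ⟨g, hg, hg'⟩ := Finset.exists_mem_notMem_of_card_lt_card hc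
    simp only [Finset.mem_union, not_or] at hg'
    exact ⟨g, mem_outN.1 hg, hg'.1.1, hg'.1.2, hg'.2.1, hg'.2.2⟩
  have hw : ∃ w, adj w u ∧ w ∉ EM ∧ w ∉ F ∧ w ∉ X := by
    have hc : (EM ∪ (F ∪ X)).card < (inN adj u).card := by
      have h1 := Finset.card_union_le EM (F ∪ X)
      have h3 := Finset.card_union_le F X
      have := hin u hu
      have := hdi u
      omega
    obtain ⟨g, hg, hg'⟩ := Finset.exists_mem_notMem_of_card_lt_card hc
    simp only [Finset.mem_union, not_or] at hg'
    exact ⟨g, mem_inN.1 hg, hg'.1, hg'.2.1, hg'.2.2⟩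
  obtain ⟨w, hwu, hw1, hw2, hw3⟩ := hw
  obtain ⟨g, hg, hg1, hg2, hg3, hg4⟩ := good u hu
  obtain ⟨g', hg', hg1', hg2', hg3', hg4'⟩ := good w hw2
  refine ⟨{u, w, g, g'}, by simp, Finset.card_le_four, ?_, ?_⟩
  · intro h hh
    simp only [Finset.mem_insert, Finset.mem_singleton] at hh
    rcases hh with rfl | rfl | rfl | rfl <;> exact ⟨‹_›, ‹_›⟩
  · intro h hh
    simp only [Finset.mem_insert, Finset.mem_singleton] at hh
    rcases hh with rfl | rfl | rfl | rfl
    · exact ⟨Or.inr ⟨w, by simp, hwu, hw1⟩, Or.inr ⟨g, by simp, hg, hg2⟩⟩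
    · exact ⟨Or.inl hw1, Or.inr ⟨g', by simp, hg', hg2'⟩⟩
    · exact ⟨Or.inl hg1, Or.inl hg2⟩
    · exact ⟨Or.inl hg1', Or.inl hg2'⟩

theorem prot_exists [Fintype V] {adj : V → V → Prop} (F EM EP X : Finset V) (K : ℕ)
    (hin : ∀ v, v ∉ F → 8 * EM.card ≤ (inN adj v).card)
    (hout : ∀ v, v ∉ F → 8 * EP.card ≤ (outN adj v).card)
    (hdi : ∀ v, K ≤ (inN adj v).card) (hdo : ∀ v, K ≤ (outN adj v).card)
    (hK : 2 * (F.card + X.card) < K) {u : V} (hu : u ∉ F) (huX : u ∉ X) :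
    ∃ H : Finset V, u ∈ H ∧ H.card ≤ 4 ∧ (∀ h ∈ H, h ∉ F ∧ h ∉ X) ∧ Prot adj EM EP H := by
  rcases le_total EM.card EP.card with h | h
  · exact prot_aux F EM EP X K hin hout hdi hdo h hK hu huX
  · obtain ⟨H, h1, h2, h3, h4⟩ := prot_aux (adj := flip adj) F EP EM X K hout hin hdo hdi h hK hu huX
    exact ⟨H, h1, h2, h3, fun h hh => (h4 h hh).symm⟩

/-- protector of a vertex -/
def IsProt (adj : V → V → Prop) (F EM EP : Finset V) (v : V) (H : Finset V) : Prop :=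
  H.card ≤ 8 ∧ (∀ h ∈ H, h ∉ F) ∧ Prot adj EM EP H ∧ (∃ w ∈ H, adj w v) ∧ (∃ w ∈ H, adj v w)

theorem isProt_exists [Fintype V] {adj : V → V → Prop} (F EM EP X : Finset V) (K : ℕ)
    (hin : ∀ v, v ∉ F → 8 * EM.card ≤ (inN adj v).card)
    (hout : ∀ v, v ∉ F → 8 * EP.card ≤ (outN adj v).card)
    (hdi : ∀ v, K ≤ (inN adj v).card) (hdo : ∀ v, K ≤ (outN adj v).card)
    (hK : 2 * (F.card + X.card) < K) (v : V) :
    ∃ H : Finset V, IsProt adj F EM EP v H ∧ ∀ h ∈ H, h ∉ X := by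
  have h3 := Finset.card_union_le F X
  obtain ⟨w, hw, hw'⟩ := Finset.exists_mem_notMem_of_card_lt_card
    (show (F ∪ X).card < (inN adj v).card by have := hdi v; omega)
  obtain ⟨u, hu, hu'⟩ := Finset.exists_mem_notMem_of_card_lt_card
    (show (F ∪ X).card < (outN adj v).card by have := hdo v; omega)
  rw [Finset.mem_union, not_or] at hw' hu'
  obtain ⟨H, a1, a2, a3, a4⟩ := prot_exists F EM EP X K hin hout hdi hdo hK hw'.1 hw'.2
  obtain ⟨H', b1, b2, b3, b4⟩ := prot_exists F EM EP X K hin hout hdi hdo hK hu'.1 hu'.2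
  have hc := Finset.card_union_le H H'
  refine ⟨H ∪ H', ⟨by omega, ?_, a4.union b4, ⟨w, Finset.mem_union_left _ a1, mem_inN.1 hw⟩,
    ⟨u, Finset.mem_union_right _ b1, mem_outN.1 hu⟩⟩, ?_⟩
  · intro h hh
    rcases Finset.mem_union.1 hh with hh | hh
    · exact (a3 h hh).1
    · exact (b3 h hh).1
  · intro h hh
    rcases Finset.mem_union.1 hh with hh | hh
    · exact (a3 h hh).2
    · exact (b3 h hh).2

theorem protFam_exists [Fintype V] {adj : V → V → Prop} (F EM EP : Finset V) (K : ℕ)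
    (hin : ∀ v, v ∉ F → 8 * EM.card ≤ (inN adj v).card)
    (hout : ∀ v, v ∉ F → 8 * EP.card ≤ (outN adj v).card)
    (hdi : ∀ v, K ≤ (inN adj v).card) (hdo : ∀ v, K ≤ (outN adj v).card)
    (hK : 2 * (9 * F.card) < K) :
    ∃ R : V → Finset V, (∀ v ∈ F, IsProt adj F EM EP v (R v)) ∧
      (∀ v ∈ F, ∀ w ∈ F, v ≠ w → Disjoint (R v) (R w)) := by
  suffices H : ∀ S : Finset V, S ⊆ F → ∃ R : V → Finset V, (∀ v ∈ S, IsProt adj F EM EP v (R v)) ∧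
      (∀ v ∈ S, ∀ w ∈ S, v ≠ w → Disjoint (R v) (R w)) from H F (Finset.Subset.refl _)
  intro S
  induction S using Finset.induction_on with
  | empty => intro _; exact ⟨fun _ => ∅, by simp, by simp⟩
  | insert x S hx ih =>
    intro hS
    obtain ⟨R, hR, hd⟩ := ih (fun y hy => hS (Finset.mem_insert_of_mem hy))
    have h1 : (S.biUnion R).card ≤ S.card * 8 :=
      Finset.card_biUnion_le_card_mul _ _ _ (fun i hi => (hR i hi).1)
    have h2 : S.card ≤ F.card := Finset.card_le_card (fun y hy => hS (Finset.mem_insert_of_mem hy))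
    obtain ⟨H, hH, hHX⟩ := isProt_exists F EM EP (S.biUnion R) K hin hout hdi hdo (by omega) x
    have hHd : ∀ w ∈ S, Disjoint H (R w) := by
      intro w hw
      rw [Finset.disjoint_left]
      intro z hz hz'
      exact hHX z hz (Finset.mem_biUnion.2 ⟨w, hw, hz'⟩)
    have hne : ∀ w ∈ S, w ≠ x := fun w hw e => hx (e ▸ hw)
    refine ⟨fun v => if v = x then H else R v, ?_, ?_⟩
    · intro v hv
      by_cases hvx : v = x
      · simp only [hvx, if_true]; exact hH
      · simp only [hvx, if_false]; exact hR v ((Finset.mem_insert.1 hv).resolve_left hvx)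
    · intro v hv w hw hvw
      by_cases hvx : v = x <;> by_cases hwx : w = x
      · exact absurd (hvx.trans hwx.symm) hvw
      · simp only [hvx, hwx, if_true, if_false]
        exact hHd w ((Finset.mem_insert.1 hw).resolve_left hwx)
      · simp only [hvx, hwx, if_true, if_false]
        exact (hHd v ((Finset.mem_insert.1 hv).resolve_left hvx)).symm
      · simp only [hvx, hwx, if_false]
        exact hd v ((Finset.mem_insert.1 hv).resolve_left hvx) w
          ((Finset.mem_insert.1 hw).resolve_left hwx) hvw


theorem hall_cond [Fintype V] {adj : V → V → Prop} {K : ℕ} (hK : KC adj K)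
    (dead X Y S : Finset V) (hYd : Disjoint Y dead) (hXY : X.card = Y.card)
    (hc : dead.card + Y.card ≤ K) (hSd : Disjoint S dead) (hSY : Disjoint S Y) :
    S.card ≤ ((S.biUnion (fun v => insert v (outN adj v) \ dead)) \ X).card := by
  by_contra hlt
  push Not at hlt
  set M := S.biUnion (fun v => insert v (outN adj v) \ dead) with hM
  have hSM : S ⊆ M := by
    intro v hv
    refine Finset.mem_biUnion.2 ⟨v, hv, ?_⟩
    simp [Finset.disjoint_left.1 hSd hv]
  set C := (M \ S) ∪ (X \ M) with hC
  have hCc : C.card < Y.card := by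
    have h1 : C.card ≤ (M \ S).card + (X \ M).card := Finset.card_union_le _ _
    have h2 : (M \ S).card + S.card = M.card := by
      rw [Finset.card_sdiff_of_subset hSM]
      have := Finset.card_le_card hSM
      omega
    have h3 := Finset.card_sdiff_add_card_inter X M
    have h4 := Finset.card_sdiff_add_card_inter M X
    rw [Finset.inter_comm] at h4
    omega
  have hdc := Finset.card_union_le dead C
  have hst := hK.2 (dead ∪ C) (by omega)
  obtain ⟨y, hy, hyC⟩ := Finset.exists_mem_notMem_of_card_lt_card hCc
  obtain ⟨s, hs⟩ : S.Nonempty := by rw [← Finset.card_pos]; omega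
  have hsC : s ∉ dead ∪ C := by
    simp only [hC, Finset.mem_union, Finset.mem_sdiff, not_or]
    exact ⟨Finset.disjoint_left.1 hSd hs, by simp [hs], by simp [hSM hs]⟩
  have hyC' : y ∉ dead ∪ C := by
    rw [Finset.mem_union, not_or]
    exact ⟨Finset.disjoint_left.1 hYd hy, hyC⟩
  obtain ⟨a, b, ha, hb, hab, h1, h2⟩ := exitEdge (hst s hsC y hyC') (fun z => z ∈ S) hs
    (Finset.disjoint_right.1 hSY hy)
  simp only [Set.mem_setOf_eq, Finset.mem_union, not_or] at hb
  have hbM : b ∈ M := by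
    refine Finset.mem_biUnion.2 ⟨a, h1, ?_⟩
    simp [mem_outN, hab, hb.1]
  exact hb.2 (Finset.mem_union_left _ (Finset.mem_sdiff.2 ⟨hbM, h2⟩))

theorem hall_fun [Fintype V] {adj : V → V → Prop} {K : ℕ} (hK : KC adj K)
    (dead X Y : Finset V) (hYd : Disjoint Y dead) (hXY : X.card = Y.card)
    (hc : dead.card + Y.card ≤ K) :
    ∃ g : V → V, (∀ v, v ∉ dead → v ∉ Y → (g v = v ∨ adj v (g v)) ∧ g v ∉ dead ∧ g v ∉ X) ∧
      (∀ v w, v ∉ dead → v ∉ Y → w ∉ dead → w ∉ Y → g v = g w → v = w) := by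
  let I := {v : V // v ∉ dead ∧ v ∉ Y}
  have := (Finset.all_card_le_biUnion_card_iff_exists_injective
    (fun v : I => (insert v.1 (outN adj v.1) \ dead) \ X)).1 (by
      intro s
      have h := hall_cond hK dead X Y (s.image Subtype.val) hYd hXY hc
        (by
          rw [Finset.disjoint_left]
          intro a ha
          obtain ⟨v, _, rfl⟩ := Finset.mem_image.1 ha
          exact v.2.1)
        (by
          rw [Finset.disjoint_left]
          intro a ha
          obtain ⟨v, _, rfl⟩ := Finset.mem_image.1 ha
          exact v.2.2)
      rw [Finset.card_image_of_injective _ Subtype.val_injective] at h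
      refine h.trans (Finset.card_le_card ?_)
      intro z hz
      simp only [Finset.mem_sdiff, Finset.mem_biUnion, Finset.mem_image] at hz ⊢
      obtain ⟨⟨_, ⟨v, hv, rfl⟩, h1⟩, h2⟩ := hz
      exact ⟨v, hv, h1, h2⟩)
  obtain ⟨f, hf, hft⟩ := this
  refine ⟨fun v => if h : v ∉ dead ∧ v ∉ Y then f ⟨v, h⟩ else v, ?_, ?_⟩
  · intro v h1 h2
    have := hft ⟨v, h1, h2⟩
    simp only [Finset.mem_sdiff, Finset.mem_insert, mem_outN] at this
    simp only [h1, h2, not_false_eq_true, and_self, dite_true]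
    exact ⟨this.1.1, this.1.2, this.2⟩
  · intro v w h1 h2 h3 h4 h
    simp only [h1, h2, h3, h4, not_false_eq_true, and_self, dite_true] at h
    exact congrArg Subtype.val (hf h)

theorem menger [Fintype V] {adj : V → V → Prop} {K : ℕ} (hK : KC adj K)
    (dead X Y : Finset V) (hXd : Disjoint X dead) (hYd : Disjoint Y dead) (hd : Disjoint X Y)
    (hXY : X.card = Y.card) (hc : dead.card + Y.card ≤ K) :
    ∃ (q : V → ℕ → V) (l : V → ℕ), ∀ x ∈ X, q x 0 = x ∧ q x (l x) ∈ Y ∧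
      (∀ s < l x, adj (q x s) (q x (s+1))) ∧
      (∀ s, 0 < s → s < l x → q x s ∉ dead ∧ q x s ∉ X ∧ q x s ∉ Y) ∧
      (∀ x' ∈ X, ∀ s ≤ l x, ∀ s' ≤ l x', q x s = q x' s' → x = x' ∧ s = s') := by
  obtain ⟨g, hg, hinj⟩ := hall_fun hK dead X Y hYd hXY hc
  have hit : ∀ x ∈ X, ∃ s, g^[s] x ∈ Y := by
    intro x hx
    by_contra hno
    push Not at hno
    have hnd : ∀ s, g^[s] x ∉ dead := by
      intro s
      induction s with
      | zero => exact Finset.disjoint_left.1 hXd hx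
      | succ s ih =>
        rw [Function.iterate_succ_apply']
        exact (hg _ ih (hno s)).2.1
    obtain ⟨i, j, hij, h⟩ := Finite.exists_ne_map_eq_of_infinite (fun s => g^[s] x)
    have cancel : ∀ d i, g^[i] x ≠ g^[i + (d+1)] x := by
      intro d i
      induction i with
      | zero =>
        intro h
        rw [Nat.zero_add, Function.iterate_succ_apply'] at h
        have := (hg _ (hnd d) (hno d)).2.2
        rw [← h] at this
        exact this hx
      | succ i ih =>
        intro h
        rw [show i + 1 + (d+1) = (i + (d+1)) + 1 by ring, Function.iterate_succ_apply',
          Function.iterate_succ_apply' g] at h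
        exact ih (hinj _ _ (hnd _) (hno _) (hnd _) (hno _) h)
    rcases lt_or_gt_of_ne hij with h' | h'
    · have := cancel (j - i - 1) i
      rw [show i + (j - i - 1 + 1) = j by omega] at this
      exact this h
    · have := cancel (i - j - 1) j
      rw [show j + (i - j - 1 + 1) = i by omega] at this
      exact this h.symm
  let l : V → ℕ := fun x => if h : ∃ s, g^[s] x ∈ Y then Nat.find h else 0
  have hl1 : ∀ x ∈ X, g^[l x] x ∈ Y := by
    intro x hx
    simp only [l, hit x hx, dite_true]
    exact Nat.find_spec (hit x hx)
  have hl2 : ∀ x ∈ X, ∀ s < l x, g^[s] x ∉ Y := by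
    intro x hx s hs
    simp only [l, hit x hx, dite_true] at hs
    exact Nat.find_min (hit x hx) hs
  have hl3 : ∀ x ∈ X, ∀ s ≤ l x, g^[s] x ∉ dead := by
    intro x hx s
    induction s with
    | zero => intro _; exact Finset.disjoint_left.1 hXd hx
    | succ s ih =>
      intro hs
      rw [Function.iterate_succ_apply']
      exact (hg _ (ih (by omega)) (hl2 x hx s (by omega))).2.1
  have hl4 : ∀ x ∈ X, ∀ s < l x, g^[s+1] x ∉ X := by
    intro x hx s hs
    rw [Function.iterate_succ_apply']
    exact (hg _ (hl3 x hx s hs.le) (hl2 x hx s hs)).2.2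
  have hJ : ∀ s, ∀ x ∈ X, ∀ x' ∈ X, s ≤ l x → ∀ s' ≤ l x', g^[s] x = g^[s'] x' → x = x' ∧ s = s' := by
    intro s
    induction s with
    | zero =>
      intro x hx x' hx' hs s' hs' h
      cases s' with
      | zero => exact ⟨h, rfl⟩
      | succ s' =>
        exfalso
        have := hl4 x' hx' s' (by omega)
        rw [← h] at this
        exact this hx
    | succ s ih =>
      intro x hx x' hx' hs s' hs' h
      cases s' with
      | zero =>
        exfalso
        have := hl4 x hx s (by omega)
        rw [h] at this
        exact this hx'
      | succ s' =>
        rw [Function.iterate_succ_apply', Function.iterate_succ_apply' g] at h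
        have := hinj _ _ (hl3 x hx s (by omega)) (hl2 x hx s (by omega))
          (hl3 x' hx' s' (by omega)) (hl2 x' hx' s' (by omega)) h
        obtain ⟨h1, h2⟩ := ih x hx x' hx' (by omega) s' (by omega) this
        exact ⟨h1, by omega⟩
  refine ⟨fun x s => g^[s] x, l, fun x hx => ⟨rfl, hl1 x hx, ?_, ?_, ?_⟩⟩
  · intro s hs
    have h1 := (hg _ (hl3 x hx s hs.le) (hl2 x hx s hs)).1
    simp only [Function.iterate_succ_apply']
    rcases h1 with h1 | h1
    · exfalso
      have := hJ (s+1) x hx x hx (by omega) s hs.le (by rw [Function.iterate_succ_apply']; exact h1)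
      omega
    · exact h1
  · intro s h0 hs
    refine ⟨hl3 x hx s hs.le, ?_, hl2 x hx s hs⟩
    have := hl4 x hx (s-1) (by omega)
    rwa [show s - 1 + 1 = s by omega] at this
  · intro x' hx' s hs s' hs' h
    exact hJ s x hx x' hx' hs s' hs' h


/-- linkage from the `b`'s to the `a`'s -/
structure Lk [Fintype V] {adj : V → V → Prop} {N c : ℕ} (D : Dt adj N c) (FR : Finset V) {t : ℕ}
    (α β : Fin t → ℕ) (q : Fin t → ℕ → V) (l : Fin t → ℕ) : Prop where
  αlt : ∀ j, α j < N
  βlt : ∀ j, β j < N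
  αinj : ∀ i j, α i = α j → i = j
  βinj : ∀ i j, β i = β j → i = j
  q0 : ∀ j, q j 0 = D.b (β j)
  ql : ∀ j, q j (l j) = D.a (α j)
  edge : ∀ j, ∀ s < l j, adj (q j s) (q j (s+1))
  int : ∀ j s, 0 < s → s < l j → q j s ∉ FR
  inj : ∀ j j', ∀ s ≤ l j, ∀ s' ≤ l j', q j s = q j' s' → j = j' ∧ s = s'

theorem Lk.flip [Fintype V] {adj : V → V → Prop} {N c : ℕ} {D : Dt adj N c} {FR : Finset V} {t : ℕ}
    {α β : Fin t → ℕ} {q : Fin t → ℕ → V} {l : Fin t → ℕ} (h : Lk D FR α β q l) :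
    Lk D.flip FR β α (fun j s => q j (l j - s)) l where
  αlt := h.βlt
  βlt := h.αlt
  αinj := h.βinj
  βinj := h.αinj
  q0 := fun j => h.ql j
  ql := fun j => by simp only [Nat.sub_self]; exact h.q0 j
  edge := fun j s hs => by
    have := h.edge j (l j - (s+1)) (by omega)
    rw [show l j - (s+1) + 1 = l j - s by omega] at this
    exact this
  int := fun j s h0 hs => h.int j _ (by omega) (by omega)
  inj := fun j j' s hs s' hs' e => by
    obtain ⟨h1, h2⟩ := h.inj j j' _ (Nat.sub_le _ _) _ (Nat.sub_le _ _) e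
    subst h1
    exact ⟨rfl, by omega⟩

/-- minimality -/
def MinLk [Fintype V] {adj : V → V → Prop} {N c : ℕ} (D : Dt adj N c) (FR : Finset V) {t : ℕ}
    (l : Fin t → ℕ) : Prop :=
  ∀ (α' β' : Fin t → ℕ) (q' : Fin t → ℕ → V) (l' : Fin t → ℕ), Lk D FR α' β' q' l' →
    ∑ j, l j ≤ ∑ j, l' j

theorem MinLk.flip [Fintype V] {adj : V → V → Prop} {N c : ℕ} {D : Dt adj N c} {FR : Finset V} {t : ℕ}
    {l : Fin t → ℕ} (h : MinLk D FR l) : MinLk D.flip FR l := by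
  intro α' β' q' l' hL
  exact h β' α' _ l' hL.flip

section
variable [Fintype V] {adj : V → V → Prop} {N c : ℕ} {D : Dt adj N c} {FR : Finset V} {t : ℕ}
    {α β : Fin t → ℕ} {q : Fin t → ℕ → V} {l : Fin t → ℕ}

theorem Dt.a_mem_F (D : Dt adj N c) {i : ℕ} (hi : i < N) : D.a i ∈ D.F :=
  (D.hF _).2 ⟨i, hi, Or.inl (D.amem i hi)⟩
theorem Dt.b_mem_F (D : Dt adj N c) {i : ℕ} (hi : i < N) : D.b i ∈ D.F :=
  (D.hF _).2 ⟨i, hi, Or.inr (D.bmem i hi)⟩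
theorem Dt.a_ne_b (D : Dt adj N c) {i j : ℕ} (hi : i < N) (hj : j < N) : D.a i ≠ D.b j := by
  intro h
  exact Finset.disjoint_left.1 (D.dAB i hi j hj) (D.amem i hi) (h ▸ D.bmem j hj)
theorem Dt.a_inj (D : Dt adj N c) {i j : ℕ} (hi : i < N) (hj : j < N) (h : D.a i = D.a j) : i = j := by
  by_contra hne
  exact Finset.disjoint_left.1 (D.dAA i hi j hj hne) (D.amem i hi) (h ▸ D.amem j hj)
theorem Dt.b_inj (D : Dt adj N c) {i j : ℕ} (hi : i < N) (hj : j < N) (h : D.b i = D.b j) : i = j :=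
  D.flip.a_inj hi hj h

theorem Lk.lpos (h : Lk D FR α β q l) (j : Fin t) : 1 ≤ l j := by
  by_contra h0
  have h0 : l j = 0 := by omega
  have := h.ql j
  rw [h0, h.q0] at this
  exact D.a_ne_b (h.αlt j) (h.βlt j) this.symm

theorem Lk.a_not (h : Lk D FR α β q l) (hFR : D.F ⊆ FR) {i : ℕ} (hi : i < N) {k : Fin t}
    (hk : α k ≠ i) {s : ℕ} (hs : s ≤ l k) : q k s ≠ D.a i := by
  intro e
  rcases Nat.eq_zero_or_pos s with h0 | h0
  · subst h0; rw [h.q0] at e; exact D.a_ne_b hi (h.βlt k) e.symm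
  · rcases hs.lt_or_eq with h1 | h1
    · exact h.int k s h0 h1 (e ▸ hFR (D.a_mem_F hi))
    · rw [h1, h.ql] at e
      exact hk (D.a_inj (h.αlt k) hi e)

theorem Lk.b_not (h : Lk D FR α β q l) (hFR : D.F ⊆ FR) {i : ℕ} (hi : i < N) {k : Fin t}
    (hk : β k ≠ i) {s : ℕ} (hs : s ≤ l k) : q k s ≠ D.b i := by
  have := h.flip.a_not hFR hi hk (s := l k - s) (by omega)
  simp only [show l k - (l k - s) = s by omega] at this
  exact this

theorem Lk.surgery (h : Lk D FR α β q l) (hm : MinLk D FR l) (j : Fin t) (p : ℕ → V) (l' i m : ℕ)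
    (hi : i < N) (hm' : m < N) (hiu : ∀ k, k ≠ j → α k ≠ i) (hmu : ∀ k, k ≠ j → β k ≠ m)
    (p0 : p 0 = D.b m) (pl : p l' = D.a i) (pe : ∀ s < l', adj (p s) (p (s+1)))
    (pi : ∀ s, 0 < s → s < l' → p s ∉ FR) (pinj : ∀ s ≤ l', ∀ s' ≤ l', p s = p s' → s = s')
    (pd : ∀ s ≤ l', ∀ k, k ≠ j → ∀ s' ≤ l k, p s ≠ q k s') : l j ≤ l' := by
  have key : Lk D FR (Function.update α j i) (Function.update β j m) (Function.update q j p)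
      (Function.update l j l') := by
    refine ⟨?_, ?_, ?_, ?_, ?_, ?_, ?_, ?_, ?_⟩
    · intro k
      by_cases hk : k = j
      · subst hk; simpa using hi
      · simpa [hk] using h.αlt k
    · intro k
      by_cases hk : k = j
      · subst hk; simpa using hm'
      · simpa [hk] using h.βlt k
    · intro k k' e
      by_cases hk : k = j <;> by_cases hk' : k' = j
      · rw [hk, hk']
      · subst hk; simp [hk'] at e; exact absurd e.symm (hiu _ hk')
      · subst hk'; simp [hk] at e; exact absurd e (hiu _ hk)
      · simp [hk, hk'] at e; exact h.αinj _ _ e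
    · intro k k' e
      by_cases hk : k = j <;> by_cases hk' : k' = j
      · rw [hk, hk']
      · subst hk; simp [hk'] at e; exact absurd e.symm (hmu _ hk')
      · subst hk'; simp [hk] at e; exact absurd e (hmu _ hk)
      · simp [hk, hk'] at e; exact h.βinj _ _ e
    · intro k
      by_cases hk : k = j
      · subst hk; simpa using p0
      · simpa [hk] using h.q0 k
    · intro k
      by_cases hk : k = j
      · subst hk; simpa using pl
      · simpa [hk] using h.ql k
    · intro k
      by_cases hk : k = j
      · subst hk; simpa using pe
      · simpa [hk] using h.edge k
    · intro k
      by_cases hk : k = j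
      · subst hk; simpa using pi
      · simpa [hk] using h.int k
    · intro k k'
      by_cases hk : k = j <;> by_cases hk' : k' = j
      · subst hk; subst hk'; simpa using pinj
      · subst hk
        simp only [Function.update_self, Function.update_of_ne hk']
        intro s hs s' hs' e
        exact absurd e (pd s hs _ hk' s' hs')
      · subst hk'
        simp only [Function.update_self, Function.update_of_ne hk]
        intro s hs s' hs' e
        exact absurd e.symm (pd s' hs' _ hk s hs)
      · simp only [Function.update_of_ne hk, Function.update_of_ne hk']
        exact h.inj k k'
  have h1 := hm _ _ _ _ key
  rw [Finset.sum_update_of_mem (Finset.mem_univ j), ← Finset.add_sum_erase _ _ (Finset.mem_univ j),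
    Finset.sdiff_singleton_eq_erase] at h1
  omega

/-- back-transitivity -/
theorem Lk.back (h : Lk D FR α β q l) (hm : MinLk D FR l) (hT : IsTournament adj) (j : Fin t)
    {r s : ℕ} (hrs : r + 2 ≤ s) (hs : s ≤ l j) : adj (q j s) (q j r) := by
  rcases hT.2.2 (q j s) (q j r) (fun e => by have := (h.inj j j s hs r (by omega) e).2; omega) with h1 | h1
  · exact h1
  exfalso
  have := h.surgery hm j (fun x => if x ≤ r then q j x else q j (x + (s - r - 1))) (l j - (s - r - 1))
    (α j) (β j) (h.αlt j) (h.βlt j) (fun k hk e => hk (h.αinj _ _ e)) (fun k hk e => hk (h.βinj _ _ e))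
    (by simpa using h.q0 j)
    (by
      simp only [show ¬ (l j - (s - r - 1) ≤ r) by omega, if_false]
      rw [show l j - (s - r - 1) + (s - r - 1) = l j by omega]; exact h.ql j)
    (by
      intro x hx
      rcases lt_trichotomy x r with h2 | h2 | h2
      · simp only [h2.le, show x + 1 ≤ r by omega, if_true]; exact h.edge j x (by omega)
      · subst h2
        simp only [le_refl, if_true, show ¬ (x + 1 ≤ x) by omega, if_false]
        rw [show x + 1 + (s - x - 1) = s by omega]; exact h1
      · simp only [show ¬ (x ≤ r) by omega, show ¬ (x + 1 ≤ r) by omega, if_false]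
        rw [show x + 1 + (s - r - 1) = x + (s - r - 1) + 1 by omega]
        exact h.edge j _ (by omega))
    (by
      intro x h0 hx
      split_ifs
      · exact h.int j _ h0 (by omega)
      · exact h.int j _ (by omega) (by omega))
    (by
      intro x hx y hy e
      split_ifs at e <;> have := (h.inj j j _ (by omega) _ (by omega) e).2 <;> omega)
    (by
      intro x hx k hk y hy e
      split_ifs at e
      · exact hk (h.inj _ _ _ (by omega) _ hy e).1.symm
      · exact hk (h.inj _ _ _ (by omega) _ hy e).1.symm)
  omega

theorem Lk.x_to (h : Lk D FR α β q l) (hm : MinLk D FR l) (hT : IsTournament adj) (hFR : D.F ⊆ FR)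
    {i : ℕ} (hi : i < N) (hiu : ∀ k, α k ≠ i) (j : Fin t) {s : ℕ} (hs : s + 2 ≤ l j) :
    adj (D.a i) (q j s) := by
  have hne : ∀ k, ∀ s ≤ l k, q k s ≠ D.a i := fun k s hs => h.a_not hFR hi (hiu k) hs
  rcases hT.2.2 (q j s) (D.a i) (hne j s (by omega)) with h1 | h1
  swap
  · exact h1
  exfalso
  have := h.surgery hm j (fun x => if x ≤ s then q j x else D.a i) (s+1)
    i (β j) hi (h.βlt j) (fun k _ => hiu k) (fun k hk e => hk (h.βinj _ _ e))
    (by simpa using h.q0 j)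
    (by simp)
    (by
      intro x hx
      rcases (show x < s ∨ x = s by omega) with h2 | h2
      · simp only [h2.le, show x + 1 ≤ s by omega, if_true]; exact h.edge j x (by omega)
      · subst h2
        simpa using h1)
    (by
      intro x h0 hx
      split_ifs
      · exact h.int j _ h0 (by omega)
      · omega)
    (by
      intro x hx y hy e
      split_ifs at e
      · exact (h.inj j j _ (by omega) _ (by omega) e).2
      · exact absurd e (hne _ _ (by omega))
      · exact absurd e.symm (hne _ _ (by omega))
      · omega)
    (by
      intro x hx k hk y hy e
      split_ifs at e
      · exact hk (h.inj _ _ _ (by omega) _ hy e).1.symm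
      · exact hne _ _ hy e.symm)
  omega

theorem Lk.to_y (h : Lk D FR α β q l) (hm : MinLk D FR l) (hT : IsTournament adj) (hFR : D.F ⊆ FR)
    {i : ℕ} (hi : i < N) (hiu : ∀ k, β k ≠ i) (j : Fin t) {s : ℕ} (h2 : 2 ≤ s) (hs : s ≤ l j) :
    adj (q j s) (D.b i) := by
  have := h.flip.x_to hm.flip (IsTournament.flip hT) hFR hi hiu j (s := l j - s) (by omega)
  simp only [show l j - (l j - s) = s by omega] at this
  exact this

theorem Lk.in_last (h : Lk D FR α β q l) (hm : MinLk D FR l) (hFR : D.F ⊆ FR)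
    {i : ℕ} (hi : i < N) (hiu : ∀ k, α k ≠ i) {v : V} (hv : v ∉ FR)
    (hvQ : ∀ k, ∀ s ≤ l k, q k s ≠ v) (hvx : adj v (D.a i)) (j : Fin t) {s : ℕ} (hs : s ≤ l j)
    (hsv : adj (q j s) v) : l j ≤ s + 2 := by
  by_contra hlt
  push Not at hlt
  have hne : ∀ k, ∀ s ≤ l k, q k s ≠ D.a i := fun k s hs => h.a_not hFR hi (hiu k) hs
  have hvx' : v ≠ D.a i := fun e => hv (e ▸ hFR (D.a_mem_F hi))
  have := h.surgery hm j (fun x => if x ≤ s then q j x else if x = s+1 then v else D.a i) (s+2)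
    i (β j) hi (h.βlt j) (fun k _ => hiu k) (fun k hk e => hk (h.βinj _ _ e))
    (by simpa using h.q0 j)
    (by simp)
    (by
      intro x hx
      rcases (show x < s ∨ x = s ∨ x = s + 1 by omega) with h2 | h2 | h2
      · simp only [h2.le, show x + 1 ≤ s by omega, if_true]; exact h.edge j x (by omega)
      · subst h2
        simpa using hsv
      · subst h2
        simpa using hvx)
    (by
      intro x h0 hx
      split_ifs
      · exact h.int j _ h0 (by omega)
      · exact hv
      · omega)
    (by
      intro x hx y hy e
      split_ifs at e
      · exact (h.inj j j _ (by omega) _ (by omega) e).2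
      · exact absurd e (hvQ _ _ (by omega))
      · exact absurd e (hne _ _ (by omega))
      · exact absurd e.symm (hvQ _ _ (by omega))
      · omega
      · exact absurd e hvx'
      · exact absurd e.symm (hne _ _ (by omega))
      · exact absurd e.symm hvx'
      · omega)
    (by
      intro x hx k hk y hy e
      split_ifs at e
      · exact hk (h.inj _ _ _ (by omega) _ hy e).1.symm
      · exact hvQ _ _ hy e.symm
      · exact hne _ _ hy e.symm)
  omega

theorem Lk.out_first (h : Lk D FR α β q l) (hm : MinLk D FR l) (hFR : D.F ⊆ FR)
    {i : ℕ} (hi : i < N) (hiu : ∀ k, β k ≠ i) {v : V} (hv : v ∉ FR)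
    (hvQ : ∀ k, ∀ s ≤ l k, q k s ≠ v) (hvx : adj (D.b i) v) (j : Fin t) {s : ℕ} (hs : s ≤ l j)
    (hsv : adj v (q j s)) : s ≤ 2 := by
  have := h.flip.in_last hm.flip hFR hi hiu hv (fun k s hs => hvQ k _ (Nat.sub_le _ _)) hvx j
    (s := l j - s) (by omega)
  simp only [show l j - (l j - s) = s by omega] at this
  have := this hsv
  omega

end

theorem linkage_exists [Fintype V] {adj : V → V → Prop} {K N c t : ℕ} (hK : KC adj K)
    (D : Dt adj N c) (RR : Finset V) (hRF : Disjoint D.F RR) (hc : N + D.F.card + RR.card ≤ K)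
    (ht : 2 * t ≤ N) (hN : 0 < N) :
    ∃ (α β : Fin t → ℕ) (q : Fin t → ℕ → V) (l : Fin t → ℕ), Lk D (D.F ∪ RR) α β q l ∧
      MinLk D (D.F ∪ RR) l ∧ N * ∑ j, (l j + 1) ≤ t * (2 * Fintype.card V) := by
  suffices H : ∃ (α β : Fin t → ℕ) (q : Fin t → ℕ → V) (l : Fin t → ℕ), Lk D (D.F ∪ RR) α β q l ∧
      N * ∑ j, (l j + 1) ≤ t * (2 * Fintype.card V) by
    obtain ⟨α₀, β₀, q₀, l₀, h₀, hs₀⟩ := H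
    let P : ℕ → Prop := fun k => ∃ (α β : Fin t → ℕ) (q : Fin t → ℕ → V) (l : Fin t → ℕ),
      Lk D (D.F ∪ RR) α β q l ∧ ∑ j, l j = k
    have hP : ∃ k, P k := ⟨_, α₀, β₀, q₀, l₀, h₀, rfl⟩
    obtain ⟨α, β, q, l, h, hs⟩ := Nat.find_spec hP
    refine ⟨α, β, q, l, h, ?_, ?_⟩
    · intro α' β' q' l' h'
      rw [hs]
      exact Nat.find_min' hP ⟨α', β', q', l', h', rfl⟩
    · refine le_trans ?_ hs₀
      have : ∑ j, l j ≤ ∑ j, l₀ j := by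
        rw [hs]; exact Nat.find_min' hP ⟨α₀, β₀, q₀, l₀, h₀, rfl⟩
      rw [Finset.sum_add_distrib, Finset.sum_add_distrib]
      gcongr
  set X := (Finset.range N).image D.b with hX
  set Y := (Finset.range N).image D.a with hY
  have hXc : X.card = N := by
    rw [hX, Finset.card_image_of_injOn, Finset.card_range]
    intro i hi j hj h
    exact D.b_inj (by simpa using hi) (by simpa using hj) h
  have hYc : Y.card = N := by
    rw [hY, Finset.card_image_of_injOn, Finset.card_range]
    intro i hi j hj h
    exact D.a_inj (by simpa using hi) (by simpa using hj) h
  have hXF : X ⊆ D.F := by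
    intro x hx
    obtain ⟨i, hi, rfl⟩ := Finset.mem_image.1 hx
    exact D.b_mem_F (by simpa using hi)
  have hYF : Y ⊆ D.F := by
    intro x hx
    obtain ⟨i, hi, rfl⟩ := Finset.mem_image.1 hx
    exact D.a_mem_F (by simpa using hi)
  set dead := (D.F \ (X ∪ Y)) ∪ RR with hdead
  obtain ⟨q, l, hq⟩ := menger hK dead X Y
    (by
      rw [Finset.disjoint_left]
      intro x hx hx'
      rcases Finset.mem_union.1 hx' with h | h
      · simp [hx] at h
      · exact Finset.disjoint_left.1 hRF (hXF hx) h)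
    (by
      rw [Finset.disjoint_left]
      intro x hx hx'
      rcases Finset.mem_union.1 hx' with h | h
      · simp [hx] at h
      · exact Finset.disjoint_left.1 hRF (hYF hx) h)
    (by
      rw [Finset.disjoint_left]
      intro x hx hx'
      obtain ⟨i, hi, rfl⟩ := Finset.mem_image.1 hx
      obtain ⟨j, hj, h⟩ := Finset.mem_image.1 hx'
      exact D.a_ne_b (by simpa using hj) (by simpa using hi) h)
    (by omega)
    (by
      have h1 : dead.card ≤ (D.F \ (X ∪ Y)).card + RR.card := Finset.card_union_le _ _
      have h2 : (D.F \ (X ∪ Y)).card ≤ D.F.card := Finset.card_le_card Finset.sdiff_subset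
      omega)
  have hbX : ∀ i < N, D.b i ∈ X := fun i hi => Finset.mem_image_of_mem _ (by simpa using hi)
  -- total size
  have htot : ∑ i ∈ Finset.range N, (l (D.b i) + 1) ≤ Fintype.card V := by
    have : ((Finset.range N).sigma (fun i => Finset.range (l (D.b i) + 1))).card ≤
        (Finset.univ : Finset V).card := by
      apply Finset.card_le_card_of_injOn (fun p => q (D.b p.1) p.2) (by intro _ _; simp)
      rintro ⟨i, s⟩ h1 ⟨i', s'⟩ h2 h
      simp only [Finset.coe_sigma, Set.mem_sigma_iff, Finset.coe_range, Set.mem_Iio] at h1 h2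
      have h3 := (hq _ (hbX i h1.1)).2.2.2.2 _ (hbX i' h2.1) s (by omega) s' (by omega) h
      have := D.b_inj h1.1 h2.1 h3.1
      subst this
      rw [h3.2]
    rw [Finset.card_sigma] at this
    simpa using this
  set n := Fintype.card V with hn
  have hnpos : 0 < n := by have := hK.1; omega
  set good := (Finset.range N).filter (fun i => N * (l (D.b i) + 1) ≤ 2 * n) with hgood
  have hgc : t ≤ good.card := by
    set bad := (Finset.range N).filter (fun i => ¬ N * (l (D.b i) + 1) ≤ 2 * n) with hbad
    have h1 : good.card + bad.card = N := by
      rw [hgood, hbad, Finset.card_filter_add_card_filter_not, Finset.card_range]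
    have h2 : ∑ i ∈ bad, 2 * n ≤ ∑ i ∈ bad, N * (l (D.b i) + 1) := by
      apply Finset.sum_le_sum
      intro i hi
      have := (Finset.mem_filter.1 hi).2
      omega
    have h3 : ∑ i ∈ bad, N * (l (D.b i) + 1) ≤ ∑ i ∈ Finset.range N, N * (l (D.b i) + 1) :=
      Finset.sum_le_sum_of_subset (Finset.filter_subset _ _)
    rw [← Finset.mul_sum (Finset.range N)] at h3
    rw [Finset.sum_const, smul_eq_mul] at h2
    have h4 : bad.card * (2 * n) ≤ N * n := h2.trans (h3.trans (Nat.mul_le_mul_left _ htot))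
    have h5 : 2 * bad.card ≤ N := by
      apply Nat.le_of_mul_le_mul_right _ hnpos
      nlinarith
    omega
  obtain ⟨T, hTs, hTc⟩ := Finset.exists_subset_card_eq hgc
  let β : Fin t → ℕ := fun j => T.orderEmbOfFin hTc j
  have hβ : ∀ j, β j ∈ good := fun j => hTs (T.orderEmbOfFin_mem hTc j)
  have hβN : ∀ j, β j < N := fun j => by
    have := (Finset.mem_filter.1 (hβ j)).1
    simpa using this
  have hβinj : ∀ i j, β i = β j → i = j := fun i j h => (T.orderEmbOfFin hTc).injective h
  have hα : ∀ j, ∃ i, i < N ∧ D.a i = q (D.b (β j)) (l (D.b (β j))) := by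
    intro j
    obtain ⟨i, hi, h⟩ := Finset.mem_image.1 (hq _ (hbX _ (hβN j))).2.1
    exact ⟨i, by simpa using hi, h⟩
  choose α hαN hαe using hα
  have hJ : ∀ j j' : Fin t, ∀ s ≤ l (D.b (β j)), ∀ s' ≤ l (D.b (β j')),
      q (D.b (β j)) s = q (D.b (β j')) s' → j = j' ∧ s = s' := by
    intro j j' s hs s' hs' h
    have := (hq _ (hbX _ (hβN j))).2.2.2.2 _ (hbX _ (hβN j')) s hs s' hs' h
    exact ⟨hβinj _ _ (D.b_inj (hβN j) (hβN j') this.1), this.2⟩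
  refine ⟨α, β, fun j => q (D.b (β j)), fun j => l (D.b (β j)),
    ⟨hαN, hβN, ?_, hβinj, ?_, ?_, ?_, ?_, hJ⟩, ?_⟩
  · intro i j h
    have h1 := hαe i
    rw [h, hαe j] at h1
    exact ((hJ j i _ le_rfl _ le_rfl h1).1).symm
  · intro j
    exact (hq _ (hbX _ (hβN j))).1
  · intro j
    exact (hαe j).symm
  · intro j
    exact (hq _ (hbX _ (hβN j))).2.2.1
  · intro j s h0 hs
    have := (hq _ (hbX _ (hβN j))).2.2.2.1 s h0 hs
    simp only [hdead, Finset.mem_union, Finset.mem_sdiff] at this ⊢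
    tauto
  · rw [Finset.mul_sum]
    calc ∑ j : Fin t, N * (l (D.b (β j)) + 1) ≤ ∑ j : Fin t, 2 * n := by
          apply Finset.sum_le_sum
          intro j _
          exact (Finset.mem_filter.1 (hβ j)).2
      _ = t * (2 * n) := by simp


/-- the whole context -/
structure Cx [Fintype V] (adj : V → V → Prop) (N c t : ℕ) where
  D : Dt adj N c
  R : V → Finset V
  α : Fin t → ℕ
  β : Fin t → ℕ
  q : Fin t → ℕ → V
  l : Fin t → ℕ
  hT : IsTournament adj
  hR : ∀ v ∈ D.F, IsProt adj D.F D.EM D.EP v (R v)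
  Rd : ∀ v ∈ D.F, ∀ w ∈ D.F, v ≠ w → Disjoint (R v) (R w)
  lk : Lk D (D.F ∪ D.F.biUnion R) α β q l
  mn : MinLk D (D.F ∪ D.F.biUnion R) l

/-- dual context -/
def Cx.flip [Fintype V] {adj : V → V → Prop} {N c t : ℕ} (X : Cx adj N c t) :
    Cx (flip adj) N c t where
  D := X.D.flip
  R := X.R
  α := X.β
  β := X.α
  q := fun j s => X.q j (X.l j - s)
  l := X.l
  hT := IsTournament.flip X.hT
  hR := fun v hv => by
    obtain ⟨h1, h2, h3, h4, h5⟩ := X.hR v hv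
    exact ⟨h1, h2, fun h hh => (h3 h hh).symm, h5, h4⟩
  Rd := X.Rd
  lk := X.lk.flip
  mn := X.mn.flip

section
variable [Fintype V] {adj : V → V → Prop} {N c t : ℕ}

/-- protectors -/
noncomputable def Cx.RR (X : Cx adj N c t) : Finset V := X.D.F.biUnion X.R

theorem Cx.RR_not_F (X : Cx adj N c t) {v : V} (hv : v ∈ X.RR) : v ∉ X.D.F := by
  obtain ⟨w, hw, h⟩ := Finset.mem_biUnion.1 hv
  exact (X.hR w hw).2.1 v h

theorem Cx.AF (X : Cx adj N c t) {j : Fin t} {v : V} (hv : v ∈ X.D.A (X.α j)) : v ∈ X.D.F :=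
  (X.D.hF v).2 ⟨_, X.lk.αlt j, Or.inl hv⟩
theorem Cx.BF (X : Cx adj N c t) {j : Fin t} {v : V} (hv : v ∈ X.D.B (X.β j)) : v ∈ X.D.F :=
  (X.D.hF v).2 ⟨_, X.lk.βlt j, Or.inr hv⟩

/-- territory contained in a set -/
def Ter (X : Cx adj N c t) (j : Fin t) (Z : Set V) : Prop :=
  (∀ s ≤ X.l j, X.q j s ∈ Z) ∧
    (∀ v, v ∈ X.D.A (X.α j) ∨ v ∈ X.D.B (X.β j) → v ∈ Z ∧ ∀ h ∈ X.R v, h ∈ Z)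

theorem Ter.flip {X : Cx adj N c t} {j : Fin t} {Z : Set V} (h : Ter X j Z) : Ter X.flip j Z :=
  ⟨fun _ _ => h.1 _ (Nat.sub_le _ _), fun v hv => h.2 v hv.symm⟩

theorem Cx.in_A (X : Cx adj N c t) {j : Fin t} {Z : Set V} (h : Ter X j Z) {x : V}
    (hx : x ∈ X.D.A (X.α j)) : ReachIn adj Z (X.D.a (X.α j)) x := by
  have ha := X.D.amem _ (X.lk.αlt j)
  rcases X.D.asrc _ (X.lk.αlt j) x hx with rfl | h1
  · exact .refl
  · exact ReachIn.edge (h.2 _ (Or.inl ha)).1 (h.2 _ (Or.inl hx)).1 h1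

theorem Cx.in_good (X : Cx adj N c t) {j : Fin t} {Z : Set V} (h : Ter X j Z) {z : V}
    (hz : z ∈ Z) (hF : z ∉ X.D.F) (hE : z ∉ X.D.Em (X.α j)) : ReachIn adj Z (X.D.a (X.α j)) z := by
  obtain ⟨x, hx, hxz⟩ := (X.D.domA _ (X.lk.αlt j) z hF).resolve_left hE
  exact ReachIn.trans' (X.in_A h hx) (ReachIn.edge (h.2 _ (Or.inl hx)).1 hz hxz)

theorem Cx.in_prot (X : Cx adj N c t) {j : Fin t} {Z : Set V} (h : Ter X j Z) {v : V}
    (hv : v ∈ X.D.F) (hRZ : ∀ z ∈ X.R v, z ∈ Z) {z : V} (hz : z ∈ X.R v) :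
    ReachIn adj Z (X.D.a (X.α j)) z := by
  obtain ⟨_, h2, h3, _, _⟩ := X.hR v hv
  rcases (h3 z hz).1 with h4 | ⟨z', hz', h4, h5⟩
  · exact X.in_good h (hRZ z hz) (h2 z hz) (fun e => h4 (X.D.EM_sub (X.lk.αlt j) e))
  · exact ReachIn.trans' (X.in_good h (hRZ z' hz') (h2 z' hz') (fun e => h5 (X.D.EM_sub (X.lk.αlt j) e)))
      (ReachIn.edge (hRZ z' hz') (hRZ z hz) h4)

theorem Cx.in_F (X : Cx adj N c t) {j : Fin t} {Z : Set V} (h : Ter X j Z) {v : V}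
    (hv : v ∈ X.D.F) (hRZ : ∀ z ∈ X.R v, z ∈ Z) (hvZ : v ∈ Z) : ReachIn adj Z (X.D.a (X.α j)) v := by
  obtain ⟨w, hw, hwv⟩ := (X.hR v hv).2.2.2.1
  exact ReachIn.trans' (X.in_prot h hv hRZ hw) (ReachIn.edge (hRZ w hw) hvZ hwv)

theorem Lk.fwd {D : Dt adj N c} {FR : Finset V}
    {α β : Fin t → ℕ} {q : Fin t → ℕ → V} {l : Fin t → ℕ} (h : Lk D FR α β q l) {Z : Set V} {j : Fin t}
    {r s : ℕ} (hrs : r ≤ s) (hs : s ≤ l j) (hZ : ∀ i, r ≤ i → i ≤ s → q j i ∈ Z) :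
    ReachIn adj Z (q j r) (q j s) := by
  obtain ⟨d, rfl⟩ := Nat.exists_eq_add_of_le hrs
  induction d with
  | zero => exact .refl
  | succ d ih =>
    refine ReachIn.trans' (ih (by omega) (by omega) (fun i h1 h2 => hZ i h1 (by omega))) ?_
    exact ReachIn.edge (hZ _ (by omega) (by omega)) (hZ _ (by omega) (by omega)) (h.edge j _ (by omega))

theorem Cx.in_Q (X : Cx adj N c t) {j : Fin t} {Z : Set V} (h : Ter X j Z) {s : ℕ} (hs : s ≤ X.l j) :
    ReachIn adj Z (X.D.a (X.α j)) (X.q j s) := by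
  refine ReachIn.trans' ?_ (X.lk.fwd (Nat.zero_le s) hs (fun i _ hi => h.1 i (by omega)))
  rw [X.lk.q0]
  have hb := X.D.bmem _ (X.lk.βlt j)
  exact X.in_F h (X.BF hb) (h.2 _ (Or.inr hb)).2 (h.2 _ (Or.inr hb)).1

theorem core (X : Cx adj N c t) {j : Fin t} {Z : Set V} (h : Ter X j Z)
    (hin : ∀ z ∈ Z, ReachIn adj Z (X.D.a (X.α j)) z)
    (hout : ∀ z ∈ Z, ReachIn (flip adj) Z (X.D.b (X.β j)) z) : StrConnOn adj Z := by
  intro x hx y hy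
  have h1 : ReachIn adj Z x (X.D.b (X.β j)) := ReachIn.flip (hout x hx)
  have h2 : ReachIn adj Z (X.D.b (X.β j)) (X.D.a (X.α j)) := by
    rw [← X.lk.q0, ← X.lk.ql]
    exact X.lk.fwd (Nat.zero_le _) le_rfl (fun i _ hi => h.1 i hi)
  exact ReachIn.trans' h1 (ReachIn.trans' h2 (hin y hy))

theorem strong_root {Z : Set V} {r : V}
    (h1 : ∀ z ∈ Z, ReachIn adj Z r z) (h2 : ∀ z ∈ Z, ReachIn adj Z z r) : StrConnOn adj Z :=
  fun x hx y hy => ReachIn.trans' (h2 x hx) (h1 y hy)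

/-- vertex set of a path segment -/
noncomputable def Cx.seg (X : Cx adj N c t) (j : Fin t) (r s : ℕ) : Finset V :=
  (Finset.Icc r s).image (X.q j)

theorem Cx.mem_seg (X : Cx adj N c t) {j : Fin t} {r s : ℕ} {z : V} :
    z ∈ X.seg j r s ↔ ∃ i, (r ≤ i ∧ i ≤ s) ∧ X.q j i = z := by
  simp [Cx.seg]

theorem Cx.seg_card (X : Cx adj N c t) {j : Fin t} {r s : ℕ} (hs : s ≤ X.l j) :
    (X.seg j r s).card = s + 1 - r := by
  rw [Cx.seg, Finset.card_image_of_injOn, Nat.card_Icc]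
  intro a ha b hb e
  simp only [Finset.coe_Icc, Set.mem_Icc] at ha hb
  exact (X.lk.inj j j a (by omega) b (by omega) e).2

theorem Cx.seg_strong (X : Cx adj N c t) {j : Fin t} {r s : ℕ} (hs : s ≤ X.l j) (hrs : r + 2 ≤ s) :
    StrConnOn adj (X.seg j r s : Set V) := by
  have hm : ∀ i, r ≤ i → i ≤ s → X.q j i ∈ (X.seg j r s : Set V) := fun i h1 h2 =>
    X.mem_seg.2 ⟨i, ⟨h1, h2⟩, rfl⟩
  apply strong_root (r := X.q j r)
  · intro z hz
    obtain ⟨i, hi, rfl⟩ := X.mem_seg.1 hz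
    exact X.lk.fwd hi.1 (by omega) (fun k h1 h2 => hm k h1 (by omega))
  · intro z hz
    obtain ⟨i, hi, rfl⟩ := X.mem_seg.1 hz
    refine ReachIn.trans' (X.lk.fwd hi.2 hs (fun k h1 h2 => hm k (by omega) h2)) ?_
    exact ReachIn.edge (hm _ (by omega) le_rfl) (hm _ le_rfl (by omega)) (X.lk.back X.mn X.hT j hrs hs)

/-- usable vertices -/
def Usable (X : Cx adj N c t) (j : Fin t) (U : Finset V) : Prop :=
  ∀ u ∈ U, u ∉ X.D.F ∧ u ∉ X.RR ∧ u ∉ X.D.Em (X.α j) ∧ u ∉ X.D.Ep (X.β j) ∧ ∀ s ≤ X.l j, X.q j s ≠ u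

theorem Usable.flip {X : Cx adj N c t} {j : Fin t} {U : Finset V} (h : Usable X j U) :
    Usable X.flip j U := by
  intro u hu
  obtain ⟨h1, h2, h3, h4, h5⟩ := h u hu
  exact ⟨h1, h2, h4, h3, fun s _ => h5 _ (Nat.sub_le _ _)⟩

theorem Cx.q_not_RR (X : Cx adj N c t) {j : Fin t} {s : ℕ} (hs : s ≤ X.l j) : X.q j s ∉ X.RR := by
  intro h
  rcases Nat.eq_zero_or_pos s with h0 | h0
  · subst h0; rw [X.lk.q0] at h; exact X.RR_not_F h (X.D.b_mem_F (X.lk.βlt j))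
  · rcases hs.lt_or_eq with h1 | h1
    · exact X.lk.int j s h0 h1 (Finset.mem_union_right _ h)
    · rw [h1, X.lk.ql] at h; exact X.RR_not_F h (X.D.a_mem_F (X.lk.αlt j))

/-- type II, case (b) -/
theorem typeB (X : Cx adj N c t) (j : Fin t) (U : Finset V) (hU : Usable X j U) (e : ℕ) (he : 1 ≤ e)
    (hc : (c + 2) * e ≤ U.card)
    (hb : ∀ u ∈ U, adj (X.q j (X.l j - 1)) u ∧ adj (X.D.b (X.β j)) u) :
    ∃ Z : Finset V, StrConnOn adj (Z : Set V) ∧ Z.card = X.l j + 1 + e ∧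
      (∀ s < X.l j, X.q j s ∈ Z) ∧ (∀ z ∈ Z, z ∉ X.RR) ∧
      ∀ z ∈ Z, z ∈ U ∨ (∃ s ≤ X.l j, X.q j s = z) ∨ (z ∈ X.D.A (X.α j) ∨ z ∈ X.D.B (X.β j)) := by
  have hl := X.lk.lpos j
  have hex : ∀ u ∈ U, ∃ b ∈ X.D.B (X.β j), adj u b := fun u hu =>
    (X.D.domB _ (X.lk.βlt j) u (hU u hu).1).resolve_left (hU u hu).2.2.2.1
  choose! f hf1 hf2 using hex
  obtain ⟨b, hbB, hfib⟩ := Finset.exists_lt_card_fiber_of_mul_lt_card_of_maps_to (s := U)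
    (t := X.D.B (X.β j)) (f := f) (n := e - 1) hf1 (by
      have h1 := X.D.cB _ (X.lk.βlt j)
      have h2 : (X.D.B (X.β j)).card * (e-1) ≤ (c+2) * (e-1) := Nat.mul_le_mul_right _ h1
      have h3 : (c+2) * e = (c+2) * (e-1) + (c+2) := by
        obtain ⟨k, rfl⟩ := Nat.exists_eq_add_of_le he
        simp; ring
      omega)
  obtain ⟨S, hS, hSc⟩ := Finset.exists_subset_card_eq (show e ≤ (U.filter (fun x => f x = b)).card by omega)
  have hSU : ∀ u ∈ S, u ∈ U ∧ adj u b := by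
    intro u hu
    have := Finset.mem_filter.1 (hS hu)
    exact ⟨this.1, this.2 ▸ hf2 u this.1⟩
  obtain ⟨v, hv⟩ : S.Nonempty := by rw [← Finset.card_pos]; omega
  have hbb : b ≠ X.D.b (X.β j) := by
    rintro rfl
    exact X.hT.2.1 _ _ (hb v (hSU v hv).1).2 (hSU v hv).2
  have hbedge : adj b (X.D.b (X.β j)) := (X.D.bsnk _ (X.lk.βlt j) b hbB).resolve_left hbb
  have hbQ : ∀ s ≤ X.l j, X.q j s ≠ b := by
    intro s hs h
    rcases Nat.eq_zero_or_pos s with h0 | h0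
    · subst h0; rw [X.lk.q0] at h; exact hbb h.symm
    · rcases hs.lt_or_eq with h1 | h1
      · exact X.lk.int j s h0 h1 (Finset.mem_union_left _ (h ▸ X.BF hbB))
      · rw [h1, X.lk.ql] at h
        exact Finset.disjoint_left.1 (X.D.dAB _ (X.lk.αlt j) _ (X.lk.βlt j)) (X.D.amem _ (X.lk.αlt j)) (h ▸ hbB)
  set Z := X.seg j 0 (X.l j - 1) ∪ insert b S with hZ
  have hmq : ∀ s, s < X.l j → X.q j s ∈ Z := fun s hs =>
    Finset.mem_union_left _ (X.mem_seg.2 ⟨s, ⟨by omega, by omega⟩, rfl⟩)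
  have hmb : b ∈ Z := by simp [hZ]
  have hmS : ∀ u ∈ S, u ∈ Z := fun u hu => by simp [hZ, hu]
  have hcase : ∀ z ∈ Z, (∃ s < X.l j, X.q j s = z) ∨ z = b ∨ z ∈ S := by
    intro z hz
    rcases Finset.mem_union.1 hz with h | h
    · obtain ⟨s, hs, h⟩ := X.mem_seg.1 h
      exact Or.inl ⟨s, by omega, h⟩
    · exact Or.inr (Finset.mem_insert.1 h)
  refine ⟨Z, ?_, ?_, hmq, ?_, ?_⟩
  · have hfw : ∀ s < X.l j, ReachIn adj (Z : Set V) (X.q j 0) (X.q j s) := fun s hs =>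
      X.lk.fwd (Nat.zero_le _) hs.le (fun i _ hi => hmq i (by omega))
    have hbr : ReachIn adj (Z : Set V) b (X.q j 0) :=
      ReachIn.edge hmb (hmq 0 (by omega)) (by rw [X.lk.q0]; exact hbedge)
    have hSb : ∀ u ∈ S, ReachIn adj (Z : Set V) u b := fun u hu =>
      ReachIn.edge (hmS u hu) hmb (hSU u hu).2
    have hqS : ∀ u ∈ S, ReachIn adj (Z : Set V) (X.q j (X.l j - 1)) u := fun u hu =>
      ReachIn.edge (hmq _ (by omega)) (hmS u hu) (hb u (hSU u hu).1).1
    apply strong_root (r := X.q j 0)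
    · intro z hz
      rcases hcase z hz with ⟨s, hs, rfl⟩ | rfl | h
      · exact hfw s hs
      · exact ReachIn.trans' (hfw _ (by omega)) (ReachIn.trans' (hqS v hv) (hSb v hv))
      · exact ReachIn.trans' (hfw _ (by omega)) (hqS z h)
    · intro z hz
      rcases hcase z hz with ⟨s, hs, rfl⟩ | rfl | h
      · refine ReachIn.trans' (X.lk.fwd (s := X.l j - 1) (by omega) (by omega)
          (fun i _ hi => hmq i (by omega))) ?_
        exact ReachIn.trans' (hqS v hv) (ReachIn.trans' (hSb v hv) hbr)
      · exact hbr
      · exact ReachIn.trans' (hSb z h) hbr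
  · rw [hZ, Finset.card_union_of_disjoint, Finset.card_insert_of_notMem, X.seg_card (by omega), hSc]
    · omega
    · intro h
      exact (hU b (hSU b h).1).1 (X.BF hbB)
    · rw [Finset.disjoint_left]
      intro z hz hz'
      obtain ⟨s, hs, rfl⟩ := X.mem_seg.1 hz
      rcases Finset.mem_insert.1 hz' with h | h
      · exact hbQ s (by omega) h
      · exact (hU _ (hSU _ h).1).2.2.2.2 s (by omega) rfl
  · intro z hz
    rcases hcase z hz with ⟨s, hs, rfl⟩ | rfl | h
    · exact X.q_not_RR hs.le
    · exact fun h => X.RR_not_F h (X.BF hbB)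
    · exact (hU _ (hSU _ h).1).2.1
  · intro z hz
    rcases hcase z hz with ⟨s, hs, rfl⟩ | rfl | h
    · exact Or.inr (Or.inl ⟨s, hs.le, rfl⟩)
    · exact Or.inr (Or.inr (Or.inr hbB))
    · exact Or.inl (hSU z h).1

theorem typeC (X : Cx adj N c t) (j : Fin t) (U : Finset V) (hU : Usable X j U) (e : ℕ) (he : 1 ≤ e)
    (hc : (c + 2) * e ≤ U.card)
    (hb : ∀ u ∈ U, adj u (X.q j 1) ∧ adj u (X.D.a (X.α j))) :
    ∃ Z : Finset V, StrConnOn adj (Z : Set V) ∧ Z.card = X.l j + 1 + e ∧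
      (∀ s, 1 ≤ s → s ≤ X.l j → X.q j s ∈ Z) ∧ (∀ z ∈ Z, z ∉ X.RR) ∧
      ∀ z ∈ Z, z ∈ U ∨ (∃ s ≤ X.l j, X.q j s = z) ∨ (z ∈ X.D.A (X.α j) ∨ z ∈ X.D.B (X.β j)) := by
  have hl := X.lk.lpos j
  obtain ⟨Z, h1, h2, h3, h4, h5⟩ := typeB X.flip j U hU.flip e he hc (by
    intro u hu
    have : X.flip.q j (X.flip.l j - 1) = X.q j 1 := by
      change X.q j (X.l j - (X.l j - 1)) = X.q j 1
      congr 1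
      omega
    rw [this]
    exact hb u hu)
  refine ⟨Z, fun x hx y hy => ReachIn.flip (h1 y hy x hx), h2, ?_, h4, ?_⟩
  · intro s hs hs'
    have := h3 (X.l j - s) (show X.l j - s < X.l j by omega)
    change X.q j (X.l j - (X.l j - s)) ∈ Z at this
    rwa [show X.l j - (X.l j - s) = s by omega] at this
  · intro z hz
    rcases h5 z hz with h | ⟨s, hs, h⟩ | h
    · exact Or.inl h
    · exact Or.inr (Or.inl ⟨X.l j - s, Nat.sub_le _ _, h⟩)
    · exact Or.inr (Or.inr h.symm)

theorem typeA (X : Cx adj N c t) (j : Fin t) (S : Finset V) (hU : Usable X j S) (he : 1 ≤ S.card)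
    (hb : ∀ u ∈ S, (adj u (X.q j (X.l j - 1)) ∨ adj u (X.q j 0)) ∧ (adj (X.q j 1) u ∨ adj (X.q j (X.l j)) u)) :
    StrConnOn adj ((X.seg j 0 (X.l j) ∪ S : Finset V) : Set V) ∧
      (X.seg j 0 (X.l j) ∪ S).card = X.l j + 1 + S.card := by
  have hl := X.lk.lpos j
  set Z := X.seg j 0 (X.l j) ∪ S with hZ
  have hmq : ∀ s, s ≤ X.l j → X.q j s ∈ Z := fun s hs =>
    Finset.mem_union_left _ (X.mem_seg.2 ⟨s, ⟨by omega, by omega⟩, rfl⟩)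
  have hmS : ∀ u ∈ S, u ∈ Z := fun u hu => by simp [hZ, hu]
  have hfw : ∀ r s, r ≤ s → s ≤ X.l j → ReachIn adj (Z : Set V) (X.q j r) (X.q j s) := fun r s hrs hs =>
      X.lk.fwd hrs hs (fun i _ hi => hmq i (by omega))
  have hto : ∀ u ∈ S, ∃ s ≤ X.l j, (X.l j = 1 → s = 0) ∧ adj u (X.q j s) := by
    intro u hu
    rcases (hb u hu).1 with h | h
    · exact ⟨_, Nat.sub_le _ _, by omega, h⟩
    · exact ⟨0, by omega, by omega, h⟩
  have hfrom : ∀ u ∈ S, ∃ s ≤ X.l j, (X.l j = 1 → s = 1) ∧ adj (X.q j s) u := by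
    intro u hu
    rcases (hb u hu).2 with h | h
    · exact ⟨1, by omega, by omega, h⟩
    · exact ⟨_, le_rfl, by omega, h⟩
  obtain ⟨v, hv⟩ : S.Nonempty := by rw [← Finset.card_pos]; omega
  have hback : ReachIn adj (Z : Set V) (X.q j (X.l j)) (X.q j 0) := by
    rcases (show X.l j = 1 ∨ 2 ≤ X.l j by omega) with h1 | h1
    · obtain ⟨s, hs, h2, h3⟩ := hto v hv
      obtain ⟨s', hs', h2', h3'⟩ := hfrom v hv
      rw [h2 h1] at h3
      rw [h2' h1, ← h1] at h3'
      exact ReachIn.trans' (ReachIn.edge (hmq _ le_rfl) (hmS v hv) h3')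
        (ReachIn.edge (hmS v hv) (hmq _ (by omega)) h3)
    · exact ReachIn.edge (hmq _ le_rfl) (hmq _ (by omega)) (X.lk.back X.mn X.hT j (by omega) le_rfl)
  have hcase : ∀ z ∈ Z, (∃ s ≤ X.l j, X.q j s = z) ∨ z ∈ S := by
    intro z hz
    rcases Finset.mem_union.1 hz with h | h
    · obtain ⟨s, hs, h⟩ := X.mem_seg.1 h
      exact Or.inl ⟨s, by omega, h⟩
    · exact Or.inr h
  refine ⟨?_, ?_⟩
  · apply strong_root (r := X.q j 0)
    · intro z hz
      rcases hcase z hz with ⟨s, hs, rfl⟩ | h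
      · exact hfw 0 s (by omega) hs
      · obtain ⟨s, hs, _, h3⟩ := hfrom z h
        exact ReachIn.trans' (hfw 0 s (by omega) hs) (ReachIn.edge (hmq s hs) hz h3)
    · intro z hz
      rcases hcase z hz with ⟨s, hs, rfl⟩ | h
      · exact ReachIn.trans' (hfw s _ hs le_rfl) hback
      · obtain ⟨s, hs, _, h3⟩ := hto z h
        exact ReachIn.trans' (ReachIn.edge hz (hmq s hs) h3) (ReachIn.trans' (hfw s _ hs le_rfl) hback)
  · rw [hZ, Finset.card_union_of_disjoint, X.seg_card le_rfl]
    · omega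
    · rw [Finset.disjoint_left]
      intro z hz hz'
      obtain ⟨s, hs, rfl⟩ := X.mem_seg.1 hz
      exact (hU _ hz').2.2.2.2 s (by omega) rfl

end


section
variable [Fintype V] {adj : V → V → Prop} {N c t : ℕ}

/-- dominators of class `j` -/
noncomputable def Cx.Ff (X : Cx adj N c t) (j : Fin t) : Finset V := X.D.A (X.α j) ∪ X.D.B (X.β j)

/-- territory -/
noncomputable def Cx.T (X : Cx adj N c t) (j : Fin t) : Finset V :=
  X.seg j 0 (X.l j) ∪ (X.Ff j ∪ (X.Ff j).biUnion X.R)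

theorem Cx.mem_T (X : Cx adj N c t) {j : Fin t} {z : V} : z ∈ X.T j ↔
    (∃ s ≤ X.l j, X.q j s = z) ∨ (z ∈ X.D.A (X.α j) ∨ z ∈ X.D.B (X.β j)) ∨
      ∃ w, (w ∈ X.D.A (X.α j) ∨ w ∈ X.D.B (X.β j)) ∧ z ∈ X.R w := by
  simp [Cx.T, Cx.Ff, Cx.mem_seg, or_assoc]

theorem Cx.FfF (X : Cx adj N c t) {j : Fin t} {w : V}
    (h : w ∈ X.D.A (X.α j) ∨ w ∈ X.D.B (X.β j)) : w ∈ X.D.F := by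
  rcases h with h | h
  · exact X.AF h
  · exact X.BF h

theorem Cx.T_card (X : Cx adj N c t) (j : Fin t) : (X.T j).card ≤ X.l j + 1 + 18 * (c + 2) := by
  have h1 : (X.T j).card ≤ (X.seg j 0 (X.l j)).card + (X.Ff j ∪ (X.Ff j).biUnion X.R).card :=
    Finset.card_union_le _ _
  have h2 := Finset.card_union_le (X.Ff j) ((X.Ff j).biUnion X.R)
  have h3 : (X.Ff j).card ≤ (X.D.A (X.α j)).card + (X.D.B (X.β j)).card := Finset.card_union_le _ _
  have h4 : ((X.Ff j).biUnion X.R).card ≤ (X.Ff j).card * 8 :=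
    Finset.card_biUnion_le_card_mul _ _ _ (fun w hw => (X.hR w (X.FfF (Finset.mem_union.1 hw))).1)
  have h5 := X.D.cA _ (X.lk.αlt j)
  have h6 := X.D.cB _ (X.lk.βlt j)
  rw [X.seg_card le_rfl] at h1
  omega

theorem Cx.ter_of (X : Cx adj N c t) {j : Fin t} {Z : Finset V} (h : X.T j ⊆ Z) :
    Ter X j (Z : Set V) :=
  ⟨fun s hs => h (X.mem_T.2 (Or.inl ⟨s, hs, rfl⟩)), fun v hv =>
    ⟨h (X.mem_T.2 (Or.inr (Or.inl hv))), fun w hw => h (X.mem_T.2 (Or.inr (Or.inr ⟨v, hv, hw⟩)))⟩⟩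

theorem Cx.in_T (X : Cx adj N c t) {j : Fin t} {Z : Set V} (h : Ter X j Z) {z : V}
    (hz : (∃ s ≤ X.l j, X.q j s = z) ∨ (z ∈ X.D.A (X.α j) ∨ z ∈ X.D.B (X.β j)) ∨
      ∃ w, (w ∈ X.D.A (X.α j) ∨ w ∈ X.D.B (X.β j)) ∧ z ∈ X.R w) :
    ReachIn adj Z (X.D.a (X.α j)) z := by
  rcases hz with ⟨s, hs, rfl⟩ | hz | ⟨w, hw, hz⟩
  · exact X.in_Q h hs
  · exact X.in_F h (X.FfF hz) (h.2 _ hz).2 (h.2 _ hz).1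
  · exact X.in_prot h (X.FfF hw) (h.2 _ hw).2 hz

theorem Cx.out_T (X : Cx adj N c t) {j : Fin t} {Z : Set V} (h : Ter X j Z) {z : V}
    (hz : (∃ s ≤ X.l j, X.q j s = z) ∨ (z ∈ X.D.A (X.α j) ∨ z ∈ X.D.B (X.β j)) ∨
      ∃ w, (w ∈ X.D.A (X.α j) ∨ w ∈ X.D.B (X.β j)) ∧ z ∈ X.R w) :
    ReachIn (_root_.flip adj) Z (X.D.b (X.β j)) z := by
  refine X.flip.in_T h.flip (j := j) ?_
  rcases hz with ⟨s, hs, rfl⟩ | hz | ⟨w, hw, hz⟩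
  · refine Or.inl ⟨X.l j - s, Nat.sub_le _ _, ?_⟩
    change X.q j (X.l j - (X.l j - s)) = _
    congr 1; omega
  · exact Or.inr (Or.inl hz.symm)
  · exact Or.inr (Or.inr ⟨w, hw.symm, hz⟩)

/-- requirement on a class `j` different from the special one -/
def ClassOK (X : Cx adj N c t) (j : Fin t) (Z : Finset V) : Prop :=
  X.T j ⊆ Z ∨ ((∀ z ∈ Z, z ∉ X.RR) ∧
    (2 ≤ X.l j → X.q j 1 ∈ Z ∧ (X.q j (X.l j - 1) ∈ Z ∨ X.q j (X.l j - 2) ∉ Z)))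

theorem classLemma (X : Cx adj N c t) (j : Fin t) (U : Finset V) (hU : Usable X j U) (L : ℕ)
    (hL : 3 ≤ L) (hLU : L ≤ U.card) (hc : 54 * (c + 2) * (c + 2) ≤ U.card) :
    ∃ Z : Finset V, StrConnOn adj (Z : Set V) ∧ Z.card = L ∧ (∀ z ∈ Z, z ∈ X.T j ∨ z ∈ U) ∧
      ClassOK X j Z := by
  have hl := X.lk.lpos j
  have hTU : Disjoint (X.T j) U := by
    rw [Finset.disjoint_left]
    intro z hz hzU
    obtain ⟨h1, h2, _, _, h5⟩ := hU z hzU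
    rcases X.mem_T.1 hz with ⟨s, hs, h⟩ | h | ⟨w, hw, h⟩
    · exact h5 s hs h
    · exact h1 (X.FfF h)
    · exact h2 (Finset.mem_biUnion.2 ⟨w, X.FfF hw, h⟩)
  rcases (show L ≤ X.l j + 1 ∨ (X.l j + 1 < L ∧ L ≤ (X.T j).card) ∨ (X.T j).card < L by omega) with
    h | ⟨h, h'⟩ | h
  · -- type I
    have hsegsub : ∀ r s, s ≤ X.l j → ∀ z ∈ X.seg j r s, z ∈ X.T j ∨ z ∈ U := by
      intro r s hs z hz
      obtain ⟨i, hi, rfl⟩ := X.mem_seg.1 hz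
      exact Or.inl (X.mem_T.2 (Or.inl ⟨i, by omega, rfl⟩))
    have hsegR : ∀ r s, s ≤ X.l j → ∀ z ∈ X.seg j r s, z ∉ X.RR := by
      intro r s hs z hz
      obtain ⟨i, hi, rfl⟩ := X.mem_seg.1 hz
      exact X.q_not_RR (by omega)
    by_cases h1 : L = X.l j - 1
    · refine ⟨X.seg j 1 (X.l j - 1), X.seg_strong (by omega) (by omega), ?_, hsegsub _ _ (by omega),
        Or.inr ⟨hsegR _ _ (by omega), fun _ => ⟨?_, Or.inl ?_⟩⟩⟩
      · rw [X.seg_card (by omega)]; omega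
      · exact X.mem_seg.2 ⟨1, by omega, rfl⟩
      · exact X.mem_seg.2 ⟨X.l j - 1, by omega, rfl⟩
    · refine ⟨X.seg j 0 (L - 1), X.seg_strong (by omega) (by omega), ?_, hsegsub _ _ (by omega),
        Or.inr ⟨hsegR _ _ (by omega), fun _ => ⟨?_, ?_⟩⟩⟩
      · rw [X.seg_card (by omega)]; omega
      · exact X.mem_seg.2 ⟨1, by omega, rfl⟩
      · by_cases h2 : L + 1 < X.l j
        · right
          intro hm
          obtain ⟨i, hi, e⟩ := X.mem_seg.1 hm
          have := (X.lk.inj j j i (by omega) _ (by omega) e).2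
          omega
        · left
          exact X.mem_seg.2 ⟨X.l j - 1, by omega, rfl⟩
  · -- type II
    obtain ⟨e, rfl⟩ := Nat.exists_eq_add_of_le h.le
    have he : 1 ≤ e := by omega
    have he' : e ≤ 18 * (c + 2) := by have := X.T_card j; omega
    have hce : (c + 2) * e + (c + 2) * e + e ≤ U.card := by
      refine le_trans ?_ hc
      have : (c + 2) * e ≤ (c + 2) * (18 * (c + 2)) := Nat.mul_le_mul_left _ he'
      nlinarith
    have hTsub : ∀ W : Finset V, W ⊆ U → ∀ z, (z ∈ W ∨ (∃ s ≤ X.l j, X.q j s = z) ∨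
        (z ∈ X.D.A (X.α j) ∨ z ∈ X.D.B (X.β j))) → z ∈ X.T j ∨ z ∈ U := by
      intro W hW z hz
      rcases hz with hz | hz | hz
      · exact Or.inr (hW hz)
      · exact Or.inl (X.mem_T.2 (Or.inl hz))
      · exact Or.inl (X.mem_T.2 (Or.inr (Or.inl hz)))
    set Ub := U.filter (fun u => adj (X.q j (X.l j - 1)) u ∧ adj (X.D.b (X.β j)) u) with hUb
    set Uc := U.filter (fun u => adj u (X.q j 1) ∧ adj u (X.D.a (X.α j))) with hUc
    have hsub : ∀ {W : Finset V}, W ⊆ U → Usable X j W := fun hW u hu => hU u (hW hu)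
    by_cases hb : (c + 2) * e ≤ Ub.card
    · obtain ⟨Z, h1, h2, h3, h4, h5⟩ := typeB X j Ub (hsub (Finset.filter_subset _ _)) e he hb
        (fun u hu => (Finset.mem_filter.1 hu).2)
      exact ⟨Z, h1, h2, fun z hz => hTsub Ub (Finset.filter_subset _ _) z (h5 z hz),
        Or.inr ⟨h4, fun h => ⟨h3 1 (by omega), Or.inl (h3 _ (by omega))⟩⟩⟩
    by_cases hc' : (c + 2) * e ≤ Uc.card
    · obtain ⟨Z, h1, h2, h3, h4, h5⟩ := typeC X j Uc (hsub (Finset.filter_subset _ _)) e he hc'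
        (fun u hu => (Finset.mem_filter.1 hu).2)
      exact ⟨Z, h1, h2, fun z hz => hTsub Uc (Finset.filter_subset _ _) z (h5 z hz),
        Or.inr ⟨h4, fun h => ⟨h3 1 (by omega) (by omega), Or.inl (h3 _ (by omega) (by omega))⟩⟩⟩
    have hac : e ≤ (U \ (Ub ∪ Uc)).card := by
      have h1 := Finset.card_union_le Ub Uc
      have h2 := Finset.le_card_sdiff (Ub ∪ Uc) U
      omega
    obtain ⟨S, hS, hSc⟩ := Finset.exists_subset_card_eq hac
    have hSU : S ⊆ U := fun z hz => (Finset.mem_sdiff.1 (hS hz)).1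
    obtain ⟨h1, h2⟩ := typeA X j S (hsub hSU) (by omega) (by
      intro u hu
      have h3 := (Finset.mem_sdiff.1 (hS hu)).2
      have huU := hSU hu
      rw [Finset.mem_union, not_or, hUb, hUc, Finset.mem_filter, Finset.mem_filter] at h3
      have hq := (hU u huU).2.2.2.2
      have t1 := X.hT.2.2 _ _ (hq (X.l j - 1) (by omega))
      have t2 := X.hT.2.2 _ _ (hq 0 (by omega))
      have t3 := X.hT.2.2 _ _ (hq 1 (by omega))
      have t4 := X.hT.2.2 _ _ (hq (X.l j) (by omega))
      rw [← X.lk.q0, ← X.lk.ql] at h3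
      have a3 := X.hT.2.1 u (X.q j 1)
      have a4 := X.hT.2.1 u (X.q j (X.l j))
      tauto)
    have hm : ∀ s ≤ X.l j, X.q j s ∈ X.seg j 0 (X.l j) ∪ S := fun s hs =>
      Finset.mem_union_left _ (X.mem_seg.2 ⟨s, by omega, rfl⟩)
    have hcase : ∀ z ∈ X.seg j 0 (X.l j) ∪ S, (∃ s ≤ X.l j, X.q j s = z) ∨ z ∈ S := by
      intro z hz
      rcases Finset.mem_union.1 hz with h | h
      · obtain ⟨s, hs, h⟩ := X.mem_seg.1 h
        exact Or.inl ⟨s, by omega, h⟩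
      · exact Or.inr h
    refine ⟨_, h1, by omega, ?_, Or.inr ⟨?_, fun h => ⟨hm 1 (by omega), Or.inl (hm _ (by omega))⟩⟩⟩
    · intro z hz
      rcases hcase z hz with h | h
      · exact Or.inl (X.mem_T.2 (Or.inl h))
      · exact Or.inr (hSU h)
    · intro z hz
      rcases hcase z hz with ⟨s, hs, rfl⟩ | h
      · exact X.q_not_RR hs
      · exact (hU z (hSU h)).2.1
  · -- large
    obtain ⟨S, hS, hSc⟩ := Finset.exists_subset_card_eq (show L - (X.T j).card ≤ U.card by omega)
    have hter : Ter X j ((X.T j ∪ S : Finset V) : Set V) := X.ter_of Finset.subset_union_left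
    refine ⟨X.T j ∪ S, core X hter ?_ ?_, ?_, ?_, Or.inl Finset.subset_union_left⟩
    · intro z hz
      rcases Finset.mem_union.1 hz with h | h
      · exact X.in_T hter (X.mem_T.1 h)
      · exact X.in_good hter hz (hU z (hS h)).1 (hU z (hS h)).2.2.1
    · intro z hz
      rcases Finset.mem_union.1 hz with h | h
      · exact X.out_T hter (X.mem_T.1 h)
      · exact X.flip.in_good hter.flip hz (hU z (hS h)).1 (hU z (hS h)).2.2.2.1
    · rw [Finset.card_union_of_disjoint, hSc]
      · omega
      · exact Finset.disjoint_of_subset_right hS hTU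
    · intro z hz
      rcases Finset.mem_union.1 hz with h | h
      · exact Or.inl h
      · exact Or.inr (hS h)

end


section
variable [Fintype V] {adj : V → V → Prop} {N c t : ℕ}

/-- generic vertices -/
noncomputable def Cx.G (X : Cx adj N c t) : Finset V :=
  Finset.univ.filter (fun v => v ∉ X.D.F ∧ v ∉ X.RR ∧ ∀ k, ∀ s ≤ X.l k, X.q k s ≠ v)

theorem Cx.mem_G (X : Cx adj N c t) {v : V} :
    v ∈ X.G ↔ v ∉ X.D.F ∧ v ∉ X.RR ∧ ∀ k, ∀ s ≤ X.l k, X.q k s ≠ v := by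
  simp [Cx.G]

theorem Cx.G_flip (X : Cx adj N c t) : X.flip.G = X.G := by
  ext v
  rw [Cx.mem_G, Cx.mem_G]
  refine and_congr Iff.rfl (and_congr Iff.rfl ?_)
  constructor
  · intro h k s hs
    have := h k (X.l k - s) (Nat.sub_le _ _)
    change X.q k (X.l k - (X.l k - s)) ≠ v at this
    rwa [show X.l k - (X.l k - s) = s by omega] at this
  · intro h k s hs
    exact h k _ (Nat.sub_le _ _)

theorem Cx.q_F (X : Cx adj N c t) {j : Fin t} {s : ℕ} (hs : s ≤ X.l j) (h : X.q j s ∈ X.D.F) :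
    X.q j s ∈ X.D.A (X.α j) ∨ X.q j s ∈ X.D.B (X.β j) := by
  rcases Nat.eq_zero_or_pos s with h0 | h0
  · subst h0; right; rw [X.lk.q0]; exact X.D.bmem _ (X.lk.βlt j)
  · rcases hs.lt_or_eq with h1 | h1
    · exact absurd (Finset.mem_union_left _ h) (X.lk.int j s h0 h1)
    · left; rw [h1, X.lk.ql]; exact X.D.amem _ (X.lk.αlt j)

theorem Cx.T_F (X : Cx adj N c t) {j : Fin t} {z : V} (h : z ∈ X.T j) (hF : z ∈ X.D.F) :
    z ∈ X.D.A (X.α j) ∨ z ∈ X.D.B (X.β j) := by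
  rcases X.mem_T.1 h with ⟨s, hs, rfl⟩ | h | ⟨w, hw, h⟩
  · exact X.q_F hs hF
  · exact h
  · exact absurd hF ((X.hR w (X.FfF hw)).2.1 z h)

theorem Cx.T_R (X : Cx adj N c t) {j : Fin t} {z w : V} (h : z ∈ X.T j) (hw : w ∈ X.D.F)
    (hz : z ∈ X.R w) : w ∈ X.D.A (X.α j) ∨ w ∈ X.D.B (X.β j) := by
  have hRR : z ∈ X.RR := Finset.mem_biUnion.2 ⟨w, hw, hz⟩
  rcases X.mem_T.1 h with ⟨s, hs, rfl⟩ | h | ⟨w', hw', h⟩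
  · exact absurd hRR (X.q_not_RR hs)
  · exact absurd (X.FfF h) (X.RR_not_F hRR)
  · by_cases e : w' = w
    · exact e ▸ hw'
    · exact absurd hz (Finset.disjoint_left.1 (X.Rd _ (X.FfF hw') _ hw e) h)

theorem Cx.Ff_disj (X : Cx adj N c t) {i j : Fin t} (hij : i ≠ j) {z : V}
    (h1 : z ∈ X.D.A (X.α i) ∨ z ∈ X.D.B (X.β i)) (h2 : z ∈ X.D.A (X.α j) ∨ z ∈ X.D.B (X.β j)) :
    False := by
  rcases h1 with h1 | h1 <;> rcases h2 with h2 | h2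
  · exact Finset.disjoint_left.1 (X.D.dAA _ (X.lk.αlt i) _ (X.lk.αlt j)
      (fun e => hij (X.lk.αinj _ _ e))) h1 h2
  · exact Finset.disjoint_left.1 (X.D.dAB _ (X.lk.αlt i) _ (X.lk.βlt j)) h1 h2
  · exact Finset.disjoint_left.1 (X.D.dAB _ (X.lk.αlt j) _ (X.lk.βlt i)) h2 h1
  · exact Finset.disjoint_left.1 (X.D.dBB _ (X.lk.βlt i) _ (X.lk.βlt j)
      (fun e => hij (X.lk.βinj _ _ e))) h1 h2

theorem Cx.T_disj (X : Cx adj N c t) {i j : Fin t} (hij : i ≠ j) {z : V}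
    (h1 : z ∈ X.T i) (h2 : z ∈ X.T j) : False := by
  rcases X.mem_T.1 h1 with ⟨s, hs, rfl⟩ | h | ⟨w, hw, h⟩
  · rcases X.mem_T.1 h2 with ⟨s', hs', e⟩ | h | ⟨w, hw, h⟩
    · exact hij (X.lk.inj _ _ _ hs' _ hs e).1.symm
    · exact X.Ff_disj hij (X.q_F hs (X.FfF h)) h
    · exact X.q_not_RR hs (Finset.mem_biUnion.2 ⟨w, X.FfF hw, h⟩)
  · exact X.Ff_disj hij h (X.T_F h2 (X.FfF h))
  · exact X.Ff_disj hij hw (X.T_R h2 (X.FfF hw) h)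

theorem Cx.T_G (X : Cx adj N c t) {j : Fin t} {z : V} (h1 : z ∈ X.T j) (h2 : z ∈ X.G) : False := by
  obtain ⟨hF, hR, hq⟩ := X.mem_G.1 h2
  rcases X.mem_T.1 h1 with ⟨s, hs, h⟩ | h | ⟨w, hw, h⟩
  · exact hq _ s hs h
  · exact hF (X.FfF h)
  · exact hR (Finset.mem_biUnion.2 ⟨w, X.FfF hw, h⟩)

theorem lastIn (X : Cx adj N c t) (m : Fin t) (Z : Set V) (hter : Ter X m Z)
    (hF : ∀ v ∈ X.D.F, v ∈ Z → ∀ h ∈ X.R v, h ∈ Z)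
    (hRR : ∀ v ∈ X.D.F, ∀ h ∈ X.R v, h ∈ Z → ∀ h' ∈ X.R v, h' ∈ Z)
    {i : ℕ} (hi : i < N) (hiu : ∀ k, X.α k ≠ i) (hx : X.D.a i ∈ Z)
    (hQ : ∀ j, 2 ≤ X.l j → X.q j (X.l j - 1) ∈ Z → X.q j (X.l j - 2) ∈ Z)
    (hG : ∀ v ∈ X.G, v ∈ Z → v ∈ X.D.Em (X.α m) → adj v (X.D.a i) →
      ∃ w ∈ Z, adj w v ∧ w ∉ X.D.F ∧ w ∉ X.D.Em (X.α m)) :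
    ∀ z ∈ Z, ReachIn adj Z (X.D.a (X.α m)) z := by
  have hxF := X.D.a_mem_F hi
  have hxr : ReachIn adj Z (X.D.a (X.α m)) (X.D.a i) := X.in_F hter hxF (hF _ hxF hx) hx
  have hFR : X.D.F ⊆ X.D.F ∪ X.D.F.biUnion X.R := Finset.subset_union_left
  have hxq : ∀ j s, s + 2 ≤ X.l j → X.q j s ∈ Z → ReachIn adj Z (X.D.a (X.α m)) (X.q j s) :=
    fun j s hs hz => ReachIn.trans' hxr
      (ReachIn.edge hx hz (X.lk.x_to X.mn X.hT hFR hi hiu j hs))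
  intro z hz
  by_cases h1 : z ∈ X.D.F
  · exact X.in_F hter h1 (hF z h1 hz) hz
  by_cases h2 : z ∈ X.RR
  · obtain ⟨v, hv, hzv⟩ := Finset.mem_biUnion.1 h2
    exact X.in_prot hter hv (hRR v hv z hzv hz) hzv
  by_cases h3 : ∃ k, ∃ s ≤ X.l k, X.q k s = z
  · obtain ⟨k, s, hs, rfl⟩ := h3
    by_cases h4 : s + 2 ≤ X.l k
    · exact hxq k s h4 hz
    by_cases h5 : s = X.l k
    · subst h5; rw [X.lk.ql] at h1; exact absurd (X.D.a_mem_F (X.lk.αlt k)) h1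
    by_cases h6 : s = 0
    · subst h6; rw [X.lk.q0] at h1; exact absurd (X.D.b_mem_F (X.lk.βlt k)) h1
    have e : s = X.l k - 1 := by omega
    subst e
    have h7 := hQ k (by omega) hz
    refine ReachIn.trans' (hxq k _ (by omega) h7) (ReachIn.edge h7 hz ?_)
    have := X.lk.edge k (X.l k - 2) (by omega)
    rwa [show X.l k - 2 + 1 = X.l k - 1 by omega] at this
  · have hzG : z ∈ X.G := X.mem_G.2 ⟨h1, h2, fun k s hs e => h3 ⟨k, s, hs, e⟩⟩
    by_cases h4 : z ∈ X.D.Em (X.α m)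
    · rcases X.hT.2.2 z (X.D.a i) (fun e => h1 (e ▸ hxF)) with h5 | h5
      · obtain ⟨w, hw, hwz, hwF, hwE⟩ := hG z hzG hz h4 h5
        exact ReachIn.trans' (X.in_good hter hw hwF hwE) (ReachIn.edge hw hz hwz)
      · exact ReachIn.trans' hxr (ReachIn.edge hx hz h5)
    · exact X.in_good hter hz h1 h4

theorem Wm_exists (X : Cx adj N c t) (m : Fin t) {i : ℕ} (hi : i < N) (hiu : ∀ k, X.α k ≠ i)
    (hd : ∀ v, v ∉ X.D.F →
      (X.D.Em (X.α m)).card + (X.D.F.card + X.RR.card) + 3 * t < (inN adj v).card) :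
    ∃ W : Finset V, W ⊆ X.G ∧ W.card ≤ (X.D.Em (X.α m)).card ∧
      ∀ v ∈ X.G, v ∈ X.D.Em (X.α m) → adj v (X.D.a i) → ∃ w ∈ W, adj w v ∧ w ∉ X.D.F ∧
        w ∉ X.D.Em (X.α m) := by
  have key : ∀ v ∈ X.G, adj v (X.D.a i) → ∃ w ∈ X.G, adj w v ∧ w ∉ X.D.Em (X.α m) := by
    intro v hv hvx
    obtain ⟨hF, hR, hq⟩ := X.mem_G.1 hv
    let S : Finset V := (X.D.Em (X.α m) ∪ (X.D.F ∪ X.RR)) ∪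
      (Finset.univ : Finset (Fin t)).biUnion (fun k => X.seg k (X.l k - 2) (X.l k))
    have hS : S.card < (inN adj v).card := by
      have h0 : ((Finset.univ : Finset (Fin t)).biUnion
          (fun k => X.seg k (X.l k - 2) (X.l k))).card ≤ (Finset.univ : Finset (Fin t)).card * 3 :=
        Finset.card_biUnion_le_card_mul _ _ _ (fun k _ => by rw [X.seg_card le_rfl]; omega)
      rw [Finset.card_univ, Fintype.card_fin] at h0
      have h1 : S.card ≤ _ := Finset.card_union_le _ _
      have h2 := Finset.card_union_le (X.D.Em (X.α m)) (X.D.F ∪ X.RR)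
      have h3 := Finset.card_union_le X.D.F X.RR
      have := hd v hF
      omega
    obtain ⟨w, hw, hw'⟩ := Finset.exists_mem_notMem_of_card_lt_card hS
    simp only [S, Finset.mem_union, not_or, Finset.mem_biUnion, Finset.mem_univ, true_and,
      not_exists] at hw'
    obtain ⟨⟨hw1, hw2, hw3⟩, hw4⟩ := hw'
    rw [mem_inN] at hw
    refine ⟨w, X.mem_G.2 ⟨hw2, hw3, fun k s hs e => ?_⟩, hw, hw1⟩
    subst e
    have := X.lk.in_last X.mn Finset.subset_union_left hi hiu (v := v)
      (by rw [Finset.mem_union, not_or]; exact ⟨hF, hR⟩) hq hvx k hs hw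
    exact hw4 k (X.mem_seg.2 ⟨s, ⟨by omega, hs⟩, rfl⟩)
  choose! f hf1 hf2 hf3 using key
  let B := (X.G.filter (fun v => v ∈ X.D.Em (X.α m) ∧ adj v (X.D.a i)))
  refine ⟨B.image f, ?_, ?_, ?_⟩
  · intro w hw
    obtain ⟨v, hv, rfl⟩ := Finset.mem_image.1 hw
    obtain ⟨h1, h2, h3⟩ := Finset.mem_filter.1 hv
    exact hf1 v h1 h3
  · refine le_trans Finset.card_image_le (Finset.card_le_card ?_)
    intro v hv
    exact (Finset.mem_filter.1 hv).2.1
  · intro v hv h2 h3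
    exact ⟨f v, Finset.mem_image_of_mem _ (Finset.mem_filter.2 ⟨hv, h2, h3⟩), hf2 v hv h3,
      (X.mem_G.1 (hf1 v hv h3)).1, hf3 v hv h3⟩

theorem choose_exists (X : Cx adj N c t) (m : Fin t) (W : Finset V) (L : Fin t → ℕ)
    (hL : ∀ j, 3 ≤ L j)
    (hb : ∀ j, j ≠ m → ∑ k ∈ Finset.univ.erase m, L k + 54*(c+2)*(c+2) ≤
      (X.G \ (W ∪ (X.D.Em (X.α j) ∪ X.D.Ep (X.β j)))).card) (J : Finset (Fin t)) (hm : m ∉ J) :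
    ∃ P : Fin t → Finset V, (∀ j ∈ J, StrConnOn adj (P j : Set V) ∧ (P j).card = L j ∧
      (∀ z ∈ P j, z ∈ X.T j ∨ (z ∈ X.G ∧ z ∉ W)) ∧ ClassOK X j (P j)) ∧
      ∀ i ∈ J, ∀ j ∈ J, i ≠ j → Disjoint (P i) (P j) := by
  induction J using Finset.induction_on with
  | empty => exact ⟨fun _ => ∅, by simp, by simp⟩
  | insert j J hj ih =>
    obtain ⟨P, hP, hd⟩ := ih (fun h => hm (Finset.mem_insert_of_mem h))
    have hjm : j ≠ m := fun e => hm (e ▸ Finset.mem_insert_self _ _)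
    let U := (X.G \ (W ∪ (X.D.Em (X.α j) ∪ X.D.Ep (X.β j)))) \ J.biUnion P
    have hUc : L j + 54*(c+2)*(c+2) ≤ U.card := by
      have h1 : (J.biUnion P).card ≤ ∑ k ∈ J, L k :=
        Finset.card_biUnion_le.trans (Finset.sum_le_sum (fun k hk => (hP k hk).2.1.le))
      have h2 : ∑ k ∈ insert j J, L k ≤ ∑ k ∈ Finset.univ.erase m, L k := by
        apply Finset.sum_le_sum_of_subset
        intro k hk
        exact Finset.mem_erase.2 ⟨fun e => hm (e ▸ hk), Finset.mem_univ _⟩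
      rw [Finset.sum_insert hj] at h2
      have h3 := hb j hjm
      have h4 : _ ≤ U.card := Finset.le_card_sdiff (J.biUnion P)
        (X.G \ (W ∪ (X.D.Em (X.α j) ∪ X.D.Ep (X.β j))))
      omega
    have hU : Usable X j U := by
      intro u hu
      simp only [U, Finset.mem_sdiff, Finset.mem_union, not_or] at hu
      obtain ⟨h1, h2, h3⟩ := X.mem_G.1 hu.1.1
      exact ⟨h1, h2, hu.1.2.2.1, hu.1.2.2.2, h3 j⟩
    obtain ⟨Z, h1, h2, h3, h4⟩ := classLemma X j U hU (L j) (hL j) (by omega) (by omega)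
    have hZd : ∀ k ∈ J, ∀ z ∈ Z, z ∈ P k → False := by
      intro k hk z hz hzk
      rcases h3 z hz with h | h
      · rcases (hP k hk).2.2.1 z hzk with h' | h'
        · exact X.T_disj (i := j) (j := k) (fun e => hj (e.symm ▸ hk)) h h'
        · exact X.T_G h h'.1
      · exact (Finset.mem_sdiff.1 h).2 (Finset.mem_biUnion.2 ⟨k, hk, hzk⟩)
    have hne : ∀ k ∈ J, k ≠ j := fun k hk e => hj (e ▸ hk)
    refine ⟨Function.update P j Z, ?_, ?_⟩
    · intro k hk
      rcases Finset.mem_insert.1 hk with rfl | hk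
      · rw [Function.update_self]
        refine ⟨h1, h2, fun z hz => (h3 z hz).imp_right ?_, h4⟩
        intro h
        simp only [U, Finset.mem_sdiff, Finset.mem_union, not_or] at h
        exact ⟨h.1.1, h.1.2.1⟩
      · rw [Function.update_of_ne (hne k hk)]
        exact hP k hk
    · intro a ha b hb hab
      rcases Finset.mem_insert.1 ha with rfl | ha' <;> rcases Finset.mem_insert.1 hb with rfl | hb'
      · exact absurd rfl hab
      · rw [Function.update_self, Function.update_of_ne (hne b hb')]
        exact Finset.disjoint_left.2 (fun z hz hz' => hZd b hb' z hz hz')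
      · rw [Function.update_self, Function.update_of_ne (hne a ha')]
        exact Finset.disjoint_right.2 (fun z hz hz' => hZd a ha' z hz hz')
      · rw [Function.update_of_ne (hne a ha'), Function.update_of_ne (hne b hb')]
        exact hd a ha' b hb' hab

end

section
variable [Fintype V] {adj : V → V → Prop} {N c t : ℕ}

theorem assemble (X : Cx adj N c t) (L : Fin t → ℕ) (hL : ∀ j, 3 ≤ L j)
    (hsum : ∑ j, L j = Fintype.card V) (m : Fin t) (htN : t < N)
    (hd : ∀ v, v ∉ X.D.F →
      (X.D.Em (X.α m)).card + (X.D.F.card + X.RR.card) + 3 * t < (inN adj v).card)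
    (hd' : ∀ v, v ∉ X.D.F →
      (X.D.Ep (X.β m)).card + (X.D.F.card + X.RR.card) + 3 * t < (outN adj v).card)
    (hb : ∀ j, X.D.F.card + X.RR.card + ∑ k, (X.l k + 1) +
      ((X.D.Em (X.α m)).card + (X.D.Ep (X.β m)).card) +
      ((X.D.Em (X.α j)).card + (X.D.Ep (X.β j)).card) + 54*(c+2)*(c+2) ≤ L m) :
    ∃ P : Fin t → Finset V, (∀ j, StrConnOn adj (P j : Set V) ∧ (P j).card = L j) ∧
      (∀ i j, i ≠ j → Disjoint (P i) (P j)) ∧ ∀ v, ∃ j, v ∈ P j := by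
  have hun : ∀ γ : Fin t → ℕ, ∃ i < N, ∀ k, γ k ≠ i := by
    intro γ
    have : (Finset.univ.image γ).card < (Finset.range N).card := by
      refine lt_of_le_of_lt Finset.card_image_le ?_
      simpa using htN
    obtain ⟨i, hi, hi'⟩ := Finset.exists_mem_notMem_of_card_lt_card this
    exact ⟨i, by simpa using hi, fun k e => hi' (Finset.mem_image.2 ⟨k, Finset.mem_univ _, e⟩)⟩
  obtain ⟨i, hi, hiu⟩ := hun X.α
  obtain ⟨i', hi', hiu'⟩ := hun X.β
  obtain ⟨W1, hW1G, hW1c, hW1⟩ := Wm_exists X m hi hiu hd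
  obtain ⟨W2, hW2G, hW2c, hW2⟩ := Wm_exists X.flip m hi' hiu' hd'
  rw [X.G_flip] at hW2G hW2
  have hGc : Fintype.card V ≤ X.G.card + (X.D.F.card + X.RR.card + ∑ k, (X.l k + 1)) := by
    have hsub : (Finset.univ : Finset V) ⊆ X.G ∪ ((X.D.F ∪ X.RR) ∪
      (Finset.univ : Finset (Fin t)).biUnion (fun k => X.seg k 0 (X.l k))) := by
      intro v _
      by_cases h : v ∈ X.G
      · exact Finset.mem_union_left _ h
      · apply Finset.mem_union_right
        by_contra h'
        simp only [Finset.mem_union, not_or, Finset.mem_biUnion, Finset.mem_univ, true_and,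
          not_exists] at h'
        exact h (X.mem_G.2 ⟨h'.1.1, h'.1.2, fun k s hs e =>
          h'.2 k (X.mem_seg.2 ⟨s, ⟨Nat.zero_le _, hs⟩, e⟩)⟩)
    have h1 := Finset.card_le_card hsub
    have h2 := Finset.card_union_le X.G ((X.D.F ∪ X.RR) ∪
      (Finset.univ : Finset (Fin t)).biUnion (fun k => X.seg k 0 (X.l k)))
    have h3 := Finset.card_union_le (X.D.F ∪ X.RR)
      ((Finset.univ : Finset (Fin t)).biUnion (fun k => X.seg k 0 (X.l k)))
    have h4 := Finset.card_union_le X.D.F X.RR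
    have h5 : ((Finset.univ : Finset (Fin t)).biUnion (fun k => X.seg k 0 (X.l k))).card ≤
        ∑ k, (X.l k + 1) :=
      Finset.card_biUnion_le.trans (Finset.sum_le_sum (fun k _ => by
        rw [X.seg_card le_rfl]; omega))
    rw [Finset.card_univ] at h1
    omega
  have hsplit : ∑ k ∈ Finset.univ.erase m, L k + L m = Fintype.card V := by
    rw [← hsum]; exact Finset.sum_erase_add _ _ (Finset.mem_univ m)
  obtain ⟨P, hP, hPd⟩ := choose_exists X m (W1 ∪ W2) L hL (by
    intro j hj
    have h1 := Finset.le_card_sdiff ((W1 ∪ W2) ∪ (X.D.Em (X.α j) ∪ X.D.Ep (X.β j))) X.G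
    have h2 := Finset.card_union_le (W1 ∪ W2) (X.D.Em (X.α j) ∪ X.D.Ep (X.β j))
    have h3 := Finset.card_union_le W1 W2
    have h4 := Finset.card_union_le (X.D.Em (X.α j)) (X.D.Ep (X.β j))
    have h5 := hb j
    change W2.card ≤ (X.D.Ep (X.β m)).card at hW2c
    omega) (Finset.univ.erase m) (by simp)
  set O := (Finset.univ.erase m).biUnion P with hO
  have hPm : ∀ j, j ≠ m → j ∈ Finset.univ.erase m := fun j hj =>
    Finset.mem_erase.2 ⟨hj, Finset.mem_univ _⟩
  have hmO : ∀ z, z ∈ O ↔ ∃ j, j ≠ m ∧ z ∈ P j := by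
    intro z; simp [hO]
  have hOc : O.card = ∑ k ∈ Finset.univ.erase m, L k := by
    rw [hO, Finset.card_biUnion hPd]
    exact Finset.sum_congr rfl (fun k hk => (hP k hk).2.1)
  set Z : Finset V := Finset.univ \ O with hZ
  have hmZ : ∀ z, z ∈ Z ↔ ∀ j, j ≠ m → z ∉ P j := by
    intro z
    rw [hZ, Finset.mem_sdiff, hmO]
    simp
  have hZc : Z.card = L m := by
    rw [hZ, Finset.card_sdiff_of_subset (Finset.subset_univ _), Finset.card_univ]
    omega
  have hcl : ∀ j, j ≠ m → ∀ z ∈ P j, z ∈ X.T j ∨ (z ∈ X.G ∧ z ∉ W1 ∪ W2) := fun j hj =>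
    (hP j (hPm j hj)).2.2.1
  have hok : ∀ j, j ≠ m → ClassOK X j (P j) := fun j hj => (hP j (hPm j hj)).2.2.2
  have hTm : X.T m ⊆ Z := by
    intro z hz
    rw [hmZ]
    intro j hj hzj
    rcases hcl j hj z hzj with h | h
    · exact X.T_disj hj h hz
    · exact X.T_G hz h.1
  have hter : Ter X m (Z : Set V) := X.ter_of hTm
  have hRT : ∀ v ∈ X.D.F, ∀ h ∈ X.R v, h ∉ Z → v ∉ Z ∧ ∀ h' ∈ X.R v, h' ∉ Z := by
    intro v hv h hh hhZ
    have hhR : h ∈ X.RR := Finset.mem_biUnion.2 ⟨v, hv, hh⟩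
    rw [hmZ] at hhZ
    push Not at hhZ
    obtain ⟨j, hj, hhj⟩ := hhZ
    have hTj : X.T j ⊆ P j := by
      rcases hok j hj with h1 | h1
      · exact h1
      · exact absurd hhR (h1.1 h hhj)
    have hhT : h ∈ X.T j := by
      rcases hcl j hj h hhj with h1 | h1
      · exact h1
      · exact absurd hhR (X.mem_G.1 h1.1).2.1
    have hvf := X.T_R hhT hv hh
    refine ⟨fun h1 => (hmZ v).1 h1 j hj (hTj (X.mem_T.2 (Or.inr (Or.inl hvf)))), fun h' hh' h1 => ?_⟩
    exact (hmZ h').1 h1 j hj (hTj (X.mem_T.2 (Or.inr (Or.inr ⟨v, hvf, hh'⟩))))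
  have hFZ : ∀ v ∈ X.D.F, v ∈ (Z : Set V) → ∀ h ∈ X.R v, h ∈ (Z : Set V) := by
    intro v hv hvZ h hh
    by_contra h1
    exact (hRT v hv h hh h1).1 hvZ
  have hRRZ : ∀ v ∈ X.D.F, ∀ h ∈ X.R v, h ∈ (Z : Set V) → ∀ h' ∈ X.R v, h' ∈ (Z : Set V) := by
    intro v hv h hh hhZ h' hh'
    by_contra h1
    exact (hRT v hv h' hh' h1).2 h hh hhZ
  have hqZ : ∀ j, 2 ≤ X.l j →
      (X.q j (X.l j - 1) ∈ (Z : Set V) → X.q j (X.l j - 2) ∈ (Z : Set V)) ∧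
      (X.q j 1 ∈ (Z : Set V) → X.q j 2 ∈ (Z : Set V)) := by
    intro j hj2
    by_cases hj : j = m
    · subst hj
      exact ⟨fun _ => hter.1 _ (by omega), fun _ => hter.1 _ (by omega)⟩
    have hq1 : ∀ s ≤ X.l j, X.q j s ∉ P j → X.q j s ∈ Z := by
      intro s hs hn
      rw [hmZ]
      intro k hk hqk
      rcases hcl k hk _ hqk with h1 | h1
      · by_cases hkj : k = j
        · exact hn (hkj ▸ hqk)
        · exact X.T_disj hkj h1 (X.mem_T.2 (Or.inl ⟨s, hs, rfl⟩))
      · exact (X.mem_G.1 h1.1).2.2 j s hs rfl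
    have hq2 : ∀ s, X.q j s ∈ P j → X.q j s ∉ Z := fun s h h' => (hmZ _).1 h' j hj h
    rcases hok j hj with h1 | ⟨_, h1⟩
    · have : ∀ s ≤ X.l j, X.q j s ∈ P j := fun s hs => h1 (X.mem_T.2 (Or.inl ⟨s, hs, rfl⟩))
      exact ⟨fun h => absurd h (hq2 _ (this _ (by omega))),
        fun h => absurd h (hq2 _ (this _ (by omega)))⟩
    · obtain ⟨h2, h3⟩ := h1 hj2
      refine ⟨fun h => ?_, fun h => absurd h (hq2 _ h2)⟩
      rcases h3 with h3 | h3
      · exact absurd h (hq2 _ h3)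
      · exact hq1 _ (by omega) h3
  have hWZ : W1 ∪ W2 ⊆ Z := by
    intro w hw
    rw [hmZ]
    intro j hj hwj
    have hwG : w ∈ X.G := by
      rcases Finset.mem_union.1 hw with h | h
      · exact hW1G h
      · exact hW2G h
    rcases hcl j hj w hwj with h | h
    · exact X.T_G h hwG
    · exact h.2 hw
  have hxZ : X.D.a i ∈ Z := by
    rw [hmZ]
    intro j hj hxj
    have hxF := X.D.a_mem_F hi
    rcases hcl j hj _ hxj with h | h
    · rcases X.T_F h hxF with h1 | h1
      · exact Finset.disjoint_left.1 (X.D.dAA _ (X.lk.αlt j) _ hi (hiu j)) h1 (X.D.amem i hi)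
      · exact Finset.disjoint_left.1 (X.D.dAB _ hi _ (X.lk.βlt j)) (X.D.amem i hi) h1
    · exact (X.mem_G.1 h.1).1 hxF
  have hyZ : X.D.b i' ∈ Z := by
    rw [hmZ]
    intro j hj hxj
    have hxF := X.D.b_mem_F hi'
    rcases hcl j hj _ hxj with h | h
    · rcases X.T_F h hxF with h1 | h1
      · exact Finset.disjoint_left.1 (X.D.dAB _ (X.lk.αlt j) _ hi') h1 (X.D.bmem i' hi')
      · exact Finset.disjoint_left.1 (X.D.dBB _ (X.lk.βlt j) _ hi' (hiu' j)) h1 (X.D.bmem i' hi')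
    · exact (X.mem_G.1 h.1).1 hxF
  have hin := lastIn X m (Z : Set V) hter hFZ hRRZ hi hiu hxZ (fun j h => (hqZ j h).1)
    (fun v hv _ h1 h2 => by
      obtain ⟨w, hw, h3⟩ := hW1 v hv h1 h2
      exact ⟨w, hWZ (Finset.mem_union_left _ hw), h3⟩)
  have hout := lastIn X.flip m (Z : Set V) hter.flip hFZ hRRZ hi' hiu' hyZ
    (fun j h h1 => by
      change 2 ≤ X.l j at h
      change X.q j (X.l j - (X.l j - 1)) ∈ (Z : Set V) at h1
      change X.q j (X.l j - (X.l j - 2)) ∈ (Z : Set V)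
      rw [show X.l j - (X.l j - 1) = 1 by omega] at h1
      rw [show X.l j - (X.l j - 2) = 2 by omega]
      exact (hqZ j h).2 h1)
    (fun v hv _ h1 h2 => by
      rw [X.G_flip] at hv
      obtain ⟨w, hw, h3⟩ := hW2 v hv h1 h2
      exact ⟨w, hWZ (Finset.mem_union_right _ hw), h3⟩)
  have hZs : StrConnOn adj (Z : Set V) := core X hter hin hout
  refine ⟨Function.update P m Z, ?_, ?_, ?_⟩
  · intro j
    by_cases hj : j = m
    · subst hj; rw [Function.update_self]; exact ⟨hZs, hZc⟩
    · rw [Function.update_of_ne hj]; exact ⟨(hP j (hPm j hj)).1, (hP j (hPm j hj)).2.1⟩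
  · intro a b hab
    by_cases ha : a = m <;> by_cases hb : b = m
    · exact absurd (ha.trans hb.symm) hab
    · subst ha; rw [Function.update_self, Function.update_of_ne hb]
      exact Finset.disjoint_left.2 (fun z hz => (hmZ z).1 hz b hb)
    · subst hb; rw [Function.update_self, Function.update_of_ne ha]
      exact Finset.disjoint_right.2 (fun z hz => (hmZ z).1 hz a ha)
    · rw [Function.update_of_ne hb, Function.update_of_ne ha]
      exact hPd a (hPm a ha) b (hPm b hb) hab
  · intro v
    by_cases hv : v ∈ Z
    · exact ⟨m, by rw [Function.update_self]; exact hv⟩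
    · rw [hmZ] at hv
      push Not at hv
      obtain ⟨j, hj, hvj⟩ := hv
      exact ⟨j, by rw [Function.update_of_ne hj]; exact hvj⟩

end

theorem two_pow_aux (t : ℕ) : t ^ 2 ≤ 2 ^ (t + 3) := by
  induction t with
  | zero => simp
  | succ t ih =>
    have h := @Nat.lt_two_pow_self t
    have e : 2 ^ (t + 1 + 3) = 2 ^ (t + 3) + 8 * 2 ^ t := by ring
    rw [e]
    nlinarith

theorem main_part [Fintype V] {adj : V → V → Prop} (hT : IsTournament adj)
    (t : ℕ) (ht : 2 ≤ t) (L : Fin t → ℕ) (hL : ∀ j, 3 ≤ L j)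
    (hsum : ∑ j, L j = Fintype.card V) (hK : KC adj (10 ^ 6 * t ^ 4)) :
    ∃ P : Fin t → Finset V, (∀ j, StrConnOn adj (P j : Set V) ∧ (P j).card = L j) ∧
      (∀ i j, i ≠ j → Disjoint (P i) (P j)) ∧ ∀ v, ∃ j, v ∈ P j := by
  have hn := hK.1
  set n := Fintype.card V with hn_def
  have t1 : t ≤ t ^ 4 := Nat.le_self_pow (by norm_num) t
  have t2 : t ^ 2 ≤ t ^ 4 := Nat.pow_le_pow_right (by omega) (by norm_num)
  have t3 : 2 * t ^ 3 ≤ t ^ 4 := by rw [pow_succ t 3, mul_comm]; gcongr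
  have hC : t + 10 + 2 ≤ 7 * t := by omega
  have hF0 : 2 * (16 * t ^ 2) * (t + 10 + 2) ≤ 224 * t ^ 3 := by
    calc 2 * (16 * t ^ 2) * (t + 10 + 2) ≤ 2 * (16 * t ^ 2) * (7 * t) := by gcongr
      _ = 224 * t ^ 3 := by ring
  have h2c : 128 * t ^ 2 ≤ 2 ^ (t + 10) := by
    have := two_pow_aux t
    calc 128 * t ^ 2 ≤ 128 * 2 ^ (t + 3) := by gcongr
      _ = 2 ^ (t + 10) := by ring
  obtain ⟨D, -⟩ := dt_exists hT (16 * t ^ 2) (t + 10) (by omega)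
  have hFc : D.F.card ≤ 224 * t ^ 3 := D.F_card.trans hF0
  have hc8 : 8 * (16 * t ^ 2) ≤ 2 ^ (t + 10) := by omega
  obtain ⟨R, hR, Rd⟩ := protFam_exists D.F D.EM D.EP (10 ^ 6 * t ^ 4)
    (fun v hv => D.EM_small hc8 hv) (fun v hv => D.EP_small hc8 hv)
    (hK.indeg hT) (hK.outdeg hT) (by omega)
  have hRc : (D.F.biUnion R).card ≤ D.F.card * 8 :=
    Finset.card_biUnion_le_card_mul _ _ _ (fun v hv => (hR v hv).1)
  obtain ⟨α, β, q, l, hlk, hmn, hs⟩ := linkage_exists (t := t) hK D (D.F.biUnion R) (by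
      rw [Finset.disjoint_biUnion_right]
      intro v hv
      exact Finset.disjoint_right.2 (fun h hh => (hR v hv).2.1 h hh))
    (by omega) (by nlinarith) (by positivity)
  let X : Cx adj (16 * t ^ 2) (t + 10) t := ⟨D, R, α, β, q, l, hT, hR, Rd, hlk, hmn⟩
  haveI : Nonempty (Fin t) := ⟨⟨0, by omega⟩⟩
  obtain ⟨m, -, hm⟩ := Finset.exists_max_image (Finset.univ : Finset (Fin t)) L Finset.univ_nonempty
  have hnm : n ≤ t * L m := by
    rw [← hsum]
    have := Finset.sum_le_card_nsmul Finset.univ L (L m) hm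
    simpa using this
  have hsm : ∀ j v, v ∉ D.F → 128 * t ^ 2 * (D.Em (α j)).card ≤ (inN adj v).card := fun j v hv =>
    (Nat.mul_le_mul_right _ h2c).trans (D.smA _ (hlk.αlt j) v hv)
  have hsp : ∀ j v, v ∉ D.F → 128 * t ^ 2 * (D.Ep (β j)).card ≤ (outN adj v).card := fun j v hv =>
    (Nat.mul_le_mul_right _ h2c).trans (D.smB _ (hlk.βlt j) v hv)
  obtain ⟨v₀, hv₀⟩ : ∃ v, v ∉ D.F := by
    by_contra h
    push Not at h
    have : D.F.card = n := by rw [Finset.eq_univ_iff_forall.2 h, Finset.card_univ]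
    omega
  have t22 : 2 * t ≤ t ^ 2 := by nlinarith
  have hEm : ∀ j, 256 * (t * (D.Em (α j)).card) ≤ n := by
    intro j
    have h1 := (hsm j v₀ hv₀).trans (Finset.card_le_univ _)
    have h2 : 128 * (2 * t) * (D.Em (α j)).card ≤ 128 * t ^ 2 * (D.Em (α j)).card := by gcongr
    rw [← hn_def] at h1
    calc _ = 128 * (2 * t) * (D.Em (α j)).card := by ring
      _ ≤ n := h2.trans h1
  have hEp : ∀ j, 256 * (t * (D.Ep (β j)).card) ≤ n := by
    intro j
    have h1 := (hsp j v₀ hv₀).trans (Finset.card_le_univ _)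
    have h2 : 128 * (2 * t) * (D.Ep (β j)).card ≤ 128 * t ^ 2 * (D.Ep (β j)).card := by gcongr
    rw [← hn_def] at h1
    calc _ = 128 * (2 * t) * (D.Ep (β j)).card := by ring
      _ ≤ n := h2.trans h1
  have hbig : ∀ e : ℕ, 2 * e ≤ 128 * t ^ 2 * e := fun e => by
    apply Nat.mul_le_mul_right; nlinarith
  have hS8 : 8 * (t * ∑ k, (l k + 1)) ≤ n := by
    have : (2 * t) * (8 * (t * ∑ k, (l k + 1))) ≤ (2 * t) * n := by
      calc _ = 16 * t ^ 2 * ∑ k, (l k + 1) := by ring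
        _ ≤ t * (2 * n) := hs
        _ = _ := by ring
    exact Nat.le_of_mul_le_mul_left this (by omega)
  have htF : t * D.F.card ≤ 224 * t ^ 4 := by
    calc _ ≤ t * (224 * t ^ 3) := by gcongr
      _ = _ := by ring
  have htR : t * (D.F.biUnion R).card ≤ 8 * (t * D.F.card) := by
    calc _ ≤ t * (D.F.card * 8) := by gcongr
      _ = _ := by ring
  have htC : t * (54 * (t + 10 + 2) * (t + 10 + 2)) ≤ 1323 * t ^ 4 := by
    calc _ ≤ t * (54 * (7 * t) * (7 * t)) := by gcongr
      _ = 1323 * (2 * t ^ 3) := by ring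
      _ ≤ _ := by gcongr
  refine assemble X L hL hsum m (by nlinarith) ?_ ?_ ?_
  · intro v hv
    change (D.Em (α m)).card + (D.F.card + (D.F.biUnion R).card) + 3 * t < _
    have h1 := hsm m v hv
    have h2 := hbig (D.Em (α m)).card
    have h3 := hK.indeg hT v
    omega
  · intro v hv
    change (D.Ep (β m)).card + (D.F.card + (D.F.biUnion R).card) + 3 * t < _
    have h1 := hsp m v hv
    have h2 := hbig (D.Ep (β m)).card
    have h3 := hK.outdeg hT v
    omega
  · intro j
    change D.F.card + (D.F.biUnion R).card + ∑ k, (l k + 1) +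
      ((D.Em (α m)).card + (D.Ep (β m)).card) +
      ((D.Em (α j)).card + (D.Ep (β j)).card) + 54 * (t + 10 + 2) * (t + 10 + 2) ≤ L m
    refine Nat.le_of_mul_le_mul_left (le_trans ?_ hnm) (show 0 < t by omega)
    simp only [Nat.mul_add t]
    have := hEm m
    have := hEm j
    have := hEp m
    have := hEp j
    simp only [Nat.mul_add] at *
    omega

theorem kc_of [Fintype V] {adj : V → V → Prop} (t : ℕ) (ht : 2 ≤ t)
    (hconn : StrConnR adj (10 ^ 10 * (t : ℝ) ^ 4 * Real.logb 2 (t : ℝ))) :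
    KC adj (10 ^ 6 * t ^ 4) := by
  have ht' : (2 : ℝ) ≤ t := by exact_mod_cast ht
  have hlog : 1 ≤ Real.logb 2 (t : ℝ) := by
    rw [Real.le_logb_iff_rpow_le (by norm_num) (by linarith)]
    simpa using ht'
  have h4 : (0 : ℝ) ≤ 10 ^ 6 * (t : ℝ) ^ 4 := by positivity
  have hr : ((10 ^ 6 * t ^ 4 : ℕ) : ℝ) ≤ 10 ^ 10 * (t : ℝ) ^ 4 * Real.logb 2 (t : ℝ) := by
    push_cast
    calc (1000000 * (t : ℝ) ^ 4) ≤ 10 ^ 10 * (t : ℝ) ^ 4 * 1 := by nlinarith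
      _ ≤ _ := by gcongr
  refine ⟨?_, ?_⟩
  · exact_mod_cast hr.trans_lt hconn.1
  · intro S hS
    have := hconn.2 (S : Set V) (by
      rw [Set.ncard_coe_finset]
      exact lt_of_lt_of_le (by exact_mod_cast hS) hr)
    convert this using 1
    ext v; simp

end Tp
end MyProof

/-- Every strongly `10^10 t^4 log t`-connected tournament on `n` vertices
contains `t` vertex-disjoint directed cycles of any prescribed lengths `L₁,…,L_t ≥ 3` with
`L₁ + ⋯ + L_t = n`; in particular their vertex sets partition the vertex set. -/
theorem stmt2 [Fintype V] (adj : V → V → Prop) (hT : IsTournament adj)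
    (t : ℕ) (ht : 2 ≤ t) (L : Fin t → ℕ) (hL : ∀ j, 3 ≤ L j)
    (hsum : ∑ j, L j = Fintype.card V)
    (hconn : StrConnR adj (10 ^ 10 * (t : ℝ) ^ 4 * Real.logb 2 (t : ℝ))) :
    ∃ C : Fin t → List V,
      (∀ j, IsCycleList adj (C j) ∧ (C j).length = L j) ∧
      (∀ i j, i ≠ j → ∀ v ∈ C i, v ∉ C j) ∧
      (∀ v : V, ∃ j, v ∈ C j) := by
  obtain ⟨P, hP, hd, hc⟩ := Tp.main_part hT t ht L hL hsum (Tp.kc_of t ht hconn)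
  have h := fun j => Tp.camion hT (hP j).1 (by rw [(hP j).2]; exact hL j)
  choose C hC1 hC2 hC3 using h
  refine ⟨C, fun j => ⟨hC1 j, (hC2 j).trans (hP j).2⟩, ?_, ?_⟩
  · intro i j hij v hv hv'
    exact Finset.disjoint_left.1 (hd i j hij) ((hC3 i v).1 hv) ((hC3 j v).1 hv')
  · intro v
    obtain ⟨j, hj⟩ := hc v
    exact ⟨j, (hC3 j v).2 hj⟩
end

section
/- Let T be a tournament, let v ∈ V(T) and let c be a positive integer. Then there exist disjoint sets A, E ⊆ V(T) such that: (i) 1 ≤ |A| ≤ c and T[A] is a transitive tournament with sink v; (ii) either E = ∅ or E is the common in-neighbourhood of all vertices in A; (iii) A out-dominates V(T) \ (A ∪ E); (iv) |E| ≤ (1/2)^{c−1}·d_T^-(v). -/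
/-!
Common definitions: tournaments as irreflexive, asymmetric, total relations on a
finite vertex type; reachability/strong connectivity inside induced subtournaments;
directed paths and cycles as lists of vertices; linkedness; transitivity; domination.
All logarithms are base 2 (`Real.logb 2`).
-/

variable {V : Type*}

open Classical in
theorem aux_avg (adj : V → V → Prop) (hT : IsTournament adj) (E : Finset V) (hE : E.Nonempty) :
    ∃ x ∈ E, 2 * (E.filter (fun u => adj u x)).card ≤ E.card := by
  by_contra! h
  have h1 : ∑ x ∈ E, (E.filter (fun u => adj u x)).card
      = ∑ x ∈ E, (E.filter (fun u => adj x u)).card := by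
    simp only [Finset.card_filter]
    rw [Finset.sum_comm]
  have h2 : ∀ x ∈ E, (E.filter (fun u => adj u x)).card + (E.filter (fun u => adj x u)).card
      ≤ E.card := by
    intro x _
    rw [← Finset.card_union_of_disjoint]
    · apply Finset.card_le_card
      intro u hu
      simp only [Finset.mem_union, Finset.mem_filter] at hu
      tauto
    · rw [Finset.disjoint_left]
      intro u hu hu'
      simp only [Finset.mem_filter] at hu hu'
      exact hT.2.1 _ _ hu.2 hu'.2
  have h3 := Finset.sum_le_sum h2
  have h4 := Finset.sum_lt_sum_of_nonempty hE h
  rw [Finset.sum_add_distrib, ← h1] at h3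
  rw [← Finset.mul_sum] at h4
  omega

open Classical in
theorem aux_main [Fintype V] (adj : V → V → Prop) (hT : IsTournament adj) (v : V) (n : ℕ) :
    ∃ l : List V, l.Nodup ∧ TransList adj l ∧ l.getLast? = some v ∧ l.length ≤ n + 1 ∧
      2 ^ n * (Finset.univ.filter (fun u => ∀ a ∈ l, adj u a)).card
        ≤ (Finset.univ.filter (fun u => adj u v)).card := by
  induction n with
  | zero =>
    refine ⟨[v], by simp, ?_, by simp, by simp, by simp⟩
    intro i j
    have := hT.1 v
    simp [this]
  | succ n ih =>
    obtain ⟨l, hn, ht, hl, hlen, hc⟩ := ih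
    rcases Finset.eq_empty_or_nonempty (Finset.univ.filter (fun u => ∀ a ∈ l, adj u a)) with h | h
    · refine ⟨l, hn, ht, hl, by omega, ?_⟩
      simp [h]
    · obtain ⟨x, hx, hx2⟩ := aux_avg adj hT _ h
      simp only [Finset.mem_filter, Finset.mem_univ, true_and] at hx
      refine ⟨x :: l, ?_, ?_, ?_, by simpa using hlen, ?_⟩
      · exact List.nodup_cons.2 ⟨fun hm => hT.1 x (hx x hm), hn⟩
      · intro i j
        rcases i with ⟨_ | i, hi⟩ <;> rcases j with ⟨_ | j, hj⟩
        · simpa using hT.1 x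
        · simpa using hx _ (List.getElem_mem _)
        · simpa using hT.2.1 _ _ (hx _ (List.getElem_mem _))
        · have := ht ⟨i, by simpa using hi⟩ ⟨j, by simpa using hj⟩
          simpa using this
      · simp [List.getLast?_cons, hl]
      · have e : Finset.univ.filter (fun u => ∀ a ∈ x :: l, adj u a)
            = (Finset.univ.filter (fun u => ∀ a ∈ l, adj u a)).filter (fun u => adj u x) := by
          ext u
          simp [and_comm]
        rw [e, pow_succ, mul_assoc]
        exact (Nat.mul_le_mul_left _ hx2).trans hc

/-- For any vertex `v` of a tournament and any `c ≥ 1` there are disjoint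
sets `A, E` with: `1 ≤ |A| ≤ c` and `T[A]` a transitive tournament with sink `v`; `E` empty
or the common in-neighbourhood of all vertices of `A`; `A` out-dominating `V(T) \ (A ∪ E)`;
and `|E| ≤ (1/2)^(c-1) d⁻(v)`. -/
theorem stmt5 [Fintype V] (adj : V → V → Prop) (hT : IsTournament adj)
    (v : V) (c : ℕ) (hc : 1 ≤ c) :
    ∃ A E : Set V, Disjoint A E ∧
      (1 ≤ A.ncard ∧ A.ncard ≤ c) ∧
      IsTransSetSink adj A v ∧
      (E = ∅ ∨ E = {u | ∀ a ∈ A, adj u a}) ∧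
      OutDominates adj A (Set.univ \ (A ∪ E)) ∧
      ((E.ncard : ℝ) ≤ (1 / 2 : ℝ) ^ (c - 1) * ({u | adj u v}.ncard : ℝ)) := by
  classical
  obtain ⟨l, hn, ht, hl, hlen, hcard⟩ := aux_main adj hT v (c - 1)
  have hA : ({x | x ∈ l} : Set V).ncard = l.length := by
    rw [← List.toFinset_card_of_nodup hn, ← Set.ncard_coe_finset]
    congr 1
    ext x
    simp
  have hpos : 1 ≤ l.length := by
    rcases l with _ | ⟨a, l⟩
    · simp at hl
    · simp
  refine ⟨{x | x ∈ l}, {u | ∀ a ∈ l, adj u a}, ?_, ⟨by omega, by omega⟩,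
    ⟨l, hn, fun x => Iff.rfl, ht, hl⟩, Or.inr rfl, ?_, ?_⟩
  · rw [Set.disjoint_left]
    intro a ha hb
    exact hT.1 a (hb a ha)
  · intro b hb
    simp only [Set.mem_diff, Set.mem_union, Set.mem_setOf_eq, not_or] at hb
    obtain ⟨_, h1, h2⟩ := hb
    push Not at h2
    obtain ⟨a, ha, hab⟩ := h2
    refine ⟨a, ha, ?_⟩
    rcases hT.2.2 a b (fun h => h1 (h ▸ ha)) with h | h
    · exact h
    · exact absurd h hab
  · have e1 : ({u | ∀ a ∈ l, adj u a} : Set V).ncard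
        = (Finset.univ.filter (fun u => ∀ a ∈ l, adj u a)).card := by
      rw [← Set.ncard_coe_finset]; simp
    have e2 : ({u | adj u v} : Set V).ncard
        = (Finset.univ.filter (fun u => adj u v)).card := by
      rw [← Set.ncard_coe_finset]; simp
    rw [e1, e2, one_div, inv_pow, ← div_eq_inv_mul, le_div_iff₀ (by positivity), mul_comm]
    exact_mod_cast hcard
end

section
/- Let T be a tournament, let v ∈ V(T) and let c be a positive integer. Then there exist disjoint sets B, E ⊆ V(T) such that: (i) 1 ≤ |B| ≤ c and T[B] is a transitive tournament with source v; (ii) either E = ∅ or E is the common out-neighbourhood of all vertices in B; (iii) B in-dominates V(T) \ (B ∪ E); (iv) |E| ≤ (1/2)^{c−1}·d_T^+(v). -/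
/-!
Common definitions: tournaments as irreflexive, asymmetric, total relations on a
finite vertex type; reachability/strong connectivity inside induced subtournaments;
directed paths and cycles as lists of vertices; linkedness; transitivity; domination.
All logarithms are base 2 (`Real.logb 2`).
-/

variable {V : Type*}

open Classical in
theorem exists_small_out [Fintype V] (adj : V → V → Prop) (hT : IsTournament adj)
    (N : Finset V) (hN : N.Nonempty) :
    ∃ w ∈ N, 2 * (N.filter (fun u => adj w u)).card ≤ N.card := by
  by_contra! h
  have h1 : ∑ w ∈ N, N.card < ∑ w ∈ N, 2 * (N.filter (fun u => adj w u)).card :=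
    Finset.sum_lt_sum_of_nonempty hN h
  have h2 : ∑ w ∈ N, (N.filter (fun u => adj w u)).card
      = ∑ w ∈ N, (N.filter (fun u => adj u w)).card :=
    Finset.sum_card_bipartiteAbove_eq_sum_card_bipartiteBelow adj
  have h3 : ∑ w ∈ N, ((N.filter (fun u => adj w u)).card + (N.filter (fun u => adj u w)).card)
      ≤ ∑ w ∈ N, N.card := by
    apply Finset.sum_le_sum
    intro w _
    rw [← Finset.card_union_of_disjoint]
    · apply Finset.card_le_card
      intro x hx
      simp only [Finset.mem_union, Finset.mem_filter] at hx
      tauto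
    · rw [Finset.disjoint_filter]
      intro x _ hx
      exact hT.2.1 _ _ hx
  rw [Finset.sum_add_distrib, ← h2] at h3
  rw [← Finset.mul_sum] at h1
  omega

open Classical in
theorem exists_trans_list [Fintype V] (adj : V → V → Prop) (hT : IsTournament adj)
    (v : V) (n : ℕ) :
    ∃ l : List V, l.Pairwise adj ∧ l.head? = some v ∧ l.length ≤ n + 1 ∧
      2 ^ n * (Finset.univ.filter (fun u => ∀ b ∈ l, adj b u)).card
        ≤ (Finset.univ.filter (fun u => adj v u)).card := by
  induction n with
  | zero => exact ⟨[v], by simp, by simp, by simp, by simp⟩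
  | succ n ih =>
    obtain ⟨l, hl, hv, hlen, hcard⟩ := ih
    rcases (Finset.univ.filter (fun u => ∀ b ∈ l, adj b u)).eq_empty_or_nonempty with h0 | hne
    · refine ⟨l, hl, hv, by omega, ?_⟩
      rw [h0]; simp
    · obtain ⟨w, hw, hw2⟩ := exists_small_out adj hT _ hne
      simp only [Finset.mem_filter, Finset.mem_univ, true_and] at hw
      refine ⟨l ++ [w], ?_, ?_, by simp; omega, ?_⟩
      · rw [List.pairwise_append]
        exact ⟨hl, by simp, by simpa using hw⟩
      · rw [List.head?_append, hv]; rfl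
      · rw [Finset.filter_filter] at hw2
        have he : (Finset.univ.filter (fun u => ∀ b ∈ l ++ [w], adj b u))
            = Finset.univ.filter (fun u => (∀ b ∈ l, adj b u) ∧ adj w u) := by
          ext u
          simp [or_imp, forall_and]
        rw [he, pow_succ, mul_assoc]
        exact (Nat.mul_le_mul_left _ hw2).trans hcard

theorem stmt6 [Fintype V] (adj : V → V → Prop) (hT : IsTournament adj)
    (v : V) (c : ℕ) (hc : 1 ≤ c) :
    ∃ B E : Set V, Disjoint B E ∧
      (1 ≤ B.ncard ∧ B.ncard ≤ c) ∧
      IsTransSetSource adj B v ∧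
      (E = ∅ ∨ E = {u | ∀ b ∈ B, adj b u}) ∧
      InDominates adj B (Set.univ \ (B ∪ E)) ∧
      ((E.ncard : ℝ) ≤ (1 / 2 : ℝ) ^ (c - 1) * ({u | adj v u}.ncard : ℝ)) := by
  classical
  obtain ⟨l, hl, hv, hlen, hcard⟩ := exists_trans_list adj hT v (c - 1)
  have hvl : v ∈ l := List.mem_of_mem_head? hv
  have hnd : l.Nodup := by
    refine List.Pairwise.imp ?_ hl
    intro a b h e
    subst e
    exact hT.1 _ h
  have hB : {x | x ∈ l} = (l.toFinset : Set V) := by ext; simp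
  refine ⟨{x | x ∈ l}, {u | ∀ b ∈ l, adj b u}, ?_, ⟨?_, ?_⟩, ⟨l, hnd, by simp, ?_, hv⟩,
    Or.inr rfl, ?_, ?_⟩
  · rw [Set.disjoint_left]
    intro x hx hx2
    exact hT.1 x (hx2 x hx)
  · rw [hB, Set.ncard_coe_finset, List.toFinset_card_of_nodup hnd]
    exact List.length_pos_of_mem hvl
  · rw [hB, Set.ncard_coe_finset, List.toFinset_card_of_nodup hnd]
    omega
  · intro i j
    have key : ∀ i j : Fin l.length, i < j → adj (l.get i) (l.get j) :=
      fun i j h => List.pairwise_iff_get.1 hl i j h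
    constructor
    · intro h
      by_contra hij
      rcases lt_trichotomy i j with h1 | h1 | h1
      · exact hij h1
      · subst h1; exact hT.1 _ h
      · exact hT.2.1 _ _ h (key _ _ h1)
    · intro h; exact key i j h
  · rintro b ⟨_, hb⟩
    simp only [Set.mem_union, Set.mem_setOf_eq, not_or, not_forall] at hb
    obtain ⟨hb1, a, ha, hab⟩ := hb
    refine ⟨a, ha, ?_⟩
    have hne : a ≠ b := fun e => hb1 (e ▸ ha)
    exact (hT.2.2 a b hne).resolve_left hab
  · have e1 : {u | ∀ b ∈ l, adj b u}.ncard
        = (Finset.univ.filter (fun u => ∀ b ∈ l, adj b u)).card := by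
      rw [← Set.ncard_coe_finset]; simp
    have e2 : {u | adj v u}.ncard = (Finset.univ.filter (fun u => adj v u)).card := by
      rw [← Set.ncard_coe_finset]; simp
    rw [e1, e2, one_div, inv_pow, inv_mul_eq_div, le_div_iff₀ (by positivity), mul_comm]
    exact_mod_cast hcard
end

section
/- Let k and ℓ be positive integers and let T be a tournament whose vertex set is the disjoint union V(T) = Q_1 ∪ … ∪ Q_ℓ, with |Q_j| ≥ k+1 for all j ∈ {1, …, ℓ}, and such that for each j the induced subtournament T[Q_j] is a backwards-transitive path. Then there exist sets U, W, U', W' with: (i) U ⊆ U' ⊆ V(T) and W ⊆ W' ⊆ V(T); (ii) |U|, |W| ≤ 2k(k+1) and |U'|, |W'| = ℓ(k+1); (iii) for every set S ⊆ V(T) of size at most k−1 and for every vertex v ∈ V(T) \ S, there exists a directed path (possibly of length 0) in T[(U' ∪ {v}) \ S] from v to a vertex in U, and a directed path (possibly of length 0) in T[(W' ∪ {v}) \ S] from a vertex in W to v. -/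
/-!
Common definitions: tournaments as irreflexive, asymmetric, total relations on a
finite vertex type; reachability/strong connectivity inside induced subtournaments;
directed paths and cycles as lists of vertices; linkedness; transitivity; domination.
All logarithms are base 2 (`Real.logb 2`).
-/

variable {V : Type*}

open Classical in
theorem exists_min_subset {α : Type*} (f : α → ℕ) (s : Finset α) (n : ℕ) (hn : n ≤ s.card) :
    ∃ t ⊆ s, t.card = n ∧ ∀ a ∈ t, ∀ b ∈ s, b ∉ t → f a ≤ f b := by
  induction n with
  | zero => exact ⟨∅, by simp, by simp, by simp⟩
  | succ n ih =>
    obtain ⟨t, hts, hc, ht⟩ := ih (by omega)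
    have hne : (s \ t).Nonempty := by
      rw [← Finset.card_pos, Finset.card_sdiff_of_subset hts]; omega
    obtain ⟨m, hm, hmin⟩ := Finset.exists_min_image (s \ t) f hne
    rw [Finset.mem_sdiff] at hm
    refine ⟨insert m t, ?_, ?_, ?_⟩
    · intro x hx
      rw [Finset.mem_insert] at hx
      rcases hx with rfl | hx
      exacts [hm.1, hts hx]
    · rw [Finset.card_insert_of_notMem hm.2, hc]
    · intro a ha b hb hbt
      rw [Finset.mem_insert, not_or] at hbt
      rw [Finset.mem_insert] at ha
      rcases ha with rfl | ha
      · exact hmin b (Finset.mem_sdiff.2 ⟨hb, hbt.2⟩)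
      · exact ht a ha b hb hbt.2

open Classical in
theorem tournament_sum {adj : V → V → Prop} (hT : IsTournament adj) (t : Finset V) :
    2 * ∑ x ∈ t, (t.filter (fun y => adj x y)).card = t.card * (t.card - 1) := by
  have h1 : ∑ x ∈ t, (t.filter (fun y => adj x y)).card
      = ∑ x ∈ t, (t.filter (fun y => adj y x)).card :=
    Finset.sum_card_bipartiteAbove_eq_sum_card_bipartiteBelow adj
  have h2 : ∀ x ∈ t, (t.filter (fun y => adj x y)).card + (t.filter (fun y => adj y x)).card
      = t.card - 1 := by
    intro x hx
    rw [← Finset.card_union_of_disjoint, ← Finset.card_erase_of_mem hx]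
    · congr 1
      ext y
      have a := hT.1 x
      have b := hT.2.2 x y
      simp only [Finset.mem_union, Finset.mem_filter, Finset.mem_erase]
      constructor
      · rintro (⟨h, h'⟩ | ⟨h, h'⟩)
        · exact ⟨fun e => a (e ▸ h'), h⟩
        · exact ⟨fun e => a (e ▸ h'), h⟩
      · rintro ⟨h, h'⟩
        rcases b (Ne.symm h) with c | c
        · exact Or.inl ⟨h', c⟩
        · exact Or.inr ⟨h', c⟩
    · rw [Finset.disjoint_left]
      intro y hy hy'
      exact hT.2.1 _ _ (Finset.mem_filter.1 hy).2 (Finset.mem_filter.1 hy').2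
  calc 2 * ∑ x ∈ t, (t.filter (fun y => adj x y)).card
      = ∑ x ∈ t, ((t.filter (fun y => adj x y)).card + (t.filter (fun y => adj y x)).card) := by
        rw [Finset.sum_add_distrib, ← h1, two_mul]
    _ = ∑ x ∈ t, (t.card - 1) := Finset.sum_congr rfl h2
    _ = _ := by simp

open Classical in
theorem escape {adj : V → V → Prop} (hT : IsTournament adj) (k : ℕ) (hk : 1 ≤ k)
    (A U S X : Finset V) (hUA : U ⊆ A) (hU : U.card = 2 * k)
    (hmin : ∀ a ∈ U, ∀ b ∈ A, b ∉ U →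
      (A.filter (fun y => adj a y)).card ≤ (A.filter (fun y => adj b y)).card)
    (hS : S.card ≤ k - 1) (hXA : X ⊆ A) (hXU : Disjoint X U) (hXS : Disjoint X S)
    (hne : X.Nonempty)
    (hcl : ∀ x ∈ X, ∀ y ∈ A, adj x y → y ∈ X ∨ y ∈ S) : False := by
  set D : V → ℕ := fun a => (A.filter (fun y => adj a y)).card with hD
  have hXp : 0 < X.card := hne.card_pos
  have e1 := tournament_sum hT U
  have e2 := tournament_sum hT X
  have l1 : ∑ x ∈ X, D x ≤ ∑ x ∈ X, (X.filter (fun y => adj x y)).card + X.card * S.card := by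
    rw [← smul_eq_mul, ← Finset.sum_const, ← Finset.sum_add_distrib]
    apply Finset.sum_le_sum
    intro x hx
    refine le_trans (Finset.card_le_card ?_) (Finset.card_union_le _ _)
    intro y hy
    rw [Finset.mem_filter] at hy
    rw [Finset.mem_union, Finset.mem_filter]
    rcases hcl x hx y hy.1 hy.2 with h | h
    · exact Or.inl ⟨h, hy.2⟩
    · exact Or.inr h
  have l2 : ∑ u ∈ U, (U.filter (fun y => adj u y)).card + (U \ S).card * X.card
      ≤ ∑ u ∈ U, D u := by
    have : (U \ S).card * X.card = ∑ u ∈ U, if u ∈ S then 0 else X.card := by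
      rw [Finset.sum_ite]
      simp [Finset.filter_notMem_eq_sdiff]
    rw [this, ← Finset.sum_add_distrib]
    apply Finset.sum_le_sum
    intro u hu
    by_cases huS : u ∈ S
    · simp only [huS, if_true, add_zero]
      exact Finset.card_le_card (Finset.filter_subset_filter _ hUA)
    · simp only [huS, if_false]
      rw [← Finset.card_union_of_disjoint]
      · apply Finset.card_le_card
        intro y hy
        rw [Finset.mem_union, Finset.mem_filter] at hy
        rw [Finset.mem_filter]
        rcases hy with hy | hy
        · exact ⟨hUA hy.1, hy.2⟩
        · refine ⟨hXA hy, ?_⟩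
          have huX : u ∉ X := Finset.disjoint_right.1 hXU hu
          rcases hT.2.2 u y (fun e => huX (e ▸ hy)) with h | h
          · exact h
          · rcases hcl y hy u (hUA hu) h with h | h
            · exact absurd h huX
            · exact absurd h huS
      · exact (hXU.symm).mono_left (Finset.filter_subset _ _)
  have l3 : X.card * ∑ u ∈ U, D u ≤ U.card * ∑ x ∈ X, D x := by
    calc X.card * ∑ u ∈ U, D u = ∑ x ∈ X, ∑ u ∈ U, D u := by simp
      _ ≤ ∑ x ∈ X, ∑ u ∈ U, D x := by
        refine Finset.sum_le_sum fun x hx => Finset.sum_le_sum fun u hu => ?_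
        exact hmin u hu x (hXA hx) (Finset.disjoint_left.1 hXU hx)
      _ = U.card * ∑ x ∈ X, D x := by simp [Finset.mul_sum]
  have l4 : k + 1 ≤ (U \ S).card := by
    have := Finset.le_card_sdiff S U
    omega
  generalize ∑ u ∈ U, D u = a at *
  generalize ∑ x ∈ X, D x = b at *
  generalize ∑ u ∈ U, (U.filter (fun y => adj u y)).card = c at *
  generalize ∑ u ∈ X, (X.filter (fun y => adj u y)).card = d at *
  generalize X.card = x at *
  generalize S.card = s at *
  generalize (U \ S).card = w at *
  rw [hU] at e1 l3
  obtain ⟨k, rfl⟩ : ∃ m, k = m + 1 := ⟨k - 1, by omega⟩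
  obtain ⟨x, rfl⟩ : ∃ m, x = m + 1 := ⟨x - 1, by omega⟩
  have e1' : 2 * (k + 1) - 1 = 2 * k + 1 := by omega
  rw [e1'] at e1
  simp only [Nat.add_sub_cancel] at e2 hS
  have hc : c = (k + 1) * (2 * k + 1) := by nlinarith
  have m1 : (x + 1) * s ≤ (x + 1) * k := Nat.mul_le_mul_left _ hS
  have m2 : (k + 1 + 1) * (x + 1) ≤ w * (x + 1) := Nat.mul_le_mul_right _ l4
  have m3 : (k + 1) * (2 * k + 1) + (k + 2) * (x + 1) ≤ a := by nlinarith
  have m4 : 2 * b ≤ (x + 1) * x + 2 * ((x + 1) * k) := by nlinarith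
  have m5 : (x + 1) * ((k + 1) * (2 * k + 1) + (k + 2) * (x + 1)) ≤ (x + 1) * a :=
    Nat.mul_le_mul_left _ m3
  have m6 : (k + 1) * (2 * b) ≤ (k + 1) * ((x + 1) * x + 2 * ((x + 1) * k)) :=
    Nat.mul_le_mul_left _ m4
  have m7 : (x + 1) * ((k + 1) * (2 * k + 1) + (k + 2) * (x + 1)) ≤
    (x + 1) * ((k + 1) * (x + 2 * k)) := by nlinarith
  have m8 := Nat.le_of_mul_le_mul_left m7 (by omega)
  nlinarith

open Classical in
theorem half [Fintype V] (adj : V → V → Prop) (hT : IsTournament adj)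
    (k l : ℕ) (hk : 1 ≤ k)
    (Q : Fin l → Set V)
    (hcover : (⋃ j, Q j) = Set.univ)
    (hdisj : Pairwise fun i j => Disjoint (Q i) (Q j))
    (hA : ∀ j, ∃ A : Finset V, (∀ a ∈ A, a ∈ Q j) ∧ A.card = k + 1 ∧
      ∀ v ∈ Q j, v ∉ A → k ≤ (A.filter (fun y => adj v y)).card) :
    ∃ U U' : Set V,
      U ⊆ U' ∧ U.ncard ≤ 2 * k * (k + 1) ∧ U'.ncard = l * (k + 1) ∧
      ∀ S : Set V, S.ncard ≤ k - 1 → ∀ v ∉ S,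
        (∃ u ∈ U, ReachIn adj ((U' ∪ {v}) \ S) v u) := by
  choose A hAQ hAc hAd using hA
  set B : Finset V := Finset.univ.biUnion A with hB
  have hBc : B.card = l * (k + 1) := by
    rw [hB, Finset.card_biUnion]
    · simp [hAc]
    · intro i _ j _ hij
      refine Finset.disjoint_left.2 ?_
      intro a ha ha'
      exact Set.disjoint_left.1 (hdisj hij) (hAQ i a ha) (hAQ j a ha')
  -- each vertex outside has a surviving out-neighbour
  have hout : ∀ S : Set V, S.ncard ≤ k - 1 → ∀ v, v ∉ B → ∃ b ∈ B, b ∉ S ∧ adj v b := by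
    intro S hS v hv
    obtain ⟨j, hj⟩ : ∃ j, v ∈ Q j := by
      have : v ∈ ⋃ j, Q j := by rw [hcover]; trivial
      simpa using this
    have hvA : v ∉ A j := fun h => hv (Finset.mem_biUnion.2 ⟨j, Finset.mem_univ _, h⟩)
    have hc := hAd j v hj hvA
    rw [Set.ncard_eq_toFinset_card'] at hS
    obtain ⟨b, hb, hbS⟩ := Finset.exists_mem_notMem_of_card_lt_card
      (s := S.toFinset) (t := (A j).filter (fun y => adj v y)) (by omega)
    rw [Finset.mem_filter] at hb
    exact ⟨b, Finset.mem_biUnion.2 ⟨j, Finset.mem_univ _, hb.1⟩, by simpa using hbS, hb.2⟩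
  -- it suffices to treat vertices inside
  have key : ∃ U ⊆ B, U.card ≤ 2 * k * (k + 1) ∧ ∀ S : Set V, S.ncard ≤ k - 1 →
      ∀ v ∈ B, v ∉ S → ∃ u ∈ U, ReachIn adj ((B : Set V) \ S) v u := by
    by_cases h2 : B.card < 2 * k
    · exact ⟨B, subset_rfl, by nlinarith, fun S hS v hv _ => ⟨v, hv, Relation.ReflTransGen.refl⟩⟩
    · obtain ⟨U, hUB, hUc, hUm⟩ := exists_min_subset
        (fun a => (B.filter (fun y => adj a y)).card) B (2 * k) (by omega)
      refine ⟨U, hUB, by nlinarith, fun S hS v hv hvS => ?_⟩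
      by_contra hcon
      push Not at hcon
      rw [Set.ncard_eq_toFinset_card'] at hS
      have hmem : ∀ x, ReachIn adj ((B : Set V) \ S) v x → x ∈ B ∧ x ∉ S := by
        intro x hx
        rcases Relation.ReflTransGen.cases_tail hx with h | ⟨c, _, h⟩
        · subst h; exact ⟨hv, hvS⟩
        · exact ⟨by simpa using h.2.1.1, h.2.1.2⟩
      refine escape hT k hk B U S.toFinset
        (Finset.univ.filter (fun x => ReachIn adj ((B : Set V) \ S) v x)) hUB hUc hUm hS
        ?_ ?_ ?_ ⟨v, by simp only [Finset.mem_filter, Finset.mem_univ, true_and]; exact Relation.ReflTransGen.refl⟩ ?_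
      · intro x hx
        exact (hmem x (Finset.mem_filter.1 hx).2).1
      · rw [Finset.disjoint_left]
        intro x hx hxU
        exact hcon x hxU (Finset.mem_filter.1 hx).2
      · rw [Finset.disjoint_left]
        intro x hx hxS
        exact (hmem x (Finset.mem_filter.1 hx).2).2 (by simpa using hxS)
      · intro x hx y hy hxy
        have hr := (Finset.mem_filter.1 hx).2
        by_cases hyS : y ∈ S
        · right; simpa using hyS
        · left
          rw [Finset.mem_filter]
          exact ⟨Finset.mem_univ _, Relation.ReflTransGen.tail hr
            ⟨⟨by simpa using (hmem x hr).1, (hmem x hr).2⟩, ⟨by simpa using hy, hyS⟩, hxy⟩⟩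
  obtain ⟨U, hUB, hUc, hU⟩ := key
  refine ⟨U, B, by simpa using hUB, by simpa using hUc, by simpa using hBc, fun S hS v hv => ?_⟩
  have mono : ∀ x y, ReachIn adj ((B : Set V) \ S) x y →
      ReachIn adj (((B : Set V) ∪ {v}) \ S) x y := by
    intro x y h
    refine Relation.ReflTransGen.mono ?_ _ _ h
    intro a b ⟨h1, h2, h3⟩
    exact ⟨⟨Or.inl h1.1, h1.2⟩, ⟨Or.inl h2.1, h2.2⟩, h3⟩
  by_cases hvB : v ∈ B
  · obtain ⟨u, hu, hr⟩ := hU S hS v hvB hv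
    exact ⟨u, by simpa using hu, mono _ _ hr⟩
  · obtain ⟨b, hb, hbS, hab⟩ := hout S hS v hvB
    obtain ⟨u, hu, hr⟩ := hU S hS b hb hbS
    exact ⟨u, by simpa using hu, Relation.ReflTransGen.head
      ⟨⟨Or.inr rfl, hv⟩, ⟨Or.inl (by simpa using hb), hbS⟩, hab⟩ (mono _ _ hr)⟩

open Classical in
theorem first_part {adj : V → V → Prop} (k : ℕ) (Q : Set V)
    (hs : k + 1 ≤ Q.ncard) (hQ : IsBackTransPathSet adj Q) :
    ∃ A : Finset V, (∀ a ∈ A, a ∈ Q) ∧ A.card = k + 1 ∧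
      ∀ v ∈ Q, v ∉ A → k ≤ (A.filter (fun y => adj v y)).card := by
  obtain ⟨L, -, hnd, hm, hb⟩ := hQ
  have hlen : k + 1 ≤ L.length := by
    have : Q = (L.toFinset : Set V) := by ext x; simp [hm]
    rw [this, Set.ncard_coe_finset, List.toFinset_card_of_nodup hnd] at hs
    exact hs
  refine ⟨(L.take (k + 1)).toFinset, ?_, ?_, ?_⟩
  · intro a ha
    rw [List.mem_toFinset] at ha
    exact (hm a).1 (List.mem_of_mem_take ha)
  · rw [List.toFinset_card_of_nodup (hnd.sublist (List.take_sublist _ _)), List.length_take]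
    omega
  · intro v hv hvA
    rw [List.mem_toFinset] at hvA
    obtain ⟨i, hi, rfl⟩ := List.mem_iff_getElem.1 ((hm v).2 hv)
    have hik : k + 1 ≤ i := by
      by_contra h
      exact hvA (List.mem_take_iff_getElem.2 ⟨i, by omega, rfl⟩)
    have hsub : (L.take k).toFinset ⊆
        (L.take (k + 1)).toFinset.filter (fun y => adj L[i] y) := by
      intro y hy
      rw [List.mem_toFinset, List.mem_take_iff_getElem] at hy
      obtain ⟨j, hj, rfl⟩ := hy
      rw [Finset.mem_filter, List.mem_toFinset]
      refine ⟨List.mem_take_iff_getElem.2 ⟨j, by omega, rfl⟩, ?_⟩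
      have := (hb ⟨i, hi⟩ ⟨j, by omega⟩).2 (Or.inr (by simp only; omega))
      simpa using this
    have := Finset.card_le_card hsub
    rw [List.toFinset_card_of_nodup (hnd.sublist (List.take_sublist _ _)), List.length_take] at this
    omega

theorem backTrans_swap {adj : V → V → Prop} {Q : Set V} (hQ : IsBackTransPathSet adj Q) :
    IsBackTransPathSet (fun a b => adj b a) Q := by
  obtain ⟨L, hne, hnd, hm, hb⟩ := hQ
  refine ⟨L.reverse, by simpa using hne, by simpa using hnd, by simpa using hm, ?_⟩
  intro i j
  have hi : (i : ℕ) < L.length := by simpa using i.2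
  have hj : (j : ℕ) < L.length := by simpa using j.2
  have := hb ⟨L.length - 1 - j, by omega⟩ ⟨L.length - 1 - i, by omega⟩
  simp only [List.get_eq_getElem, List.getElem_reverse] at this ⊢
  rw [this]
  omega

theorem tournament_swap {adj : V → V → Prop} (hT : IsTournament adj) :
    IsTournament (fun a b => adj b a) :=
  ⟨hT.1, fun u v h => hT.2.1 v u h, fun u v h => (hT.2.2 u v h).symm⟩

theorem reachIn_swap {adj : V → V → Prop} {U : Set V} {x y : V}
    (h : ReachIn (fun a b => adj b a) U x y) : ReachIn adj U y x := by
  unfold ReachIn at *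
  rw [← Relation.reflTransGen_swap]
  refine Relation.ReflTransGen.mono ?_ _ _ h
  intro a b ⟨h1, h2, h3⟩
  exact ⟨h2, h1, h3⟩

/-- If the vertex set of a tournament is partitioned into `ℓ` sets
`Q₁,…,Q_ℓ` of size at least `k+1`, each inducing a backwards-transitive path, then there are
sets `U ⊆ U'` and `W ⊆ W'` with `|U|,|W| ≤ 2k(k+1)` and `|U'| = |W'| = ℓ(k+1)` such that for
every set `S` of at most `k-1` vertices and every vertex `v ∉ S` there is a directed path
(possibly trivial) inside `(U' ∪ {v}) \ S` from `v` to `U`, and one inside `(W' ∪ {v}) \ S`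
from `W` to `v`. -/
theorem stmt8 [Fintype V] (adj : V → V → Prop) (hT : IsTournament adj)
    (k l : ℕ) (hk : 1 ≤ k) (hl : 1 ≤ l)
    (Q : Fin l → Set V)
    (hcover : (⋃ j, Q j) = Set.univ)
    (hdisj : Pairwise fun i j => Disjoint (Q i) (Q j))
    (hsize : ∀ j, k + 1 ≤ (Q j).ncard)
    (hbt : ∀ j, IsBackTransPathSet adj (Q j)) :
    ∃ U U' W W' : Set V,
      U ⊆ U' ∧ W ⊆ W' ∧
      U.ncard ≤ 2 * k * (k + 1) ∧ W.ncard ≤ 2 * k * (k + 1) ∧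
      U'.ncard = l * (k + 1) ∧ W'.ncard = l * (k + 1) ∧
      ∀ S : Set V, S.ncard ≤ k - 1 → ∀ v ∉ S,
        (∃ u ∈ U, ReachIn adj ((U' ∪ {v}) \ S) v u) ∧
        (∃ w ∈ W, ReachIn adj ((W' ∪ {v}) \ S) w v) := by
  obtain ⟨U, U', h1, h2, h3, h4⟩ := half adj hT k l hk Q hcover hdisj
    (fun j => first_part k (Q j) (hsize j) (hbt j))
  obtain ⟨W, W', g1, g2, g3, g4⟩ := half _ (tournament_swap hT) k l hk Q hcover hdisj
    (fun j => first_part k (Q j) (hsize j) (backTrans_swap (hbt j)))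
  refine ⟨U, U', W, W', h1, g1, h2, g2, h3, g3, fun S hS v hv => ⟨h4 S hS v hv, ?_⟩⟩
  obtain ⟨w, hw, hr⟩ := g4 S hS v hv
  exact ⟨w, hw, reachIn_swap hr⟩
end
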